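/- Let λ be a fixed nonzero real number and ε > 0. There is a constant C such that for all sufficiently large X the following holds: if Z and α are real numbers with X^{1/3 − 1/36 + 2ε} ≤ Z ≤ X^{1/3} and |S₃(λα)| > Z, then there exist coprime integers a and q with 1 ≤ q ≤ C (X^{1/3+ε}/Z)² and |qλα − a| ≤ C X^{−1} (X^{1/3+ε}/Z)². -/

import Mathlib

open MeasureTheory Finset
open scoped Classical

/-- `e(x) = exp(2πix)`. -/
noncomputable def e (x : ℝ) : ℂ := Complex.exp (2 * Real.pi * Complex.I * x)

/-- Fejér-type kernel `K_τ(α)`. -/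
noncomputable def Kf (τ α : ℝ) : ℝ :=
  if α = 0 then τ ^ 2 else (Real.sin (Real.pi * τ * α) / (Real.pi * α)) ^ 2

/-- `ψ(m,z) = 1` if every prime factor of `m` is `≥ z`, else `0`. -/
noncomputable def psi (m : ℕ) (z : ℝ) : ℝ :=
  if ∀ p : ℕ, p.Prime → p ∣ m → z ≤ (p : ℝ) then 1 else 0

/-- `z(p)` in the sieve weights. -/
noncomputable def zP (X : ℝ) (p : ℕ) : ℝ :=
  if (p : ℝ) < X ^ ((1:ℝ)/7) then X ^ ((5:ℝ)/28) * (p : ℝ) ^ (-(1:ℝ)/2)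
  else if (p : ℝ) ≤ X ^ ((3:ℝ)/14) then (p : ℝ)
  else X ^ ((5:ℝ)/14) / (p : ℝ)

/-- The sieve function `ρ(m)` of Harman–Kumchev. -/
noncomputable def rho (X : ℝ) (m : ℕ) : ℝ :=
  psi m (X ^ ((5:ℝ)/42)) -
    ∑ p ∈ m.primeFactors.filter
        (fun p : ℕ => X ^ ((5:ℝ)/42) ≤ (p:ℝ) ∧ (p:ℝ) ≤ X ^ ((1:ℝ)/4)),
      psi (m / p) (zP X p)

/-- `S_k(α) = Σ_{p ∈ [(ηX)^{1/k}, X^{1/k}]} (log p) e(p^k α)`, sum over primes. -/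
noncomputable def SS (η X : ℝ) (k : ℕ) (α : ℝ) : ℂ :=
  ∑ p ∈ (Finset.Icc 1 ⌊X ^ ((1:ℝ)/(k:ℝ))⌋₊).filter
      (fun p : ℕ => p.Prime ∧ (η * X) ^ ((1:ℝ)/(k:ℝ)) ≤ (p : ℝ)),
    (Real.log p : ℂ) * e ((p : ℝ) ^ k * α)

/-- `S₂(α, ρ) = Σ_{m ∈ [(ηX)^{1/2}, X^{1/2}]} ρ(m) e(m²α)`. -/
noncomputable def S2 (η X α : ℝ) : ℂ :=
  ∑ m ∈ (Finset.Icc 1 ⌊X ^ ((1:ℝ)/2)⌋₊).filter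
      (fun m : ℕ => (η * X) ^ ((1:ℝ)/2) ≤ (m : ℝ)),
    (rho X m : ℂ) * e ((m : ℝ) ^ 2 * α)

/-- `S_r(α)` for real `r ≥ 1`. -/
noncomputable def Sr (η X r α : ℝ) : ℂ :=
  ∑ p ∈ (Finset.Icc 1 ⌊X ^ (1/r)⌋₊).filter
      (fun p : ℕ => p.Prime ∧ (η * X) ^ (1/r) ≤ (p : ℝ)),
    (Real.log p : ℂ) * e ((p : ℝ) ^ r * α)

/-- `U_r(α)` for real `r ≥ 1`. -/
noncomputable def Ur (η X r α : ℝ) : ℂ :=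
  ∑ n ∈ (Finset.Icc 1 ⌊X ^ (1/r)⌋₊).filter
      (fun n : ℕ => (η * X) ^ (1/r) ≤ (n : ℝ)),
    e ((n : ℝ) ^ r * α)

/-- Chebyshev's function `θ(x) = Σ_{p ≤ x} log p`. -/
noncomputable def theta (x : ℝ) : ℝ :=
  ∑ p ∈ (Finset.Icc 1 ⌊x⌋₊).filter Nat.Prime, Real.log p

/-- `J_r(X,h)`. -/
noncomputable def J (ε r X h : ℝ) : ℝ :=
  ∫ x in Set.Icc (ε * X) X,
    (theta ((x + h) ^ (1/r)) - theta (x ^ (1/r)) - ((x + h) ^ (1/r) - x ^ (1/r))) ^ 2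

/-- `T_n(α) = ∫_{(ηX)^{1/n}}^{X^{1/n}} e(t^n α) dt`. -/
noncomputable def T (η X : ℝ) (n : ℕ) (α : ℝ) : ℂ :=
  ∫ t in Set.Icc ((η * X) ^ ((1:ℝ)/(n:ℝ))) (X ^ ((1:ℝ)/(n:ℝ))), e (t ^ n * α)

/-- `m₁(k)`. -/
noncomputable def m1 (k : ℕ) : ℝ :=
  if k = 5 then 2 * (⌈343 * (k:ℝ) / 50 - 20⌉ : ℝ)
  else 2 * (⌈(49 * (k:ℝ) / 50 - (⌊49 * (k:ℝ) / 50⌋ : ℝ) / 2)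
      * ((⌊49 * (k:ℝ) / 50⌋ : ℝ) + 1)⌉ : ℝ)

/-- `σ(k) = 44/45 − 24/(25 m₁(k))`. -/
noncomputable def sigma' (k : ℕ) : ℝ := 44/45 - 24 / (25 * m1 k)

/-- `m(k)` depending on `δ`. -/
noncomputable def mδ (k : ℕ) (δ : ℝ) : ℝ :=
  if ⌊(k:ℝ) * δ⌋ ≤ 3 then
    2 * (⌈((k:ℝ) * δ + 1 - (⌊(k:ℝ) * δ⌋ : ℝ)) * (2:ℝ) ^ (⌊(k:ℝ) * δ - 1⌋)⌉ : ℝ)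
  else if ⌊(k:ℝ) * δ⌋ = 4 then 2 * (⌈7 * (k:ℝ) * δ - 20⌉ : ℝ)
  else 2 * (⌈((k:ℝ) * δ - (⌊(k:ℝ) * δ⌋ : ℝ)/2) * ((⌊(k:ℝ) * δ⌋ : ℝ) + 1)⌉ : ℝ)

/-- `m₂(k)`. -/
noncomputable def m2 (k : ℕ) : ℝ :=
  if k = 5 then
    2 * (⌈(2 * (k:ℝ)/3 + 1 - (⌊2 * (k:ℝ)/3⌋ : ℝ)) * (2:ℝ) ^ (⌊2 * (k:ℝ)/3⌋ - 1)⌉ : ℝ)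
  else if k ≤ 7 then 2 * (⌈14 * (k:ℝ)/3 - 20⌉ : ℝ)
  else 2 * (⌈(2 * (k:ℝ)/3 - (⌊2 * (k:ℝ)/3⌋ : ℝ)/2) * ((⌊2 * (k:ℝ)/3⌋ : ℝ) + 1)⌉ : ℝ)

namespace W3
open MeasureTheory Finset
open scoped Classical

lemma e_add (x y : ℝ) : e (x + y) = e x * e y := by
  unfold e; rw [← Complex.exp_add]; congr 1; push_cast; ring

lemma e_eq (x : ℝ) : e x = Complex.exp (((2 * Real.pi * x : ℝ) : ℂ) * Complex.I) := by
  unfold e; congr 1; push_cast; ring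

lemma e_norm (x : ℝ) : ‖e x‖ = 1 := by
  rw [e_eq]; exact Complex.norm_exp_ofReal_mul_I _

lemma e_int (n : ℤ) : e n = 1 := by
  unfold e; rw [Complex.exp_eq_one_iff]; exact ⟨n, by push_cast; ring⟩

lemma e_zero : e 0 = 1 := by simpa using e_int 0

lemma e_conj (x : ℝ) : (starRingEnd ℂ) (e x) = e (-x) := by
  rw [e_eq, e_eq, ← Complex.exp_conj]; congr 1
  rw [map_mul, Complex.conj_ofReal, Complex.conj_I]; push_cast; ring

lemma e_add_int (x : ℝ) (n : ℤ) : e (x + n) = e x := by rw [e_add, e_int, mul_one]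

lemma e_congr {x y : ℝ} (n : ℤ) (h : x = y + n) : e x = e y := by rw [h, e_add_int]

lemma e_sub_one (x : ℝ) : ‖e x - 1‖ = 2 * |Real.sin (Real.pi * x)| := by
  rw [e_eq, mul_comm, Complex.norm_exp_I_mul_ofReal_sub_one]
  rw [norm_mul, Real.norm_eq_abs, Real.norm_eq_abs, abs_two]; congr 3; ring

lemma e_sub_le (x y : ℝ) : ‖e x - e y‖ ≤ 7 * |x - y| := by
  have h : e x - e y = e y * (e (x - y) - 1) := by
    rw [mul_sub, ← e_add]; simp
  rw [h, norm_mul, e_norm, one_mul, e_sub_one]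
  have := Real.abs_sin_le_abs (x := Real.pi * (x - y))
  rw [abs_mul, abs_of_pos Real.pi_pos] at this
  have := Real.pi_lt_d2
  nlinarith [abs_nonneg (x - y)]

lemma e_sub_one_ge (x : ℝ) : 4 * |x - round x| ≤ ‖e x - 1‖ := by
  have h1 : e x = e (x - round x) := e_congr (round x) (by ring)
  rw [h1, e_sub_one]
  have hr := abs_sub_round x
  have := Real.mul_abs_le_abs_sin (x := Real.pi * (x - round x)) (by
    rw [abs_mul, abs_of_pos Real.pi_pos]; nlinarith [Real.pi_pos])
  rw [abs_mul, abs_of_pos Real.pi_pos] at this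
  have h2 : 2 / Real.pi * (Real.pi * |x - round x|) = 2 * |x - round x| := by
    field_simp
  linarith

lemma geom_le (θ c : ℝ) (u v : ℤ) (hθ : 0 < |θ - round θ|) :
    ‖∑ n ∈ Ioc u v, e (θ * n + c)‖ ≤ 1 / (2 * |θ - round θ|) := by
  have key : (∑ n ∈ Ioc u v, e (θ * n + c)) * (e θ - 1) = if u ≤ v then e (θ * (v+1) + c) - e (θ * (u+1) + c) else 0 := by
    split_ifs with h
    · induction v, h using Int.le_induction with
      | base => simp
      | succ v hv ih =>
        have hh : Ioc u (v+1) = insert (v+1) (Ioc u v) := by ext; simp; omega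
        rw [hh, sum_insert (by simp), add_mul, ih]
        have : e (θ * (↑(v+1) + 1) + c) = e (θ * ↑(v+1) + c) * e θ := by rw [← e_add]; congr 1; ring
        rw [this]; push_cast; ring
    · rw [Finset.Ioc_eq_empty (by omega)]; simp
  have h1 : ‖∑ n ∈ Ioc u v, e (θ * n + c)‖ * ‖e θ - 1‖ ≤ 2 := by
    rw [← norm_mul, key]
    split_ifs
    · refine (norm_sub_le _ _).trans ?_; rw [e_norm, e_norm]; norm_num
    · simp
  have h2 := e_sub_one_ge θ
  rw [le_div_iff₀ (by positivity)]
  nlinarith [norm_nonneg (∑ n ∈ Ioc u v, e (θ * n + c))]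

/-- block count -/
lemma cnt_block (γ : ℝ) (b : ℤ) (r : ℕ) (hr : 0 < r) (hc : Int.gcd b r = 1)
    (hb : |γ * r - b| ≤ 1 / r) (κ : ℝ) (hκ : 0 ≤ κ) (v0 : ℤ) (S : Finset ℤ)
    (hS : ∀ v ∈ S, v0 ≤ v ∧ v < v0 + r ∧ |γ * v - round (γ * v)| ≤ κ) :
    (S.card : ℝ) ≤ 2 * κ * r + 3 := by
  have hr' : (0:ℝ) < r := by exact_mod_cast hr
  set A : ℝ := (b - γ * r) * v0
  have hcard : S.card ≤ (Icc ⌈A - (κ * r + 1)⌉ ⌊A + (κ * r + 1)⌋).card := by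
    refine Finset.card_le_card_of_injOn (fun v => b * v - r * round (γ * v)) ?_ ?_
    · intro v hv
      obtain ⟨h1, h2, h3⟩ := hS v hv
      have : |((b * v - r * round (γ * v) : ℤ):ℝ) - A| ≤ κ * r + 1 := by
        have e1 : ((b * v - r * round (γ * v) : ℤ):ℝ) - A = r * (γ * v - round (γ * v)) - (γ * r - b) * (v - v0) := by
          push_cast; simp only [A]; ring
        rw [e1]
        refine (abs_sub _ _).trans ?_
        rw [abs_mul, abs_mul, abs_of_pos hr']
        have : |((v:ℝ) - v0)| ≤ r := by
          have h1' : (v0:ℝ) ≤ v := by exact_mod_cast h1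
          have h2' : (v:ℝ) < v0 + r := by exact_mod_cast h2
          rw [abs_le]; constructor <;> linarith
        have h5 : |γ * r - b| * |((v:ℝ) - v0)| ≤ 1 / r * r := mul_le_mul hb this (abs_nonneg _) (by positivity)
        rw [one_div, inv_mul_cancel₀ hr'.ne'] at h5
        nlinarith
      rw [abs_le] at this
      simp only [coe_Icc, Set.mem_Icc, Int.ceil_le, Int.le_floor]
      constructor <;> linarith
    · intro v hv v' hv' heq
      obtain ⟨h1, h2, _⟩ := hS v hv
      obtain ⟨h1', h2', _⟩ := hS v' hv'
      simp only at heq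
      have hd : (r:ℤ) ∣ b * (v - v') := ⟨round (γ * v) - round (γ * v'), by linarith⟩
      have hd2 : (r:ℤ) ∣ v - v' := (Int.isCoprime_iff_gcd_eq_one.mpr hc).symm.dvd_of_dvd_mul_left hd
      have := Int.eq_zero_of_abs_lt_dvd hd2 (by rw [abs_lt]; constructor <;> omega)
      omega
  have h4 : ((Icc ⌈A - (κ * r + 1)⌉ ⌊A + (κ * r + 1)⌋).card : ℝ) ≤ 2 * κ * r + 3 := by
    rw [Int.card_Icc]
    have hk : (0:ℝ) ≤ κ * r := by positivity
    have f1 := Int.floor_le (A + (κ * r + 1))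
    have f2 := Int.le_ceil (A - (κ * r + 1))
    have : ((⌊A + (κ * r + 1)⌋ + 1 - ⌈A - (κ * r + 1)⌉).toNat : ℝ) = max ((⌊A + (κ * r + 1)⌋ + 1 - ⌈A - (κ * r + 1)⌉ : ℤ):ℝ) 0 := by
      rw [← Int.cast_natCast, Int.toNat_eq_max]; push_cast; rfl
    rw [this]; push_cast
    apply max_le <;> linarith
  exact (by exact_mod_cast hcard : (S.card:ℝ) ≤ _).trans h4

end W3

namespace W3
open MeasureTheory Finset
open scoped Classical

lemma card_fib {α β : Type*} [DecidableEq β] (s : Finset α) (t : Finset β) (f : α → β) (n : ℝ)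
    (hf : ∀ a ∈ s, f a ∈ t) (hn : ∀ b ∈ t, ((s.filter (fun a => f a = b)).card : ℝ) ≤ n) :
    (s.card : ℝ) ≤ t.card * n := by
  rw [Finset.card_eq_sum_card_fiberwise (f := f) (t := t) hf]
  push_cast
  refine (Finset.sum_le_sum hn).trans ?_
  simp

lemma cnt (γ : ℝ) (b : ℤ) (r : ℕ) (hr : 0 < r) (hc : Int.gcd b r = 1)
    (hb : |γ * r - b| ≤ 1 / r) (κ : ℝ) (hκ : 0 ≤ κ) (V : ℝ) (hV : 0 ≤ V) (S : Finset ℤ)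
    (hS : ∀ v ∈ S, 1 ≤ v ∧ (v:ℝ) ≤ V ∧ |γ * v - round (γ * v)| ≤ κ) :
    (S.card : ℝ) ≤ (V / r + 1) * (2 * κ * r + 3) := by
  have hr' : (0:ℝ) < r := by exact_mod_cast hr
  have hrz : (0:ℤ) < r := by exact_mod_cast hr
  have h1 := card_fib S (Icc (0:ℤ) ⌊V / r⌋) (fun v => v / r) (2 * κ * r + 3) (by
    intro v hv
    obtain ⟨h1, h2, -⟩ := hS v hv
    rw [mem_Icc]
    refine ⟨Int.ediv_nonneg (by omega) hrz.le, Int.le_floor.2 ?_⟩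
    rw [le_div_iff₀ hr']
    refine le_trans ?_ h2
    exact_mod_cast Int.ediv_mul_le v hrz.ne') (by
    intro c hcc
    refine cnt_block γ b r hr hc hb κ hκ (c * r) _ ?_
    intro v hv
    rw [mem_filter] at hv
    obtain ⟨hv, rfl⟩ := hv
    refine ⟨Int.ediv_mul_le v hrz.ne', ?_, (hS v hv).2.2⟩
    have := Int.lt_ediv_add_one_mul_self v hrz
    linarith)
  refine h1.trans ?_
  refine mul_le_mul_of_nonneg_right ?_ (by positivity)
  rw [Int.card_Icc]
  have h0 : 0 ≤ ⌊V / r⌋ := Int.floor_nonneg.2 (by positivity)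
  have : ((⌊V/r⌋ + 1 - 0).toNat : ℝ) = ⌊V / r⌋ + 1 := by
    rw [← Int.cast_natCast, Int.toNat_of_nonneg (by omega)]; push_cast; ring
  rw [this]
  linarith [Int.floor_le (V / r)]

lemma dirichlet (γ Q : ℝ) (hQ : 1 ≤ Q) : ∃ (b : ℤ) (r : ℕ), 0 < r ∧ Int.gcd b r = 1 ∧ (r:ℝ) ≤ Q ∧
    |γ * r - b| ≤ 1 / Q := by
  have hn : 0 < ⌊Q⌋₊ := Nat.floor_pos.2 hQ
  obtain ⟨x, hx, hx2⟩ := Real.exists_rat_abs_sub_le_and_den_le γ hn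
  have hd : (0:ℝ) < x.den := by exact_mod_cast x.pos
  refine ⟨x.num, x.den, x.pos, x.reduced, (by exact_mod_cast hx2 : (x.den:ℝ) ≤ ⌊Q⌋₊).trans (Nat.floor_le (by linarith)), ?_⟩
  have : γ * x.den - x.num = (γ - x) * x.den := by
    rw [sub_mul]; congr 1; exact_mod_cast (Rat.mul_den_eq_num x).symm
  rw [this, abs_mul, abs_of_pos hd]
  have h3 : |γ - x| * x.den ≤ 1 / ((⌊Q⌋₊ + 1) * x.den) * x.den := mul_le_mul_of_nonneg_right hx hd.le
  refine h3.trans ?_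
  have : 1 / ((⌊Q⌋₊ + 1) * (x.den:ℝ)) * x.den = 1 / (⌊Q⌋₊ + 1) := by field_simp
  rw [this]
  exact one_div_le_one_div_of_le (by linarith) (Nat.lt_floor_add_one Q).le

lemma CL (α V κ : ℝ) (hV : 1 ≤ V) (hκ : 0 ≤ κ) (S : Finset ℤ)
    (hS : ∀ v ∈ S, 1 ≤ v ∧ (v:ℝ) ≤ V ∧ |α * v - round (α * v)| ≤ κ) (hc : 24 * V * κ < S.card) :
    ∃ (a : ℤ) (q : ℕ), 0 < q ∧ Int.gcd a q = 1 ∧ ∀ v ∈ S, (q:ℤ) ∣ v ∧ |α - a / q| * v ≤ κ := by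
  obtain ⟨a, q, hq, hg, hqV, hb⟩ := dirichlet α (2 * V) (by linarith)
  refine ⟨a, q, hq, hg, ?_⟩
  have hq' : (0:ℝ) < q := by exact_mod_cast hq
  have hkq : κ * q < 1 / 2 := by
    by_contra! hh
    have := cnt α a q hq hg (hb.trans (one_div_le_one_div_of_le hq' hqV)) κ hκ V (by linarith) S hS
    have h2 : (V / q + 1) * (2 * κ * q + 3) ≤ (V / q + 1) * (8 * (κ * q)) := by
      refine mul_le_mul_of_nonneg_left (by linarith) (by positivity)
    have h3 : (V / q + 1) * (8 * (κ * q)) = 8 * V * κ + 8 * κ * q := by field_simp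
    nlinarith
  intro v hv
  obtain ⟨h1, h2, h3⟩ := hS v hv
  have hv' : (0:ℝ) < v := by exact_mod_cast h1
  have hz : a * v - round (α * v) * q = 0 := by
    rw [← Int.abs_lt_one_iff, ← Int.cast_lt (R := ℝ)]
    push_cast
    have : (a:ℝ) * v - round (α * v) * q = q * (α * v - round (α * v)) - (α * q - a) * v := by ring
    rw [this]
    refine (abs_sub _ _).trans_lt ?_
    rw [abs_mul, abs_mul, abs_of_pos hq', abs_of_pos hv']
    have : |α * q - a| * v ≤ 1 / (2 * V) * V := mul_le_mul hb h2 hv'.le (by positivity)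
    have h4 : 1 / (2 * V) * V = 1 / 2 := by field_simp
    nlinarith
  have hav : a * v = round (α * v) * q := by linarith
  refine ⟨?_, ?_⟩
  · refine (Int.isCoprime_iff_gcd_eq_one.mpr hg).symm.dvd_of_dvd_mul_left ⟨round (α * v), by rw [hav]; ring⟩
  · have : (α - a / q) * v = α * v - round (α * v) := by
      have : (a:ℝ) * v = round (α * v) * q := by exact_mod_cast hav
      field_simp; linarith
    rw [← abs_of_pos hv', ← abs_mul, this]; exact h3

lemma dyad (f : ℝ) (k : ℕ) (hf : f < 2 ^ k) :
    f ≤ 1 + ∑ i ∈ range k, if (2:ℝ) ^ i ≤ f then (2:ℝ) ^ i else 0 := by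
  induction k with
  | zero => simp at hf ⊢; linarith
  | succ k ih =>
    by_cases h : f < 2 ^ k
    · rw [sum_range_succ]; have := ih h
      have : (0:ℝ) ≤ if (2:ℝ) ^ k ≤ f then (2:ℝ) ^ k else 0 := by positivity
      linarith
    · push Not at h
      have : ∑ i ∈ range (k+1), (if (2:ℝ) ^ i ≤ f then (2:ℝ) ^ i else 0) = ∑ i ∈ range (k+1), (2:ℝ) ^ i := by
        refine sum_congr rfl fun i hi => if_pos (le_trans ?_ h)
        exact pow_le_pow_right₀ (by norm_num) (by simp at hi; omega)
      rw [this, geom_sum_eq (by norm_num)]; linarith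

lemma minsum (γ : ℝ) (b : ℤ) (r : ℕ) (hr : 0 < r) (hc : Int.gcd b r = 1)
    (hb : |γ * r - b| ≤ 1 / r) (V : ℝ) (hV : 0 ≤ V) (S : Finset ℤ)
    (hS : ∀ v ∈ S, 1 ≤ v ∧ (v:ℝ) ≤ V) (f : ℤ → ℝ) (M : ℝ) (k : ℕ) (hk : 2 ^ k ≤ 2 * M) (hM : M < 2 ^ k)
    (h1 : ∀ v ∈ S, f v ≤ M) (h2 : ∀ v ∈ S, f v * |γ * v - round (γ * v)| ≤ 1) :
    ∑ v ∈ S, f v ≤ V + (V / r + 1) * (2 * r * k + 6 * M) := by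
  have hr' : (0:ℝ) < r := by exact_mod_cast hr
  have hcard : (S.card : ℝ) ≤ V := by
    have : S.card ≤ (Icc (1:ℤ) ⌊V⌋).card := card_le_card fun v hv => by
      rw [mem_Icc, Int.le_floor]; exact hS v hv
    rw [Int.card_Icc, add_sub_cancel_right] at this
    have h0 : 0 ≤ ⌊V⌋ := Int.floor_nonneg.2 hV
    have h5 : ((⌊V⌋.toNat : ℕ) : ℝ) = ⌊V⌋ := by rw [← Int.cast_natCast, Int.toNat_of_nonneg h0]
    have : (S.card : ℝ) ≤ ⌊V⌋ := by rw [← h5]; exact_mod_cast this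
    exact this.trans (Int.floor_le V)
  have step : ∑ v ∈ S, f v ≤ ∑ v ∈ S, (1 + ∑ i ∈ range k, if (2:ℝ) ^ i ≤ f v then (2:ℝ) ^ i else 0) :=
    sum_le_sum fun v hv => dyad _ _ ((h1 v hv).trans_lt hM)
  rw [sum_add_distrib, sum_comm] at step
  refine step.trans ?_
  have hi : ∀ i ∈ range k, (∑ v ∈ S, if (2:ℝ) ^ i ≤ f v then (2:ℝ) ^ i else 0) ≤ (V / r + 1) * (2 * r + 3 * 2 ^ i) := by
    intro i _
    rw [← sum_filter, sum_const, nsmul_eq_mul]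
    have := cnt γ b r hr hc hb (1 / 2 ^ i) (by positivity) V hV (S.filter fun v => (2:ℝ) ^ i ≤ f v) (by
      intro v hv
      rw [mem_filter] at hv
      refine ⟨(hS v hv.1).1, (hS v hv.1).2, ?_⟩
      rw [le_div_iff₀ (by positivity), mul_comm]
      exact (mul_le_mul_of_nonneg_right hv.2 (abs_nonneg _)).trans (h2 v hv.1))
    calc _ ≤ (V / r + 1) * (2 * (1 / 2 ^ i) * r + 3) * 2 ^ i := mul_le_mul_of_nonneg_right this (by positivity)
      _ = _ := by field_simp
  have h3 := sum_le_sum hi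
  rw [← mul_sum, sum_add_distrib, ← mul_sum (range k) (fun i => (2:ℝ) ^ i) 3, geom_sum_eq (by norm_num)] at h3
  have h4 : (V / r + 1) * (∑ i ∈ range k, 2 * (r:ℝ) + 3 * ((2 ^ k - 1) / (2 - 1))) ≤ (V / r + 1) * (2 * r * k + 6 * M) := by
    refine mul_le_mul_of_nonneg_left ?_ (by positivity)
    rw [sum_const, card_range, nsmul_eq_mul]; nlinarith
  rw [sum_const, nsmul_eq_mul, mul_one]
  linarith
end W3

namespace W3
open MeasureTheory Finset
open scoped Classical

structure Ctx (P E : ℝ) : Prop where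
  hP : 2 ≤ P
  hE : 10 ^ 6 ≤ E
  hk : ∀ k : ℕ, (2:ℝ) ^ k ≤ P ^ 20 → (k:ℝ) ≤ E
  hl : Real.log P ≤ E
  hd : ∀ n : ℕ, (n:ℝ) ≤ P ^ 20 → (n.divisors.card : ℝ) ≤ E

lemma bits (M : ℝ) (hM : 1 ≤ M) : ∃ k : ℕ, (2:ℝ) ^ k ≤ 2 * M ∧ M < 2 ^ k := by
  obtain ⟨k, h1, h2⟩ := exists_nat_pow_near hM (by norm_num : (1:ℝ) < 2)
  exact ⟨k + 1, by rw [pow_succ]; linarith, h2⟩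

lemma vdc (f : ℤ → ℝ) (u v : ℤ) (H : ℤ) (hH : v - u ≤ H) :
    ‖∑ n ∈ Ioc u v, e (f n)‖ ^ 2 ≤ ∑ h ∈ Icc (-H) H,
      ‖∑ n ∈ Ioc (max u (u - h)) (min v (v - h)), e (f (n + h) - f n)‖ := by
  have h1 : ((‖∑ n ∈ Ioc u v, e (f n)‖ ^ 2 : ℝ) : ℂ) = ∑ h ∈ Icc (-H) H,
      ∑ n ∈ Ioc (max u (u - h)) (min v (v - h)), e (f (n + h) - f n) := by
    rw [Complex.ofReal_pow, ← Complex.mul_conj', map_sum, sum_mul_sum, sum_comm]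
    have h2 : ∀ n ∈ Ioc u v, ∑ m ∈ Ioc u v, e (f m) * (starRingEnd ℂ) (e (f n)) =
        ∑ h ∈ Icc (-H) H, if n + h ∈ Ioc u v then e (f (n + h) - f n) else 0 := by
      intro n hn
      rw [← sum_filter]
      rw [mem_Ioc] at hn
      refine sum_bij' (fun m _ => m - n) (fun h _ => n + h) ?_ ?_ ?_ ?_ ?_
      · intro m hm; simp only [mem_Ioc, mem_filter, mem_Icc] at *; omega
      · intro m hm; simp only [mem_Ioc, mem_filter, mem_Icc] at *; omega
      · intro m hm; simp
      · intro m hm; simp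
      · intro m hm; rw [e_conj, ← e_add]; congr 1; simp; ring
    rw [sum_congr rfl h2, sum_comm]
    refine sum_congr rfl fun h _ => ?_
    rw [← sum_filter]
    congr 1
    ext n; simp only [mem_Ioc, mem_filter, max_lt_iff, le_min_iff]; omega
  have h3 : ‖∑ n ∈ Ioc u v, e (f n)‖ ^ 2 = ‖((‖∑ n ∈ Ioc u v, e (f n)‖ ^ 2 : ℝ) : ℂ)‖ := by
    rw [Complex.norm_real, Real.norm_of_nonneg (by positivity)]
  rw [h3, h1]
  exact norm_sum_le _ _

lemma rn_neg (x : ℝ) : |(-x) - round (-x)| = |x - round x| := by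
  apply le_antisymm
  · refine (round_le (-x) (-round x)).trans_eq ?_
    rw [← abs_neg]; congr 1; push_cast; ring
  · refine (round_le x (-round (-x))).trans_eq ?_
    rw [← abs_neg]; congr 1; push_cast; ring

/-- the min function -/
noncomputable def gm (M θ : ℝ) : ℝ := if |θ - round θ| = 0 then M else min M (1 / (2 * |θ - round θ|))

lemma gm_neg (M θ : ℝ) : gm M (-θ) = gm M θ := by unfold gm; rw [rn_neg]

lemma gm_le (M θ : ℝ) : gm M θ ≤ M := by
  unfold gm; split_ifs; exacts [le_rfl, min_le_left _ _]

lemma gm_mul (M θ : ℝ) : gm M θ * |θ - round θ| ≤ 1 := by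
  unfold gm; split_ifs with h
  · rw [h]; simp
  · have : 0 < |θ - round θ| := lt_of_le_of_ne (abs_nonneg _) (Ne.symm h)
    refine (mul_le_mul_of_nonneg_right (min_le_right _ _) this.le).trans ?_
    rw [div_mul_eq_mul_div, div_le_one (by positivity)]; linarith

lemma lin_le (M θ c : ℝ) (u v : ℤ) (h : ((v - u : ℤ):ℝ) ≤ M) (hM : 0 ≤ M) :
    ‖∑ n ∈ Ioc u v, e (θ * n + c)‖ ≤ gm M θ := by
  have h1 : ‖∑ n ∈ Ioc u v, e (θ * n + c)‖ ≤ M := by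
    refine (norm_sum_le _ _).trans ?_
    simp only [e_norm, sum_const, Int.card_Ioc, nsmul_eq_mul, mul_one]
    rw [← Int.cast_natCast, Int.toNat_eq_max]; push_cast
    push_cast at h
    exact max_le h hM
  unfold gm; split_ifs with h0
  · exact h1
  · exact le_min h1 (geom_le θ c u v (lt_of_le_of_ne (abs_nonneg _) (Ne.symm h0)))

lemma fib4 (v : ℤ) (hv : 0 < v) (S : Finset (ℤ × ℤ)) (hS : ∀ x ∈ S, 6 * |x.1 * x.2| = v) :
    S.card ≤ 4 * v.natAbs.divisors.card := by
  have : S.card ≤ (v.natAbs.divisors ×ˢ (univ : Finset (Bool × Bool))).card := by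
    refine card_le_card_of_injOn (fun x => (x.1.natAbs, (decide (0 < x.1), decide (0 < x.2)))) ?_ ?_
    · intro x hx
      have := hS x hx
      simp only [coe_product, Set.mem_prod, mem_coe, Nat.mem_divisors, mem_univ, and_true]
      refine ⟨?_, by omega⟩
      rw [Int.natAbs_dvd_natAbs, ← this]
      exact Dvd.dvd.mul_left ((dvd_abs _ _).2 (dvd_mul_right _ _)) _
    · rintro ⟨a, b⟩ hx ⟨c, d⟩ hy hxy
      have h1 := hS _ hx
      have h2 := hS _ hy
      simp only [Prod.mk.injEq, decide_eq_decide] at hxy h1 h2 ⊢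
      obtain ⟨h3, h4, h5⟩ := hxy
      rw [abs_mul] at h1 h2
      have ha : |a| = |c| := by rw [Int.abs_eq_natAbs, Int.abs_eq_natAbs, h3]
      have ha0 : |c| ≠ 0 := by rintro h; rw [h] at h2; omega
      have hb : |b| = |d| := by
        rw [ha] at h1; exact mul_left_cancel₀ ha0 (by linarith)
      have ha' : a = c := by
        rcases abs_eq_abs.1 ha with h | h
        · exact h
        · have : c ≠ 0 := by simpa using ha0
          omega
      have hb' : b = d := by
        rcases abs_eq_abs.1 hb with h | h
        · exact h
        · have : d ≠ 0 := by rintro rfl; simp at h2; omega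
          omega
      exact ⟨ha', hb'⟩
  rw [card_product] at this
  simp at this; omega

lemma weyl4 {P E : ℝ} (C : Ctx P E) (γ M : ℝ) (hM : 1 ≤ M) (hMP : M ≤ P) (u v : ℤ)
    (huv : ((v - u : ℤ):ℝ) ≤ M) (b : ℤ) (r : ℕ) (hr : 0 < r) (hc : Int.gcd b r = 1)
    (hb : |γ * r - b| ≤ 1 / r) :
    ‖∑ n ∈ Ioc u v, e (γ * (n:ℝ) ^ 3)‖ ^ 4 ≤ E ^ 2 * (312 * M ^ 3 + 432 * M ^ 4 / r + 24 * M * r) := by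
  have hE1 : 1 ≤ E := by linarith [C.hE]
  have hr' : (0:ℝ) < r := by exact_mod_cast hr
  set H : ℤ := ⌊M⌋ with hHd
  have hH : v - u ≤ H := Int.le_floor.2 huv
  have hH0 : 1 ≤ H := Int.le_floor.2 (by simpa using hM)
  have hHM : (H:ℝ) ≤ M := Int.floor_le M
  have hH2 : 6 * (H:ℝ) ^ 2 ≤ 6 * M ^ 2 := by
    have : (0:ℝ) ≤ H := by exact_mod_cast (by omega : 0 ≤ H)
    gcongr
  set I := Icc (-H) H with hI
  have hIc : (I.card : ℝ) ≤ 3 * M := by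
    rw [hI, Int.card_Icc, ← Int.cast_natCast, Int.toNat_of_nonneg (by omega)]; push_cast; linarith
  let F : ℤ → ℤ → ℝ := fun h n => γ * ((n + h : ℤ):ℝ) ^ 3 - γ * (n:ℝ) ^ 3
  have s1 := vdc (fun n => γ * (n:ℝ) ^ 3) u v H hH
  have s2 : ∀ h ∈ I, ‖∑ n ∈ Ioc (max u (u - h)) (min v (v - h)), e (F h n)‖ ^ 2 ≤
      ∑ h' ∈ I, gm M (γ * ((6 * |h * h'| : ℤ) : ℝ)) := by
    intro h _
    refine (vdc (F h) _ _ H (by omega)).trans (sum_le_sum fun h' _ => ?_)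
    have h3 : gm M (γ * ((6 * |h * h'| : ℤ) : ℝ)) = gm M (γ * (6 * (h * h'))) := by
      rcases abs_choice (h * h') with hh | hh
      · rw [hh]; push_cast; rfl
      · rw [hh, ← gm_neg]; congr 1; push_cast; ring
    rw [h3]
    have h4 : ∀ n : ℤ, F h (n + h') - F h n = γ * (6 * (h * h')) * n + γ * (3 * h * h' * (h + h')) := by
      intro n; simp only [F]; push_cast; ring
    simp only [h4]
    refine lin_le M _ _ _ _ ?_ (by linarith)
    refine le_trans ?_ huv
    exact_mod_cast (by omega)
  have s3 : ‖∑ n ∈ Ioc u v, e (γ * (n:ℝ) ^ 3)‖ ^ 4 ≤ 3 * M * ∑ h ∈ I, ∑ h' ∈ I, gm M (γ * ((6 * |h * h'| : ℤ) : ℝ)) := by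
    calc _ = (‖∑ n ∈ Ioc u v, e (γ * (n:ℝ) ^ 3)‖ ^ 2) ^ 2 := by ring
      _ ≤ (∑ h ∈ I, ‖∑ n ∈ Ioc (max u (u - h)) (min v (v - h)), e (F h n)‖) ^ 2 :=
        pow_le_pow_left₀ (by positivity) s1 2
      _ ≤ I.card * ∑ h ∈ I, ‖∑ n ∈ Ioc (max u (u - h)) (min v (v - h)), e (F h n)‖ ^ 2 := sq_sum_le_card_mul_sum_sq
      _ ≤ _ := mul_le_mul hIc (sum_le_sum s2) (sum_nonneg fun _ _ => by positivity) (by linarith)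
  obtain ⟨k, hk1, hk2⟩ := bits M hM
  have hP20 : 6 * M ^ 2 ≤ P ^ 20 := by
    have hP := C.hP
    calc 6 * M ^ 2 ≤ 2 ^ 18 * P ^ 2 := by gcongr; norm_num
      _ ≤ P ^ 18 * P ^ 2 := by gcongr
      _ = _ := by ring
  have hkE : (k:ℝ) ≤ E := C.hk k (hk1.trans (le_trans (mul_le_mul (by norm_num) (by rw [sq]; exact le_mul_of_one_le_left (by linarith) hM) (by linarith) (by norm_num)) hP20))
  have hgm0 : ∀ x, 0 ≤ gm M x := fun x => by unfold gm; split_ifs <;> positivity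
  set W := (I ×ˢ I).filter (fun x => x.1 * x.2 ≠ 0)
  have s4 : ∑ x ∈ W, gm M (γ * ((6 * |x.1 * x.2| : ℤ) : ℝ)) ≤
      4 * E * ∑ w ∈ Icc (1:ℤ) (6 * H ^ 2), gm M (γ * w) := by
    rw [← sum_fiberwise_of_maps_to (g := fun x => 6 * |x.1 * x.2|) (t := Icc (1:ℤ) (6 * H ^ 2)), mul_sum]
    · refine sum_le_sum fun w hw => ?_
      rw [mem_Icc] at hw
      rw [sum_congr rfl (g := fun _ => gm M (γ * w)) (fun x hx => by rw [(mem_filter.1 hx).2]), sum_const, nsmul_eq_mul]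
      refine mul_le_mul_of_nonneg_right ?_ (hgm0 _)
      have h1 := fib4 w (by omega) (W.filter (fun x => 6 * |x.1 * x.2| = w)) (fun x hx => (mem_filter.1 hx).2)
      have h2 : (w.natAbs.divisors.card : ℝ) ≤ E := C.hd _ (by
        rw [Nat.cast_natAbs, abs_of_pos (by omega)]
        refine le_trans ?_ hP20
        calc (w:ℝ) ≤ 6 * (H:ℝ) ^ 2 := by exact_mod_cast hw.2
          _ ≤ _ := hH2)
      calc _ ≤ ((4 * w.natAbs.divisors.card : ℕ):ℝ) := by exact_mod_cast h1
        _ ≤ _ := by push_cast; linarith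
    · intro x hx
      simp only [W, mem_filter, mem_product, hI, mem_Icc] at hx ⊢
      have h0 : 0 < |x.1 * x.2| := abs_pos.2 hx.2
      refine ⟨by omega, ?_⟩
      rw [abs_mul]
      have h1 : |x.1| ≤ H := abs_le.2 hx.1.1
      have h2 : |x.2| ≤ H := abs_le.2 hx.1.2
      have := mul_le_mul h1 h2 (abs_nonneg _) (by omega); rw [← sq] at this; omega
  have s5 := minsum γ b r hr hc hb (6 * M ^ 2) (by positivity) (Icc (1:ℤ) (6 * H ^ 2)) (by
    intro w hw
    rw [mem_Icc] at hw
    refine ⟨hw.1, ?_⟩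
    calc (w:ℝ) ≤ 6 * (H:ℝ) ^ 2 := by exact_mod_cast hw.2
          _ ≤ _ := hH2) (fun w => gm M (γ * w)) M k hk1 hk2 (fun _ _ => gm_le _ _) (fun _ _ => gm_mul _ _)
  have s6 : ∑ x ∈ (I ×ˢ I).filter (fun x => ¬ x.1 * x.2 ≠ 0), gm M (γ * ((6 * |x.1 * x.2| : ℤ) : ℝ)) ≤ 6 * M * M := by
    refine (sum_le_sum fun x _ => gm_le M _).trans ?_
    rw [sum_const, nsmul_eq_mul]
    refine mul_le_mul_of_nonneg_right ?_ (by linarith)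
    have : (I ×ˢ I).filter (fun x => ¬ x.1 * x.2 ≠ 0) ⊆ ({0} ×ˢ I) ∪ (I ×ˢ {0}) := by
      intro x hx
      simp only [mem_filter, mem_product, mem_union, mem_singleton, not_not, mul_eq_zero] at hx ⊢
      tauto
    have := (card_le_card this).trans (card_union_le _ _)
    rw [card_product, card_product, card_singleton] at this
    have : (((I ×ˢ I).filter (fun x => ¬ x.1 * x.2 ≠ 0)).card : ℝ) ≤ 1 * I.card + I.card * 1 := by exact_mod_cast this
    linarith
  have s7 : ∑ h ∈ I, ∑ h' ∈ I, gm M (γ * ((6 * |h * h'| : ℤ) : ℝ)) ≤ 4 * E * (6 * M ^ 2 + (6 * M ^ 2 / r + 1) * (2 * r * k + 6 * M)) + 6 * M * M := by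
    rw [← sum_product' (s := I) (t := I) (f := fun h h' => gm M (γ * ((6 * |h * h'| : ℤ) : ℝ))), ← sum_filter_add_sum_filter_not _ (fun x => x.1 * x.2 ≠ 0)]
    exact add_le_add (s4.trans (mul_le_mul_of_nonneg_left s5 (by linarith))) s6
  refine s3.trans ((mul_le_mul_of_nonneg_left s7 (by linarith)).trans ?_)
  have e1 : (6 * M ^ 2 / r + 1) * (2 * r * k + 6 * M) = 12 * M ^ 2 * k + 36 * M ^ 3 / r + 2 * r * k + 6 * M := by
    field_simp; ring
  rw [e1]
  have hMM : M ≤ M ^ 2 := by rw [sq]; exact le_mul_of_one_le_left (by linarith) hM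
  have a1 : 12 * M ^ 2 * k ≤ 12 * M ^ 2 * E := mul_le_mul_of_nonneg_left hkE (by positivity)
  have a2 : 2 * r * k ≤ 2 * r * E := mul_le_mul_of_nonneg_left hkE (by positivity)
  have a3 : M ^ 2 ≤ M ^ 2 * E := le_mul_of_one_le_right (by positivity) hE1
  have a4 : 36 * M ^ 3 / r ≤ 36 * M ^ 3 / r * E := le_mul_of_one_le_right (by positivity) hE1
  have a5 : 6 * M * M ≤ 4 * E * (2 * M ^ 2) := by linarith
  calc 3 * M * (4 * E * (6 * M ^ 2 + (12 * M ^ 2 * k + 36 * M ^ 3 / r + 2 * r * k + 6 * M)) + 6 * M * M)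
      ≤ 3 * M * (4 * E * (E * (26 * M ^ 2 + 36 * M ^ 3 / r + 2 * r))) := by
        refine mul_le_mul_of_nonneg_left ?_ (by linarith)
        calc _ ≤ 4 * E * (6 * M ^ 2 + (12 * M ^ 2 * k + 36 * M ^ 3 / r + 2 * r * k + 6 * M)) + 4 * E * (2 * M ^ 2) := by linarith
          _ = 4 * E * (6 * M ^ 2 + (12 * M ^ 2 * k + 36 * M ^ 3 / r + 2 * r * k + 6 * M) + 2 * M ^ 2) := by ring
          _ ≤ _ := mul_le_mul_of_nonneg_left (by linarith) (by linarith)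
    _ = _ := by field_simp; ring

/-- weak Weyl -/
lemma weyl {P E : ℝ} (C : Ctx P E) (γ M Δ : ℝ) (hM : 1 ≤ M) (hMP : M ≤ P) (hΔ : 1 ≤ Δ) (hΔM : Δ ^ 4 * E ^ 4 ≤ M) (u v : ℤ)
    (huv : ((v - u : ℤ):ℝ) ≤ M) (hT : M / Δ ≤ ‖∑ n ∈ Ioc u v, e (γ * (n:ℝ) ^ 3)‖) :
    ∃ (b : ℤ) (r : ℕ), 0 < r ∧ Int.gcd b r = 1 ∧ (r:ℝ) ≤ Δ ^ 4 * E ^ 4 ∧ M ^ 3 * |γ * r - b| ≤ Δ ^ 4 * E ^ 4 := by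
  have hE := C.hE
  have hE0 : 0 < E := by linarith
  have hE2 : 10 ^ 6 ≤ E ^ 2 := by rw [sq]; exact hE.trans (le_mul_of_one_le_left hE0.le (by linarith))
  have hΔ4 : 1 ≤ Δ ^ 4 := one_le_pow₀ hΔ
  set Y := Δ ^ 4 * E ^ 4 with hY
  have hY0 : 0 < Y := by positivity
  have hQ : 1 ≤ M ^ 3 / Y := by
    rw [le_div_iff₀ hY0, one_mul]; exact hΔM.trans (le_self_pow₀ hM (by norm_num))
  obtain ⟨b, r, hr, hc, hrQ, hb⟩ := dirichlet γ _ hQ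
  have hr' : (0:ℝ) < r := by exact_mod_cast hr
  refine ⟨b, r, hr, hc, ?_, ?_⟩
  · have h4 := weyl4 C γ M hM hMP u v huv b r hr hc (hb.trans (one_div_le_one_div_of_le hr' hrQ))
    have h5 : (M / Δ) ^ 4 ≤ _ := (pow_le_pow_left₀ (by positivity) hT 4).trans h4
    rw [div_pow, div_le_iff₀ (by positivity)] at h5
    rw [le_div_iff₀ hY0] at hrQ
    have b1 : E ^ 2 * (312 * M ^ 3) * Δ ^ 4 * 4 ≤ M ^ 4 := by
      calc E ^ 2 * (312 * M ^ 3) * Δ ^ 4 * 4 = M ^ 3 * (E ^ 2 * Δ ^ 4 * 1248) := by ring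
        _ ≤ M ^ 3 * (E ^ 2 * Δ ^ 4 * E ^ 2) := by
          refine mul_le_mul_of_nonneg_left (mul_le_mul_of_nonneg_left (by linarith) (by positivity)) (by positivity)
        _ = M ^ 3 * Y := by rw [hY]; ring
        _ ≤ M ^ 3 * M := mul_le_mul_of_nonneg_left hΔM (by positivity)
        _ = _ := by ring
    have b2 : E ^ 2 * (24 * M * r) * Δ ^ 4 * 4 ≤ M ^ 4 := by
      calc E ^ 2 * (24 * M * r) * Δ ^ 4 * 4 = M * r * Δ ^ 4 * (E ^ 2 * 96) := by ring
        _ ≤ M * r * Δ ^ 4 * (E ^ 2 * E ^ 2) := by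
          refine mul_le_mul_of_nonneg_left (mul_le_mul_of_nonneg_left (by linarith) (by positivity)) (by positivity)
        _ = M * (r * Y) := by rw [hY]; ring
        _ ≤ M * M ^ 3 := mul_le_mul_of_nonneg_left hrQ (by linarith)
        _ = _ := by ring
    have b3 : M ^ 4 ≤ 2 * (E ^ 2 * (432 * M ^ 4 / r) * Δ ^ 4) := by linarith
    have b4 : 2 * (E ^ 2 * (432 * M ^ 4 / r) * Δ ^ 4) = M ^ 4 * (864 * E ^ 2 * Δ ^ 4 / r) := by field_simp; ring
    rw [b4] at b3
    have b5 : 1 ≤ 864 * E ^ 2 * Δ ^ 4 / r := by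
      refine le_of_mul_le_mul_left ?_ (by positivity : 0 < M ^ 4)
      rw [mul_one]; exact b3
    rw [le_div_iff₀ hr', one_mul] at b5
    refine b5.trans ?_
    rw [hY]
    calc 864 * E ^ 2 * Δ ^ 4 = Δ ^ 4 * (E ^ 2 * 864) := by ring
      _ ≤ Δ ^ 4 * (E ^ 2 * E ^ 2) := mul_le_mul_of_nonneg_left (mul_le_mul_of_nonneg_left (by linarith) (by positivity)) (by positivity)
      _ = _ := by ring
  · have : M ^ 3 * |γ * r - b| ≤ M ^ 3 * (1 / (M ^ 3 / Y)) := mul_le_mul_of_nonneg_left hb (by positivity)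
    refine this.trans_eq ?_
    field_simp
end W3

namespace W3
open MeasureTheory Finset
open scoped Classical

lemma Ctx.E1 {P E : ℝ} (C : Ctx P E) : 1 ≤ E := by linarith [C.hE]
lemma Ctx.E0 {P E : ℝ} (C : Ctx P E) : 0 < E := by linarith [C.hE]
lemma Ctx.P0 {P E : ℝ} (C : Ctx P E) : 0 < P := by linarith [C.hP]
lemma Ctx.P1 {P E : ℝ} (C : Ctx P E) : 1 ≤ P := by linarith [C.hP]

lemma dvc {d a b : ℤ} (h : d ∣ a) (e : a = b) : d ∣ b := e ▸ h

lemma card_cong (S : Finset ℤ) (m : ℕ) (hm : 0 < m) (N : ℝ) (hN : 0 ≤ N)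
    (hd : ∀ x ∈ S, ∀ y ∈ S, (m:ℤ) ∣ x - y) (hb : ∀ x ∈ S, ∀ y ∈ S, ((x - y : ℤ):ℝ) ≤ N) :
    (S.card : ℝ) ≤ N / m + 1 := by
  have hm' : (0:ℝ) < m := by exact_mod_cast hm
  rcases S.eq_empty_or_nonempty with h0 | hne
  · subst h0; simp; positivity
  obtain ⟨x0, hx0, hmin⟩ := S.exists_min_image id hne
  have h1 : S.card ≤ (Icc (0:ℤ) ⌊N / m⌋).card := by
    refine card_le_card_of_injOn (fun x => (x - x0) / m) ?_ ?_
    · intro x hx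
      have := hmin x hx
      simp only [id] at this
      simp only [coe_Icc, Set.mem_Icc]
      refine ⟨Int.ediv_nonneg (by omega) (by omega), Int.le_floor.2 ?_⟩
      rw [le_div_iff₀ hm']
      refine le_trans ?_ (hb x hx x0 hx0)
      exact_mod_cast Int.ediv_mul_le _ (by omega)
    · intro x hx y hy hxy
      simp only at hxy
      have h1 := Int.ediv_mul_cancel (hd x hx x0 hx0)
      have h2 := Int.ediv_mul_cancel (hd y hy x0 hx0)
      rw [hxy] at h1; omega
  rw [Int.card_Icc] at h1
  have h0 : 0 ≤ ⌊N / m⌋ := Int.floor_nonneg.2 (by positivity)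
  have h2 : ((⌊N/m⌋ + 1 - 0).toNat : ℝ) = ⌊N / m⌋ + 1 := by
    rw [← Int.cast_natCast, Int.toNat_of_nonneg (by omega)]; push_cast; ring
  have h3 : (S.card:ℝ) ≤ ⌊N / m⌋ + 1 := by rw [← h2]; exact_mod_cast h1
  linarith [Int.floor_le (N / m)]

lemma gcd_split (h : ℕ) (hh : 0 < h) (a b : ℤ) (hd : (h:ℤ) ∣ a * b) :
    ((h / Int.gcd h a : ℕ) : ℤ) ∣ b := by
  have h1 : (h:ℤ) ∣ gcd (h:ℤ) a * b := dvd_gcd_mul_of_dvd_mul hd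
  have h2 : Int.gcd h a ∣ h := by exact_mod_cast Int.gcd_dvd_left (h:ℤ) a
  rw [← Int.coe_gcd] at h1
  obtain ⟨k, hk⟩ := h2
  have hg : 0 < Int.gcd h a := Nat.pos_of_ne_zero (by rintro h0; rw [h0] at hk; omega)
  generalize Int.gcd h a = g at *
  subst hk
  rw [Nat.mul_div_cancel_left _ hg]
  push_cast at h1
  exact Int.dvd_of_mul_dvd_mul_left (by omega) h1

lemma CR_core (h : ℕ) (hh : 0 < h) (E : ℝ) (hE0 : 0 ≤ E) (hE : ∀ g, g ∣ h → (g.divisors.card : ℝ) ≤ E) (N L : ℝ) (hN : 0 ≤ N)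
    (hL0 : 0 < L) (x0 : ℤ) (S : Finset ℤ) (hS : ∀ x ∈ S, (h:ℤ) ∣ x ^ 3 - x0 ^ 3)
    (hb : ∀ x ∈ S, ∀ y ∈ S, ((x - y : ℤ):ℝ) ≤ N)
    (hL : ∀ (q1 q3 q4 : ℕ) (x x1 : ℤ), q1 * (q3 * q4) = h → (q1:ℤ) ∣ x - x0 → (q3:ℤ) ∣ x - x1 → (q4:ℤ) ∣ x + x1 + x0 →
      (q3 * q4 : ℤ) ∣ x ^ 2 + x * x0 + x0 ^ 2 → (q3 * q4 : ℤ) ∣ x1 ^ 2 + x1 * x0 + x0 ^ 2 →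
      L ≤ Nat.lcm q1 (Nat.lcm q3 q4)) :
    (S.card : ℝ) ≤ E ^ 2 * (N / L + 1) := by
  have hpos : 0 ≤ N / L + 1 := by positivity
  have main : ∀ q1 ∈ h.divisors, ((S.filter (fun x => Int.gcd h (x - x0) = q1)).card : ℝ) ≤ E * (N / L + 1) := by
    intro q1 hq1
    have hq1d := Nat.dvd_of_mem_divisors hq1
    have hq1p : 0 < q1 := Nat.pos_of_dvd_of_pos hq1d hh
    set S1 := S.filter (fun x => Int.gcd h (x - x0) = q1) with hS1
    rcases S1.eq_empty_or_nonempty with h0 | ⟨x1, hx1⟩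
    · rw [h0]; simp; positivity
    set q2 := h / q1 with hq2
    have hq12 : q1 * q2 = h := Nat.mul_div_cancel' hq1d
    have hq2p : 0 < q2 := Nat.pos_of_ne_zero (by rintro h0; rw [h0] at hq12; omega)
    have hsq : ∀ x ∈ S1, (q2:ℤ) ∣ x ^ 2 + x * x0 + x0 ^ 2 := by
      intro x hx
      rw [hS1, mem_filter] at hx
      rw [hq2, ← hx.2]
      refine gcd_split h hh _ _ ?_
      exact dvc (hS x hx.1) (by ring)
    refine (card_fib S1 q2.divisors (fun x => Int.gcd q2 (x - x1)) (N / L + 1) ?_ ?_).trans ?_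
    · intro x hx
      rw [Nat.mem_divisors]
      exact ⟨by exact_mod_cast Int.gcd_dvd_left (q2:ℤ) (x - x1), hq2p.ne'⟩
    · intro q3 hq3
      have hq3d := Nat.dvd_of_mem_divisors hq3
      set q4 := q2 / q3 with hq4
      have hq34 : q3 * q4 = q2 := Nat.mul_div_cancel' hq3d
      have hq34z : (q3 * q4 : ℤ) = q2 := by exact_mod_cast hq34
      have f1 : ∀ x ∈ S1.filter (fun x => Int.gcd q2 (x - x1) = q3), (q1:ℤ) ∣ x - x0 ∧ (q3:ℤ) ∣ x - x1 ∧ (q4:ℤ) ∣ x + x1 + x0 := by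
        intro x hx
        rw [mem_filter] at hx
        have hx' := hx.1
        rw [hS1, mem_filter] at hx'
        refine ⟨?_, ?_, ?_⟩
        · rw [← hx'.2]; exact Int.gcd_dvd_right _ _
        · rw [← hx.2]; exact Int.gcd_dvd_right _ _
        · rw [hq4, ← hx.2]
          refine gcd_split q2 hq2p _ _ ?_
          exact dvc (dvd_sub (hsq x hx.1) (hsq x1 hx1)) (by ring)
      rcases (S1.filter (fun x => Int.gcd q2 (x - x1) = q3)).eq_empty_or_nonempty with h0 | ⟨z, hz⟩
      · rw [h0]; simpa using hpos
      obtain ⟨z1, z2, z3⟩ := f1 z hz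
      have hl := hL q1 q3 q4 z x1 (by rw [hq34, hq12]) z1 z2 z3 (by rw [hq34z]; exact hsq z (mem_filter.1 hz).1)
        (by rw [hq34z]; exact hsq x1 hx1)
      set m := Nat.lcm q1 (Nat.lcm q3 q4)
      have hm' : (0:ℝ) < m := hL0.trans_le hl
      refine (card_cong _ m (by exact_mod_cast hm') N hN ?_ ?_).trans ?_
      · intro x hx y hy
        obtain ⟨a1, a2, a3⟩ := f1 x hx
        obtain ⟨b1, b2, b3⟩ := f1 y hy
        have c1 : (q1:ℤ) ∣ x - y := dvc (dvd_sub a1 b1) (by ring)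
        have c2 : (q3:ℤ) ∣ x - y := dvc (dvd_sub a2 b2) (by ring)
        have c3 : (q4:ℤ) ∣ x - y := dvc (dvd_sub a3 b3) (by ring)
        rw [Int.natCast_dvd] at c1 c2 c3 ⊢
        exact Nat.lcm_dvd c1 (Nat.lcm_dvd c2 c3)
      · intro x hx y hy
        exact hb x (mem_filter.1 (mem_filter.1 hx).1).1 y (mem_filter.1 (mem_filter.1 hy).1).1
      · gcongr
    · refine mul_le_mul_of_nonneg_right (hE q2 ⟨q1, by rw [mul_comm, hq12]⟩) hpos
  refine (card_fib S h.divisors (fun x => Int.gcd h (x - x0)) _ ?_ main).trans ?_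
  · intro x hx
    rw [Nat.mem_divisors]
    exact ⟨by exact_mod_cast Int.gcd_dvd_left (h:ℤ) (x - x0), hh.ne'⟩
  · rw [sq, mul_assoc]
    exact mul_le_mul_of_nonneg_right (hE h dvd_rfl) (by positivity)

lemma Ctx.hdv {P E : ℝ} (C : Ctx P E) {h : ℕ} (hh : 0 < h) (hP : (h:ℝ) ≤ P ^ 20) (g : ℕ) (hg : g ∣ h) :
    (g.divisors.card : ℝ) ≤ E :=
  C.hd g (le_trans (by exact_mod_cast Nat.le_of_dvd hh hg) hP)

lemma CR_coarse {P E : ℝ} (C : Ctx P E) (h : ℕ) (hh : 0 < h) (hhP : (h:ℝ) ≤ P ^ 20) (N L : ℝ) (hN : 0 ≤ N)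
    (hL0 : 0 < L) (hL : L ^ 3 ≤ h) (x0 : ℤ) (S : Finset ℤ) (hS : ∀ x ∈ S, (h:ℤ) ∣ x ^ 3 - x0 ^ 3)
    (hb : ∀ x ∈ S, ∀ y ∈ S, ((x - y : ℤ):ℝ) ≤ N) : (S.card : ℝ) ≤ E ^ 2 * (N / L + 1) := by
  refine CR_core h hh E C.E0.le (C.hdv hh hhP) N L hN hL0 x0 S hS hb ?_
  intro q1 q3 q4 x x1 hq _ _ _ _ _
  have h1 : q1 * (q3 * q4) ≠ 0 := by omega
  simp only [mul_ne_zero_iff] at h1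
  set m := Nat.lcm q1 (Nat.lcm q3 q4) with hm
  have hlp : 0 < Nat.lcm q3 q4 := Nat.lcm_pos (by omega) (by omega)
  have hmp : 0 < m := Nat.lcm_pos (by omega) hlp
  have a1 : q1 ≤ m := Nat.le_of_dvd hmp (Nat.dvd_lcm_left _ _)
  have a3 : q3 ≤ m := Nat.le_of_dvd hmp ((Nat.dvd_lcm_left _ _).trans (Nat.dvd_lcm_right _ _))
  have a4 : q4 ≤ m := Nat.le_of_dvd hmp ((Nat.dvd_lcm_right _ _).trans (Nat.dvd_lcm_right _ _))
  have h3 : h ≤ m ^ 3 := by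
    rw [← hq, pow_succ, sq, mul_assoc]; exact Nat.mul_le_mul a1 (Nat.mul_le_mul a3 a4)
  have h4 : L ^ 3 ≤ (m:ℝ) ^ 3 := hL.trans (by exact_mod_cast h3)
  exact le_of_pow_le_pow_left₀ (by norm_num) (by positivity) h4

lemma dvd3 (g h : ℕ) (x0 : ℤ) (hc : IsCoprime x0 h) (hg : g ∣ h) (hd : (g:ℤ) ∣ 3 * x0 ^ 2) : g ≤ 3 := by
  have h1 : IsCoprime (g:ℤ) (x0 ^ 2) := (hc.of_isCoprime_of_dvd_right (by exact_mod_cast hg)).symm.pow_right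
  have h2 : (g:ℤ) ∣ 3 := h1.dvd_of_dvd_mul_right hd
  exact_mod_cast Int.le_of_dvd (by norm_num) h2

lemma CR_fine {P E : ℝ} (C : Ctx P E) (h : ℕ) (hh : 0 < h) (hhP : (h:ℝ) ≤ P ^ 20) (N : ℝ) (hN : 0 ≤ N)
    (x0 : ℤ) (hc : IsCoprime x0 h) (S : Finset ℤ) (hS : ∀ x ∈ S, (h:ℤ) ∣ x ^ 3 - x0 ^ 3)
    (hb : ∀ x ∈ S, ∀ y ∈ S, ((x - y : ℤ):ℝ) ≤ N) : (S.card : ℝ) ≤ E ^ 3 * (N / h + 1) := by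
  have hh' : (0:ℝ) < h := by exact_mod_cast hh
  refine (CR_core h hh E C.E0.le (C.hdv hh hhP) N (h / 9) hN (by positivity) x0 S hS hb ?_).trans ?_
  · intro q1 q3 q4 x x1 hq z1 z2 z3 z4 z5
    have g2 : Nat.gcd q3 q4 ≤ 3 := by
      refine dvd3 _ h x0 hc ?_ ?_
      · rw [← hq]; exact ((Nat.gcd_dvd_left _ _).trans (dvd_mul_right _ _)).mul_left _
      · have b1 : (Nat.gcd q3 q4 : ℤ) ∣ x - x1 := dvd_trans (by exact_mod_cast Nat.gcd_dvd_left _ _) z2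
        have b2 : (Nat.gcd q3 q4 : ℤ) ∣ x + x1 + x0 := dvd_trans (by exact_mod_cast Nat.gcd_dvd_right _ _) z3
        have b3 : (Nat.gcd q3 q4 : ℤ) ∣ x1 ^ 2 + x1 * x0 + x0 ^ 2 :=
          dvd_trans (by exact_mod_cast (Nat.gcd_dvd_left q3 q4).trans (dvd_mul_right _ q4)) z5
        exact dvc (dvd_sub (b3.mul_left 4) ((dvd_sub b2 b1).mul_left (2 * x1 + x0))) (by ring)
    have g1 : Nat.gcd q1 (Nat.lcm q3 q4) ≤ 3 := by
      refine dvd3 _ h x0 hc ?_ ?_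
      · rw [← hq]; exact (Nat.gcd_dvd_left _ _).trans (dvd_mul_right _ _)
      · have b1 : (Nat.gcd q1 (Nat.lcm q3 q4) : ℤ) ∣ x - x0 := dvd_trans (by exact_mod_cast Nat.gcd_dvd_left _ _) z1
        have b2 : (Nat.gcd q1 (Nat.lcm q3 q4) : ℤ) ∣ x ^ 2 + x * x0 + x0 ^ 2 :=
          dvd_trans (by exact_mod_cast (Nat.gcd_dvd_right q1 _).trans (Nat.lcm_dvd_mul q3 q4)) z4
        exact dvc (dvd_sub b2 (b1.mul_left (x + 2 * x0))) (by ring)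
    have e1 := Nat.gcd_mul_lcm q3 q4
    have e2 := Nat.gcd_mul_lcm q1 (Nat.lcm q3 q4)
    have e3 : h ≤ 9 * Nat.lcm q1 (Nat.lcm q3 q4) := by
      calc h = Nat.gcd q3 q4 * (q1 * Nat.lcm q3 q4) := by rw [← hq, ← e1]; ring
        _ = Nat.gcd q3 q4 * (Nat.gcd q1 (Nat.lcm q3 q4) * Nat.lcm q1 (Nat.lcm q3 q4)) := by rw [e2]
        _ ≤ 3 * (3 * Nat.lcm q1 (Nat.lcm q3 q4)) := by gcongr
        _ = _ := by ring
    rw [div_le_iff₀ (by norm_num), mul_comm]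
    exact_mod_cast e3
  · have hE := C.hE
    have h1 : N / (h / 9) + 1 ≤ E * (N / h + 1) := by
      have : N / (h / 9) = 9 * (N / h) := by field_simp
      rw [this]
      have h0 : 0 ≤ N / h := by positivity
      nlinarith
    calc _ ≤ E ^ 2 * (E * (N / h + 1)) := mul_le_mul_of_nonneg_left h1 (by positivity)
      _ = _ := by ring
end W3

namespace W3
open MeasureTheory Finset
open scoped Classical

lemma orth (q : ℕ) (hq : 0 < q) (x : ℤ) : ∑ h ∈ range q, e ((h:ℝ) * x / q) = if (q:ℤ) ∣ x then (q:ℂ) else 0 := by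
  have hq' : (q:ℝ) ≠ 0 := by positivity
  have hp : ∀ h : ℕ, e ((h:ℝ) * x / q) = (e (x / q)) ^ h := by
    intro h
    induction h with
    | zero => simp [e_zero]
    | succ n ih => rw [pow_succ, ← ih, ← e_add]; congr 1; push_cast; ring
  simp only [hp]
  split_ifs with hd
  · obtain ⟨k, rfl⟩ := hd
    have : e (((q * k : ℤ):ℝ) / q) = 1 := by
      rw [← e_int k]; congr 1; push_cast; field_simp
    rw [this]; simp
  · have h1 : e (x / q) ≠ 1 := by
      intro h
      have := e_sub_one_ge (x / q)
      rw [h] at this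
      simp only [sub_self, norm_zero] at this
      have h0 : ((x:ℝ) / q) - round ((x:ℝ) / q) = 0 := by
        rw [← abs_eq_zero]; linarith [abs_nonneg ((x:ℝ) / q - round ((x:ℝ) / q))]
      apply hd
      refine ⟨round ((x:ℝ) / q), ?_⟩
      have : (x:ℝ) = q * round ((x:ℝ) / q) := by
        rw [sub_eq_zero] at h0; rw [← h0]; field_simp
      exact_mod_cast this
    have h2 : e (x / q) ^ q = 1 := by
      rw [← hp, ← e_int x]; congr 1; field_simp
    have := mul_neg_geom_sum (e (x / q)) q
    rw [h2, sub_self] at this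
    exact (mul_eq_zero.1 this).resolve_left (sub_ne_zero.2 (Ne.symm h1))

def OpB {ι κ : Type*} (s : Finset ι) (t : Finset κ) (K : ι → κ → ℂ) (C : ℝ) : Prop :=
  ∀ (a : ι → ℂ) (b : κ → ℂ), ‖∑ i ∈ s, ∑ j ∈ t, a i * b j * K i j‖ ≤
    C * (√(∑ i ∈ s, ‖a i‖ ^ 2) * √(∑ j ∈ t, ‖b j‖ ^ 2))

lemma OpB.mono {ι κ : Type*} {s : Finset ι} {t : Finset κ} {K : ι → κ → ℂ} {C C' : ℝ} (h : OpB s t K C) (hC : C ≤ C') :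
    OpB s t K C' := fun a b => (h a b).trans (by gcongr)

lemma OpB.congr {ι κ : Type*} {s : Finset ι} {t : Finset κ} {K K' : ι → κ → ℂ} {C : ℝ} (h : OpB s t K C)
    (hK : ∀ i ∈ s, ∀ j ∈ t, K i j = K' i j) : OpB s t K' C := by
  intro a b
  convert h a b using 2
  refine sum_congr rfl fun i hi => sum_congr rfl fun j hj => by rw [hK i hi j hj]

/-- multiply by bounded functions of the variables -/
lemma OpB.wt {ι κ : Type*} {s : Finset ι} {t : Finset κ} {K : ι → κ → ℂ} {C : ℝ} (hC : 0 ≤ C) (h : OpB s t K C)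
    (f : ι → ℂ) (g : κ → ℂ) (hf : ∀ i ∈ s, ‖f i‖ ≤ 1) (hg : ∀ j ∈ t, ‖g j‖ ≤ 1) : OpB s t (fun i j => f i * g j * K i j) C := by
  intro a b
  have := h (fun i => a i * f i) (fun j => b j * g j)
  have e1 : ∑ i ∈ s, ∑ j ∈ t, a i * b j * (f i * g j * K i j) = ∑ i ∈ s, ∑ j ∈ t, (a i * f i) * (b j * g j) * K i j :=
    sum_congr rfl fun i _ => sum_congr rfl fun j _ => by ring
  rw [e1]
  refine this.trans (mul_le_mul_of_nonneg_left ?_ hC)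
  gcongr with i hi j hj
  · rw [norm_mul]; exact mul_le_of_le_one_right (norm_nonneg _) (hf i hi)
  · rw [norm_mul]; exact mul_le_of_le_one_right (norm_nonneg _) (hg j hj)

lemma OpB.add {ι κ : Type*} {s : Finset ι} {t : Finset κ} {K K' : ι → κ → ℂ} {C C' : ℝ} (h : OpB s t K C) (h' : OpB s t K' C') :
    OpB s t (fun i j => K i j + K' i j) (C + C') := by
  intro a b
  have e1 : ∑ i ∈ s, ∑ j ∈ t, a i * b j * (K i j + K' i j) = ∑ i ∈ s, ∑ j ∈ t, a i * b j * K i j + ∑ i ∈ s, ∑ j ∈ t, a i * b j * K' i j := by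
    simp only [mul_add, sum_add_distrib]
  rw [e1, add_mul]
  exact (norm_add_le _ _).trans (add_le_add (h a b) (h' a b))

lemma OpB.block {ι κ : Type*} {s : Finset ι} {t : Finset κ} {K : ι → κ → ℂ} {C : ℝ} (hC : 0 ≤ C) (h : OpB s t K C)
    (u : ι → ℕ) (v : κ → ℕ) : OpB s t (fun i j => if u i = v j then K i j else 0) C := by
  intro a b
  set T : ℕ := ∑ i ∈ s, u i + ∑ j ∈ t, v j + 1 with hT
  have hT' : (0:ℝ) < T := by positivity
  have e1 : (T:ℂ) * ∑ i ∈ s, ∑ j ∈ t, a i * b j * (if u i = v j then K i j else 0) =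
      ∑ m ∈ range T, ∑ i ∈ s, ∑ j ∈ t, a i * b j * (e (((m:ℝ) * u i) / T) * e (-((m:ℝ) * v j) / T) * K i j) := by
    rw [Finset.sum_comm (s := range T), mul_sum]
    refine sum_congr rfl fun i hi => ?_
    rw [Finset.sum_comm (s := range T), mul_sum]
    refine sum_congr rfl fun j hj => ?_
    have h1 : u i < T := by have := Finset.single_le_sum (f := u) (s := s) (fun _ _ => Nat.zero_le _) hi; omega
    have h2 : v j < T := by have := Finset.single_le_sum (f := v) (s := t) (fun _ _ => Nat.zero_le _) hj; omega
    have := orth T (by omega) ((u i : ℤ) - v j)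
    have h3 : (T:ℤ) ∣ (u i : ℤ) - v j ↔ u i = v j := by
      constructor
      · intro hd
        by_contra hne
        have := Int.le_of_dvd (a := (T:ℤ)) (b := |(u i : ℤ) - v j|) (abs_pos.2 (by omega)) ((dvd_abs _ _).2 hd)
        rcases abs_cases ((u i : ℤ) - v j) with h | h <;> omega
      · intro h; rw [h]; simp
    rw [if_congr h3 rfl rfl] at this
    have e2 : ∑ m ∈ range T, a i * b j * (e (((m:ℝ) * u i) / T) * e (-((m:ℝ) * v j) / T) * K i j) =
        a i * b j * K i j * ∑ m ∈ range T, e ((m:ℝ) * ((u i : ℤ) - v j : ℤ) / T) := by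
      rw [mul_sum]
      refine sum_congr rfl fun m _ => ?_
      rw [← e_add]
      have : (m:ℝ) * u i / T + -((m:ℝ) * v j) / T = (m:ℝ) * ((u i : ℤ) - v j : ℤ) / T := by push_cast; ring
      rw [this]; ring
    rw [e2, this]
    split_ifs <;> ring
  have h2 : ‖(T:ℂ) * ∑ i ∈ s, ∑ j ∈ t, a i * b j * (if u i = v j then K i j else 0)‖ ≤
      T * (C * (√(∑ i ∈ s, ‖a i‖ ^ 2) * √(∑ j ∈ t, ‖b j‖ ^ 2))) := by
    rw [e1]
    refine (norm_sum_le _ _).trans ?_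
    have := sum_le_sum (s := range T) (fun m _ => (h.wt hC (fun i => e (((m:ℝ) * u i) / T)) (fun j => e (-((m:ℝ) * v j) / T))
      (fun _ _ => (e_norm _).le) (fun _ _ => (e_norm _).le)) a b)
    refine this.trans ?_
    simp
  rw [norm_mul, Complex.norm_natCast] at h2
  exact le_of_mul_le_mul_left h2 hT'

lemma OpB.trunc {ι κ : Type*} {s : Finset ι} {t : Finset κ} {K : ι → κ → ℂ} {C : ℝ} (hC : 0 ≤ C) (h : OpB s t K C)
    (k : ℕ) : ∀ (u : ι → ℕ) (v : κ → ℕ), (∀ i ∈ s, u i < 2 ^ k) → (∀ j ∈ t, v j < 2 ^ k) →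
    OpB s t (fun i j => if u i < v j then K i j else 0) (k * C) := by
  induction k with
  | zero =>
    intro u v hu hv
    refine OpB.congr (K := fun _ _ => 0) (fun a b => by simp) ?_
    intro i hi j hj
    have := hu i hi; have := hv j hj
    rw [if_neg (by omega)]
  | succ k ih =>
    intro u v hu hv
    have h1 := ih (fun i => u i / 2) (fun j => v j / 2) (fun i hi => by have := hu i hi; rw [pow_succ] at this; omega)
      (fun j hj => by have := hv j hj; rw [pow_succ] at this; omega)
    have h2 := (h.block hC (fun i => u i / 2) (fun j => v j / 2)).wt hC (fun i => if u i % 2 = 0 then 1 else 0)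
      (fun j => if v j % 2 = 1 then 1 else 0) (fun i _ => by split_ifs <;> simp) (fun i _ => by split_ifs <;> simp)
    have h3 := (h1.add h2).mono (C' := ((k + 1 : ℕ):ℝ) * C) (by push_cast; linarith)
    refine h3.congr ?_
    intro i _ j _
    beta_reduce
    by_cases c1 : u i / 2 < v j / 2
    · rw [if_pos c1, if_neg (by omega : ¬ u i / 2 = v j / 2), if_pos (by omega : u i < v j)]; simp
    · by_cases c2 : u i / 2 = v j / 2
      · rcases Nat.mod_two_eq_zero_or_one (u i) with c3 | c3 <;> rcases Nat.mod_two_eq_zero_or_one (v j) with c4 | c4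
        all_goals simp [c3, c4, c2]
        all_goals omega
      · rw [if_neg c1, if_neg c2, if_neg (by omega : ¬ u i < v j)]; simp

lemma OpB.schur {ι κ : Type*} {s : Finset ι} {t : Finset κ} {K : ι → κ → ℂ} {R : ℝ}
    (h : ∀ j ∈ t, ∑ j' ∈ t, ‖∑ i ∈ s, K i j * (starRingEnd ℂ) (K i j')‖ ≤ R) : OpB s t K √R := by
  intro a b
  set c : ι → ℂ := fun i => ∑ j ∈ t, b j * K i j with hc
  have e1 : ∑ i ∈ s, ∑ j ∈ t, a i * b j * K i j = ∑ i ∈ s, a i * c i := by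
    simp only [hc, mul_sum, mul_assoc]
  have h1 : ‖∑ i ∈ s, a i * c i‖ ≤ √(∑ i ∈ s, ‖a i‖ ^ 2) * √(∑ i ∈ s, ‖c i‖ ^ 2) := by
    refine (norm_sum_le _ _).trans ?_
    simp only [norm_mul]
    exact Real.sum_mul_le_sqrt_mul_sqrt s (fun i => ‖a i‖) (fun i => ‖c i‖)
  set G : κ → κ → ℝ := fun j j' => ‖∑ i ∈ s, K i j * (starRingEnd ℂ) (K i j')‖ with hG
  have hsym : ∀ j j', G j j' = G j' j := by
    intro j j'
    simp only [hG]
    rw [← Complex.norm_conj, map_sum]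
    congr 1
    refine sum_congr rfl fun i _ => ?_
    rw [map_mul, Complex.conj_conj, mul_comm]
  have h2 : ∑ i ∈ s, ‖c i‖ ^ 2 ≤ R * ∑ j ∈ t, ‖b j‖ ^ 2 := by
    have e2 : ((∑ i ∈ s, ‖c i‖ ^ 2 : ℝ) : ℂ) = ∑ j ∈ t, ∑ j' ∈ t, b j * (starRingEnd ℂ) (b j') * ∑ i ∈ s, K i j * (starRingEnd ℂ) (K i j') := by
      push_cast
      simp only [← Complex.mul_conj']
      have : ∀ i ∈ s, c i * (starRingEnd ℂ) (c i) = ∑ j ∈ t, ∑ j' ∈ t, b j * (starRingEnd ℂ) (b j') * (K i j * (starRingEnd ℂ) (K i j')) := by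
        intro i _
        simp only [hc, map_sum, sum_mul_sum, map_mul]
        refine sum_congr rfl fun j _ => sum_congr rfl fun j' _ => by ring
      rw [sum_congr rfl this, sum_comm]
      refine sum_congr rfl fun j _ => ?_
      rw [sum_comm]
      refine sum_congr rfl fun j' _ => ?_
      rw [mul_sum]
    have e3 : ∑ i ∈ s, ‖c i‖ ^ 2 ≤ ∑ j ∈ t, ∑ j' ∈ t, (‖b j‖ ^ 2 / 2 * G j j' + ‖b j'‖ ^ 2 / 2 * G j j') := by
      have : ∑ i ∈ s, ‖c i‖ ^ 2 = ‖((∑ i ∈ s, ‖c i‖ ^ 2 : ℝ) : ℂ)‖ := by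
        rw [Complex.norm_real, Real.norm_of_nonneg]; positivity
      rw [this, e2]
      refine (norm_sum_le _ _).trans (sum_le_sum fun j _ => (norm_sum_le _ _).trans (sum_le_sum fun j' _ => ?_))
      rw [norm_mul, norm_mul, Complex.norm_conj, ← add_mul]
      refine mul_le_mul_of_nonneg_right ?_ (norm_nonneg _)
      nlinarith [sq_nonneg (‖b j‖ - ‖b j'‖)]
    refine e3.trans ?_
    simp only [sum_add_distrib]
    have e4 : ∑ j ∈ t, ∑ j' ∈ t, ‖b j'‖ ^ 2 / 2 * G j j' = ∑ j ∈ t, ∑ j' ∈ t, ‖b j‖ ^ 2 / 2 * G j j' := by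
      rw [sum_comm]
      refine sum_congr rfl fun j _ => sum_congr rfl fun j' _ => by rw [hsym]
    rw [e4]
    simp only [← mul_sum]
    have e5 : ∑ j ∈ t, ‖b j‖ ^ 2 / 2 * ∑ j' ∈ t, G j j' ≤ ∑ j ∈ t, ‖b j‖ ^ 2 / 2 * R :=
      sum_le_sum fun j hj => mul_le_mul_of_nonneg_left (h j hj) (by positivity)
    rw [← sum_mul, ← sum_div] at e5
    linarith
  rw [e1]
  refine h1.trans ?_
  rw [mul_left_comm]
  refine mul_le_mul_of_nonneg_left ?_ (by positivity)
  rcases t.eq_empty_or_nonempty with ht | ⟨j, hj⟩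
  · subst ht; simp [hc]
  · have hR : 0 ≤ R := le_trans (sum_nonneg fun _ _ => norm_nonneg _) (h j hj)
    rw [← Real.sqrt_mul hR]
    exact Real.sqrt_le_sqrt h2

lemma OpB.pull {ι ι' κ : Type*} [DecidableEq ι'] {s : Finset ι} {s' : Finset ι'} {t : Finset κ} {K : ι' → κ → ℂ} {C μ : ℝ} (hC : 0 ≤ C)
    (f : ι → ι') (hf : ∀ i ∈ s, f i ∈ s') (hμ : ∀ x ∈ s', ((s.filter (fun i => f i = x)).card : ℝ) ≤ μ) (h : OpB s' t K C) :
    OpB s t (fun i j => K (f i) j) (C * √μ) := by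
  intro a b
  have h1 := h (fun x => ∑ i ∈ s.filter (fun i => f i = x), a i) b
  have e1 : ∑ i ∈ s, ∑ j ∈ t, a i * b j * K (f i) j = ∑ x ∈ s', ∑ j ∈ t, (∑ i ∈ s.filter (fun i => f i = x), a i) * b j * K x j := by
    rw [← sum_fiberwise_of_maps_to hf]
    refine sum_congr rfl fun x _ => ?_
    simp only [sum_mul]
    rw [sum_comm]
    refine sum_congr rfl fun j _ => ?_
    refine sum_congr rfl fun i hi => ?_
    rw [(mem_filter.1 hi).2]
  rw [e1]
  refine h1.trans ?_
  rw [mul_assoc]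
  refine mul_le_mul_of_nonneg_left ?_ hC
  rw [← mul_assoc]
  refine mul_le_mul_of_nonneg_right ?_ (by positivity)
  rw [← Real.sqrt_mul' _ (by positivity)]
  refine Real.sqrt_le_sqrt ?_
  rw [← sum_fiberwise_of_maps_to hf, mul_sum]
  refine sum_le_sum fun x hx => ?_
  have c1 : ‖∑ i ∈ s.filter (fun i => f i = x), a i‖ ^ 2 ≤ (∑ i ∈ s.filter (fun i => f i = x), ‖a i‖) ^ 2 := by
    gcongr; exact norm_sum_le _ _
  refine c1.trans ((sq_sum_le_card_mul_sum_sq).trans ?_)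
  exact mul_le_mul_of_nonneg_right (hμ x hx) (by positivity)

lemma OpB.taylor {ι κ : Type*} {s : Finset ι} {t : Finset κ} {K : ι → κ → ℂ} {C : ℝ} (hC : 0 ≤ C) (h : OpB s t K C)
    (f : ι → ℝ) (g : κ → ℝ) (hf : ∀ i ∈ s, |f i| ≤ 1) (hg : ∀ j ∈ t, |g j| ≤ 1) :
    OpB s t (fun i j => K i j * e (f i * g j)) (C * Real.exp (2 * Real.pi)) := by
  intro a b
  have hs : ∀ i ∈ s, ∀ j ∈ t, HasSum (fun r : ℕ => a i * b j * (K i j * ((2 * Real.pi * Complex.I * (f i * g j : ℝ)) ^ r / r.factorial)))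
      (a i * b j * (K i j * e (f i * g j))) := by
    intro i _ j _
    refine HasSum.mul_left _ (HasSum.mul_left _ ?_)
    unfold e
    rw [Complex.exp_eq_exp_ℂ]
    exact NormedSpace.expSeries_div_hasSum_exp _
  have hs2 := hasSum_sum (fun i hi => hasSum_sum (fun j hj => hs i hi j hj))
  have hr : HasSum (fun r : ℕ => (2 * Real.pi) ^ r / r.factorial) (Real.exp (2 * Real.pi)) := by
    rw [Real.exp_eq_exp_ℝ]; exact NormedSpace.expSeries_div_hasSum_exp _
  set Y := √(∑ i ∈ s, ‖a i‖ ^ 2) * √(∑ j ∈ t, ‖b j‖ ^ 2)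
  have hr2 := hr.mul_left (C * Y)
  rw [mul_right_comm]
  refine hs2.norm_le_of_bounded hr2 ?_
  intro r
  have h1 := (h.wt hC (fun i => (f i : ℂ) ^ r) (fun j => (g j : ℂ) ^ r) (fun i hi => by
    rw [norm_pow, Complex.norm_real]; exact pow_le_one₀ (norm_nonneg _) (hf i hi)) (fun j hj => by
    rw [norm_pow, Complex.norm_real]; exact pow_le_one₀ (norm_nonneg _) (hg j hj))) a b
  have e1 : ∑ i ∈ s, ∑ j ∈ t, a i * b j * (K i j * ((2 * Real.pi * Complex.I * (f i * g j : ℝ)) ^ r / r.factorial)) =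
      ((2 * Real.pi * Complex.I) ^ r / r.factorial) * ∑ i ∈ s, ∑ j ∈ t, a i * b j * ((f i : ℂ) ^ r * (g j : ℂ) ^ r * K i j) := by
    simp only [mul_sum]
    refine sum_congr rfl fun i _ => sum_congr rfl fun j _ => ?_
    push_cast; rw [mul_pow, mul_pow (f i : ℂ)]; ring
  rw [e1, norm_mul, mul_comm]
  have e2 : ‖(2 * Real.pi * Complex.I) ^ r / (r.factorial : ℂ)‖ = (2 * Real.pi) ^ r / r.factorial := by
    rw [norm_div, norm_pow]
    simp [abs_of_pos Real.pi_pos]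
  rw [e2]
  exact mul_le_mul_of_nonneg_right h1 (by positivity)
end W3

namespace W3
open MeasureTheory Finset
open scoped Classical

lemma rn_small (θ : ℝ) (h : |θ| ≤ 1 / 4) : |θ - round θ| = |θ| := by
  have : round θ = 0 := by
    rw [round_eq, Int.floor_eq_zero_iff, Set.mem_Ico]
    rw [abs_le] at h; constructor <;> linarith
  rw [this]; simp

lemma cube_diff (N x y : ℝ) (hN : 0 ≤ N) (hx : N / 64 ≤ x) (hy : N / 64 ≤ y) :
    |x - y| * (N ^ 2 / 1500) ≤ |x ^ 3 - y ^ 3| := by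
  have : x ^ 3 - y ^ 3 = (x - y) * (x ^ 2 + x * y + y ^ 2) := by ring
  rw [this, abs_mul]
  refine mul_le_mul_of_nonneg_left ?_ (abs_nonneg _)
  refine le_trans ?_ (le_abs_self _)
  have h0 : 0 ≤ N / 64 := by positivity
  have h1 : (N/64)^2 ≤ x ^ 2 := by gcongr
  have h2 : (N/64)^2 ≤ y ^ 2 := by gcongr
  have h3 : (N/64)*(N/64) ≤ x * y := mul_le_mul hx hy h0 (h0.trans hx)
  nlinarith

lemma dyad_sum {ι : Type*} (t : Finset ι) (f : ι → ℝ) (k : ℕ) (hf : ∀ x ∈ t, f x < 2 ^ k) (A B : ℝ)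
    (h0 : (t.card : ℝ) ≤ A + B)
    (hc : ∀ i < k, ((t.filter (fun x => (2:ℝ) ^ i ≤ f x)).card : ℝ) * 2 ^ i ≤ A + B * 2 ^ i) :
    ∑ x ∈ t, f x ≤ (k + 1) * A + B * 2 ^ k := by
  have h1 : ∑ x ∈ t, f x ≤ ∑ x ∈ t, (1 + ∑ i ∈ range k, if (2:ℝ) ^ i ≤ f x then (2:ℝ) ^ i else 0) :=
    sum_le_sum fun x hx => dyad _ _ (hf x hx)
  have h2 : ∑ x ∈ t, ∑ i ∈ range k, (if (2:ℝ) ^ i ≤ f x then (2:ℝ) ^ i else 0) ≤ ∑ i ∈ range k, (A + B * 2 ^ i) := by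
    rw [sum_comm]
    refine sum_le_sum fun i hi => ?_
    rw [← sum_filter, sum_const, nsmul_eq_mul]
    exact hc i (mem_range.1 hi)
  have h3 : ∑ i ∈ range k, (A + B * (2:ℝ) ^ i) = k * A + B * (2 ^ k - 1) := by
    rw [sum_add_distrib, ← mul_sum, geom_sum_eq (by norm_num), sum_const, card_range, nsmul_eq_mul]; ring
  rw [sum_add_distrib] at h1
  simp only [sum_const, nsmul_eq_mul, mul_one] at h1
  linarith

lemma cos_cnt {P E : ℝ} (C : Ctx P E) (q : ℕ) (hq : 0 < q) (hqP : (q:ℝ) ≤ P ^ 20) (n1 : ℤ) (hc : IsCoprime n1 (q:ℤ)) (S : Finset ℤ)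
    (H : ℝ) (hH : 0 ≤ H)
    (hS : ∀ n ∈ S, (q:ℤ) ∣ n1 ^ 3 - n ^ 3 ∧ |(n1:ℝ) - n| ≤ H) : (S.card : ℝ) ≤ E ^ 3 * (2 * H / q + 1) := by
  refine CR_fine C q hq hqP (2 * H) (by positivity) n1 hc S (fun x hx => ?_) (fun x hx y hy => ?_)
  · exact (dvd_sub_comm).1 (hS x hx).1
  · have h1 := abs_le.1 (hS x hx).2
    have h2 := abs_le.1 (hS y hy).2
    push_cast; linarith

lemma L9 {P E : ℝ} (C : Ctx P E) (q : ℕ) (hq : 0 < q) (hqP : (q:ℝ) ≤ P ^ 20) (a : ℤ) (ha : Int.gcd a q = 1) (β M N : ℝ)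
    (hM : 1 ≤ M) (hN : 1 ≤ N) (hB : |β| * M ^ 3 * N ^ 3 ≤ P ^ 10) (s t : Finset ℤ)
    (hs : ∀ m ∈ s, M / 64 ≤ m ∧ (m:ℝ) ≤ M ∧ IsCoprime m (q:ℤ)) (ht : ∀ n ∈ t, N / 64 ≤ n ∧ (n:ℝ) ≤ N ∧ IsCoprime n (q:ℤ)) :
    OpB s t (fun m n => e ((a / q + β) * ((m:ℝ) ^ 3 * (n:ℝ) ^ 3)))
      √(E ^ 12 * (M / (q * (1 + |β| * M ^ 3 * N ^ 3)) + 1) * (N + q * (1 + |β| * M ^ 3 * N ^ 3))) := by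
  have hE := C.hE
  have hE0 := C.E0
  have hE1 := C.E1
  have hq' : (0:ℝ) < q := by exact_mod_cast hq
  have hM0 : 0 < M := by linarith
  have hN0 : 0 < N := by linarith
  set B := |β| * M ^ 3 * N ^ 3 with hBd
  have hB0 : 0 ≤ B := by positivity
  set K : ℤ := ⌈4 * B⌉ + 1 with hK
  have hK1 : (K:ℝ) ≤ 4 * B + 2 := by rw [hK]; push_cast; linarith [Int.ceil_lt_add_one (4 * B)]
  have hK2 : 4 * B + 1 ≤ (K:ℝ) := by rw [hK]; push_cast; linarith [Int.le_ceil (4 * B)]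
  set s' : Finset (ℕ × ℤ) := range q ×ˢ Ioc (-K-1) K
  set K' : ℕ × ℤ → ℤ → ℂ := fun x n => e ((x.1:ℝ) * (a * n ^ 3 : ℤ) / q) * e ((n:ℝ)^3 / (4 * N ^ 3) * x.2) with hK'
  -- Schur bound
  have h1 : OpB s' t K' √(E ^ 6 * (N + q * (1 + B))) := by
    apply OpB.schur
    intro n1 hn1
    obtain ⟨hn1a, hn1b, hn1c⟩ := ht n1 hn1
    obtain ⟨k, hk1, hk2⟩ := bits (2 * K + 1) (by linarith)
    have hkE : (k:ℝ) ≤ E := by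
      refine C.hk k (hk1.trans ?_)
      have : 10 ≤ P ^ 10 := by
        calc (10:ℝ) ≤ 2 ^ 10 := by norm_num
          _ ≤ _ := by gcongr; exact C.hP
      have h20 : P ^ 20 = P ^ 10 * P ^ 10 := by rw [← pow_add]
      have hp2 : (1024:ℝ) ≤ P ^ 10 := by
        calc (1024:ℝ) = 2 ^ 10 := by norm_num
          _ ≤ _ := by gcongr; exact C.hP
      have h21 := mul_le_mul_of_nonneg_right hp2 (by linarith : 0 ≤ P ^ 10)
      rw [h20]; linarith
    set θ : ℤ → ℝ := fun n => (n1:ℝ)^3 / (4 * N ^ 3) - (n:ℝ)^3 / (4 * N ^ 3)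
    have hrow : ∀ n ∈ t, ‖∑ i ∈ s', K' i n1 * (starRingEnd ℂ) (K' i n)‖ ≤ if (q:ℤ) ∣ n1 ^ 3 - n ^ 3 then q * gm (2 * K + 1) (θ n) else 0 := by
      intro n _
      have e1 : ∑ i ∈ s', K' i n1 * (starRingEnd ℂ) (K' i n) =
          (∑ x ∈ range q, e ((x:ℝ) * (a * (n1 ^ 3 - n ^ 3) : ℤ) / q)) * ∑ j ∈ Ioc (-K-1) K, e (θ n * j + 0) := by
        rw [sum_mul_sum, sum_product]
        refine sum_congr rfl fun x _ => sum_congr rfl fun j _ => ?_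
        simp only [hK', map_mul, e_conj, ← e_add]
        congr 1
        simp only [θ]
        push_cast; ring
      rw [e1, orth q hq]
      have hdv : (q:ℤ) ∣ a * (n1 ^ 3 - n ^ 3) ↔ (q:ℤ) ∣ n1 ^ 3 - n ^ 3 := by
        refine ⟨fun h => ?_, fun h => h.mul_left a⟩
        exact (Int.isCoprime_iff_gcd_eq_one.2 ha).symm.dvd_of_dvd_mul_left h
      rw [if_congr hdv rfl rfl]
      split_ifs with hd
      · rw [norm_mul, Complex.norm_natCast]
        refine mul_le_mul_of_nonneg_left (lin_le _ _ _ _ _ ?_ (by linarith)) hq'.le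
        push_cast; linarith
      · simp
    refine (sum_le_sum hrow).trans ?_
    rw [← sum_filter, ← mul_sum]
    set t1 := t.filter (fun n => (q:ℤ) ∣ n1 ^ 3 - n ^ 3) with ht1
    have hθ : ∀ n ∈ t, |(n1:ℝ) - n| ≤ 6000 * N * |θ n - round (θ n)| := by
      intro n hn
      obtain ⟨hna, hnb, hnc⟩ := ht n hn
      have c1 := cube_diff N n1 n hN0.le hn1a hna
      have c2 : |θ n| = |(n1:ℝ)^3 - (n:ℝ)^3| / (4 * N ^ 3) := by
        simp only [θ]; rw [← sub_div, abs_div, abs_of_pos (by positivity : 0 < 4 * N ^ 3)]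
      have c3 : |θ n| ≤ 1 / 4 := by
        rw [c2, div_le_div_iff₀ (by positivity) (by norm_num)]
        have u1 : (n1:ℝ)^3 ≤ N ^ 3 := by
          have : (0:ℝ) ≤ n1 := le_trans (by positivity) hn1a
          gcongr
        have u2 : (n:ℝ)^3 ≤ N ^ 3 := by
          have : (0:ℝ) ≤ n := le_trans (by positivity) hna
          gcongr
        have u3 : (0:ℝ) ≤ (n1:ℝ) ^ 3 := pow_nonneg (le_trans (by positivity) hn1a) 3
        have u4 : (0:ℝ) ≤ (n:ℝ) ^ 3 := pow_nonneg (le_trans (by positivity) hna) 3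
        have : |(n1:ℝ)^3 - (n:ℝ)^3| ≤ N ^ 3 := by rw [abs_le]; constructor <;> linarith
        linarith
      rw [rn_small _ c3, c2, ← mul_div_assoc, le_div_iff₀ (by positivity)]
      have c4 := mul_le_mul_of_nonneg_left c1 (by positivity : 0 ≤ 6000 * N)
      refine le_trans (le_of_eq ?_) c4
      ring
    have hcnt : ∀ H : ℝ, 0 ≤ H → ∀ S ⊆ t1, (∀ n ∈ S, |(n1:ℝ) - n| ≤ H) → (S.card : ℝ) ≤ E ^ 3 * (2 * H / q + 1) := by
      intro H hH S hS hS2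
      exact cos_cnt C q hq hqP n1 hn1c S H hH (fun n hn => ⟨(mem_filter.1 (hS hn)).2, hS2 n hn⟩)
    have hsum := dyad_sum t1 (fun n => gm (2 * K + 1) (θ n)) k (fun n _ => (gm_le _ _).trans_lt hk2)
      (E ^ 3 * (12000 * N / q)) (E ^ 3) (by
        refine (hcnt N hN0.le t1 (Subset.refl _) ?_).trans ?_
        · intro n hn
          obtain ⟨hna, hnb, hnc⟩ := ht n (mem_filter.1 hn).1
          rw [abs_le]; constructor <;> linarith [div_pos hN0 (by norm_num : (0:ℝ) < 64)]
        · rw [mul_add, mul_one]; gcongr; norm_num) (by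
        intro i _
        refine (mul_le_mul_of_nonneg_right (hcnt (6000 * N / 2 ^ i) (by positivity) _ (filter_subset _ _) ?_) (by positivity)).trans (le_of_eq ?_)
        · intro n hn
          rw [mem_filter] at hn
          have g1 := gm_mul (2 * K + 1) (θ n)
          have g2 := hθ n (mem_filter.1 hn.1).1
          rw [le_div_iff₀ (by positivity)]
          have g3 := mul_le_mul_of_nonneg_right hn.2 (abs_nonneg (θ n - round (θ n)))
          have g4 := mul_le_mul_of_nonneg_right g2 (by positivity : (0:ℝ) ≤ 2 ^ i)
          have g5 : 2 ^ i * |θ n - round (θ n)| ≤ 1 := g3.trans g1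
          have g6 := mul_le_mul_of_nonneg_left g5 (by positivity : 0 ≤ 6000 * N)
          linarith
        · field_simp; ring)
    refine (mul_le_mul_of_nonneg_left hsum hq'.le).trans ?_
    have f1 : (q:ℝ) * ((k + 1) * (E ^ 3 * (12000 * N / q)) + E ^ 3 * 2 ^ k) = E ^ 3 * ((k + 1) * 12000 * N + q * 2 ^ k) := by
      field_simp
    rw [f1]
    have f2 : (2:ℝ) ^ k ≤ 16 * (1 + B) := by linarith
    have f3 : ((k:ℝ) + 1) * 12000 ≤ E ^ 3 := by
      have h2 : 2 * E ≤ E * E := mul_le_mul_of_nonneg_right (by linarith) hE0.le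
      have : (k:ℝ) + 1 ≤ E * E := by linarith
      calc ((k:ℝ) + 1) * 12000 ≤ (E * E) * E := by gcongr; linarith
        _ = _ := by ring
    have f4 : (16:ℝ) ≤ E ^ 3 := by
      calc (16:ℝ) ≤ E := by linarith
        _ ≤ _ := le_self_pow₀ hE1 (by norm_num)
    calc E ^ 3 * (((k:ℝ) + 1) * 12000 * N + q * 2 ^ k) ≤ E ^ 3 * (E ^ 3 * N + q * (E ^ 3 * (1 + B))) := by
          gcongr
          exact f2.trans (by gcongr)
      _ = _ := by ring
  -- fibres
  set f : ℤ → ℕ × ℤ := fun m => (((m ^ 3) % q).toNat, ⌊4 * β * m ^ 3 * N ^ 3⌋) with hf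
  have hqz : (q:ℤ) ≠ 0 := by omega
  have hft : ∀ m : ℤ, (((m^3 % q).toNat : ℕ) : ℤ) = m ^ 3 % q := fun m => Int.toNat_of_nonneg (Int.emod_nonneg _ hqz)
  have hX : ∀ m ∈ s, |4 * β * (m:ℝ) ^ 3 * N ^ 3| ≤ 4 * B := by
    intro m hm
    obtain ⟨a1, a2, _⟩ := hs m hm
    have : (0:ℝ) ≤ m := le_trans (by positivity) a1
    rw [abs_mul, abs_mul, abs_mul, abs_of_nonneg (by positivity : (0:ℝ) ≤ (m:ℝ)^3), abs_of_pos (by positivity : 0 < N ^ 3), hBd]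
    norm_num
    rw [mul_assoc, mul_assoc, mul_assoc]
    gcongr
  have hmap : ∀ m ∈ s, f m ∈ s' := by
    intro m hm
    have hx := abs_le.1 (hX m hm)
    simp only [s', hf, mem_product, mem_range, mem_Ioc]
    refine ⟨?_, ?_, ?_⟩
    · have := Int.emod_lt_of_pos (m ^ 3) (by omega : (0:ℤ) < q)
      have := hft m; omega
    · have : -K - 1 + 1 ≤ ⌊4 * β * (m:ℝ) ^ 3 * N ^ 3⌋ := Int.le_floor.2 (by push_cast; linarith)
      omega
    · have : (⌊4 * β * (m:ℝ) ^ 3 * N ^ 3⌋:ℝ) ≤ K := (Int.floor_le _).trans (by linarith)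
      exact_mod_cast this
  set W := 2000 * M / (1 + B) with hW
  have hW0 : 0 ≤ W := by positivity
  have hfib : ∀ x ∈ s', ((s.filter (fun m => f m = x)).card : ℝ) ≤ E ^ 3 * (W / q + 1) := by
    intro x _
    rcases (s.filter (fun m => f m = x)).eq_empty_or_nonempty with h0 | ⟨m0, hm0⟩
    · rw [h0]; simp; positivity
    rw [mem_filter] at hm0
    refine CR_fine C q hq hqP W hW0 m0 (hs m0 hm0.1).2.2 _ ?_ ?_
    · intro m hm
      rw [mem_filter] at hm
      have : (f m).1 = (f m0).1 := by rw [hm.2, hm0.2]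
      simp only [hf] at this
      have h3 : m ^ 3 % q = m0 ^ 3 % q := by
        have c1 := hft m
        rw [this] at c1; exact c1.symm.trans (hft m0)
      exact Int.ModEq.dvd h3.symm
    · intro m hm m' hm'
      rw [mem_filter] at hm hm'
      obtain ⟨a1, a2, _⟩ := hs m hm.1
      obtain ⟨b1, b2, _⟩ := hs m' hm'.1
      push_cast
      rw [hW, le_div_iff₀ (by positivity)]
      have d0 : (m:ℝ) - m' ≤ M := by linarith [div_pos hM0 (by norm_num : (0:ℝ) < 64)]
      have d1 : (f m).2 = (f m').2 := by rw [hm.2, hm'.2]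
      simp only [hf] at d1
      have d2 := Int.abs_sub_lt_one_of_floor_eq_floor d1
      have d3 : 4 * β * (m:ℝ) ^ 3 * N ^ 3 - 4 * β * (m':ℝ) ^ 3 * N ^ 3 = β * (4 * N ^ 3) * ((m:ℝ)^3 - (m':ℝ)^3) := by ring
      rw [d3, abs_mul, abs_mul, abs_of_pos (by positivity : 0 < 4 * N ^ 3)] at d2
      have d4 := cube_diff M m m' hM0.le a1 b1
      have d5 := mul_le_mul_of_nonneg_left d4 (by positivity : 0 ≤ |β| * (4 * N ^ 3) * M)
      have d6 : |(m:ℝ) - m'| * B ≤ 375 * M := by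
        have : |β| * (4 * N ^ 3) * M * (|(m:ℝ) - m'| * (M ^ 2 / 1500)) = |(m:ℝ) - m'| * B / 375 := by rw [hBd]; ring
        rw [this] at d5
        have d7 := mul_lt_mul_of_pos_right d2 hM0
        have d9 : |β| * (4 * N ^ 3) * M * |(m:ℝ) ^ 3 - (m':ℝ) ^ 3| = |β| * (4 * N ^ 3) * |(m:ℝ) ^ 3 - (m':ℝ) ^ 3| * M := by ring
        linarith
      have d8 := mul_le_mul_of_nonneg_right (le_abs_self ((m:ℝ) - m')) hB0
      rw [mul_add, mul_one]
      linarith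
  have h2 := OpB.pull (Real.sqrt_nonneg _) f hmap hfib h1
  have h3 := h2.taylor (by positivity) (fun m : ℤ => Int.fract (4 * β * (m:ℝ) ^ 3 * N ^ 3)) (fun n : ℤ => (n:ℝ)^3 / (4 * N ^ 3))
    (fun m _ => by rw [abs_of_nonneg (Int.fract_nonneg _)]; exact (Int.fract_lt_one _).le) (fun n hn => by
      obtain ⟨b1, b2, _⟩ := ht n hn
      have : (0:ℝ) ≤ n := le_trans (by positivity) b1
      rw [abs_of_nonneg (by positivity), div_le_one (by positivity)]
      have : (n:ℝ)^3 ≤ N ^ 3 := by gcongr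
      linarith [pow_pos hN0 3])
  refine (h3.congr ?_).mono ?_
  · intro m _ n _
    simp only [hK', hf]
    rw [← e_add, ← e_add]
    have hm3 : m ^ 3 = m ^ 3 % q + q * (m ^ 3 / q) := (Int.emod_add_mul_ediv _ _).symm
    have hm4 : (m:ℝ)^3 = ((m^3 % q).toNat : ℕ) + q * ((m ^ 3 / q : ℤ):ℝ) := by
      have h := hm3
      rw [← hft] at h
      exact_mod_cast h
    symm
    apply e_congr (a * n ^ 3 * (m ^ 3 / q))
    have hfr : Int.fract (4 * β * (m:ℝ) ^ 3 * N ^ 3) = 4 * β * (m:ℝ) ^ 3 * N ^ 3 - ⌊4 * β * (m:ℝ) ^ 3 * N ^ 3⌋ := rfl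
    rw [hfr]
    generalize (m ^ 3 / q : ℤ) = z at *
    generalize (m^3 % q).toNat = y at *
    push_cast
    have : (a / q + β) * ((m:ℝ) ^ 3 * (n:ℝ) ^ 3) = a / q * ((m:ℝ)^3) * (n:ℝ)^3 + β * (m:ℝ)^3 * (n:ℝ)^3 := by ring
    rw [this]
    have h5 : a / q * ((m:ℝ)^3) * (n:ℝ)^3 = y * (a * n ^ 3) / q + a * n ^ 3 * z := by
      rw [hm4]; field_simp
    rw [h5]
    field_simp
    ring
  · have hpi : Real.exp (2 * Real.pi) ≤ E := by
      have : Real.exp (2 * Real.pi) ≤ Real.exp 1 ^ 7 := by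
        rw [← Real.exp_nat_mul]; apply Real.exp_le_exp.2; push_cast; linarith [Real.pi_lt_d2]
      refine this.trans ?_
      have h7 : Real.exp 1 ^ 7 ≤ 3 ^ 7 := by gcongr; linarith [Real.exp_one_lt_d9]
      have h8 : (3:ℝ) ^ 7 ≤ 10 ^ 6 := by norm_num
      exact h7.trans (h8.trans hE)
    have hQ : 0 < (q:ℝ) * (1 + B) := by positivity
    have w1 : W / q + 1 ≤ E * (M / (q * (1 + B)) + 1) := by
      have : W / q = 2000 * (M / (q * (1 + B))) := by rw [hW]; field_simp
      rw [this]
      have h0 : 0 ≤ M / (q * (1 + B)) := by positivity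
      generalize M / (q * (1 + B)) = x at h0 ⊢
      have h1 := mul_le_mul_of_nonneg_right hE h0
      norm_num at h1
      rw [mul_add, mul_one]; linarith
    calc √(E ^ 6 * (N + q * (1 + B))) * √(E ^ 3 * (W / q + 1)) * Real.exp (2 * Real.pi)
        ≤ √(E ^ 6 * (N + q * (1 + B))) * √(E ^ 3 * (E * (M / (q * (1 + B)) + 1))) * √(E ^ 2) := by
          rw [Real.sqrt_sq hE0.le]; gcongr
      _ = √(E ^ 12 * (M / (q * (1 + B)) + 1) * (N + q * (1 + B))) := by
          rw [← Real.sqrt_mul (by positivity), ← Real.sqrt_mul (by positivity)]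
          congr 1; ring
end W3

namespace W3
open MeasureTheory Finset
open scoped Classical

lemma sum_Ioc_succ (f : ℤ → ℂ) (u v : ℤ) (h : u ≤ v) : ∑ n ∈ Ioc u (v + 1), f n = ∑ n ∈ Ioc u v, f n + f (v + 1) := by
  have : Ioc u (v + 1) = insert (v + 1) (Ioc u v) := by ext x; simp only [mem_Ioc, mem_insert]; omega
  rw [this, sum_insert (by simp), add_comm]

lemma tele (F : ℤ → ℂ) (u v : ℤ) (h : u ≤ v) : ∑ n ∈ Ioc u v, (F (n + 1) - F n) = F (v + 1) - F (u + 1) := by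
  induction v, h using Int.leInduction with
  | base => simp
  | succ v hv ih => rw [sum_Ioc_succ _ _ _ hv, ih]; ring

lemma abelb (A g : ℤ → ℂ) (u v : ℤ) (h : u ≤ v) (B G : ℝ) (hA : ∀ n, u < n → n ≤ v + 1 → ‖A n‖ ≤ B)
    (hG : ∀ n, u < n → n ≤ v + 1 → ‖g n‖ ≤ G) :
    ‖∑ n ∈ Ioc u v, (A (n + 1) - A n) * g n‖ ≤ B * (2 * G + ∑ n ∈ Ioc u v, ‖g (n + 1) - g n‖) := by
  have e1 : ∑ n ∈ Ioc u v, (A (n + 1) - A n) * g n = (A (v + 1) * g (v + 1) - A (u + 1) * g (u + 1)) -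
      ∑ n ∈ Ioc u v, A (n + 1) * (g (n + 1) - g n) := by
    rw [← tele (fun n => A n * g n) u v h, ← sum_sub_distrib]
    refine sum_congr rfl fun n _ => by ring
  have hb : ∀ n, u < n → n ≤ v + 1 → ‖A n * g n‖ ≤ B * G := fun n h1 h2 => by
    rw [norm_mul]; exact mul_le_mul (hA n h1 h2) (hG n h1 h2) (norm_nonneg _) ((norm_nonneg _).trans (hA n h1 h2))
  rw [e1]
  refine (norm_sub_le _ _).trans ?_
  have h1 := norm_sub_le (A (v + 1) * g (v + 1)) (A (u + 1) * g (u + 1))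
  have h2 := hb (v + 1) (by omega) le_rfl
  have h3 := hb (u + 1) (by omega) (by omega)
  have h4 : ‖∑ n ∈ Ioc u v, A (n + 1) * (g (n + 1) - g n)‖ ≤ B * ∑ n ∈ Ioc u v, ‖g (n + 1) - g n‖ := by
    rw [mul_sum]
    refine (norm_sum_le _ _).trans (sum_le_sum fun n hn => ?_)
    rw [mem_Ioc] at hn
    rw [norm_mul]; exact mul_le_mul_of_nonneg_right (hA _ (by omega) (by omega)) (norm_nonneg _)
  linarith

lemma card_Ioc_le (u v : ℤ) (N : ℝ) (hN : 1 ≤ N) (hu : N ≤ u + 1) (hv : (v:ℝ) ≤ 2 * N) : ((Ioc u v).card : ℝ) ≤ 2 * N := by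
  rw [Int.card_Ioc, ← Int.cast_natCast, Int.toNat_eq_max]
  push_cast
  rw [max_le_iff]; constructor <;> linarith

lemma smooth_sum (β N : ℝ) (hN : 1 ≤ N) (u v : ℤ) (hu : N ≤ u + 1) (hv : (v:ℝ) ≤ 2 * N) :
    ‖∑ n ∈ Ioc u v, e (β * (n:ℝ) ^ 3)‖ ≤ 6 * N / (1 + |β| * N ^ 3) + 400 * (1 + |β| * N ^ 3) := by
  have hN0 : 0 < N := by linarith
  set B := |β| * N ^ 3 with hB
  have hB0 : 0 ≤ B := by positivity
  have hcard := card_Ioc_le u v N hN hu hv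
  have htriv : ‖∑ n ∈ Ioc u v, e (β * (n:ℝ) ^ 3)‖ ≤ 2 * N := by
    refine (norm_sum_le _ _).trans ?_
    simp only [e_norm, sum_const, nsmul_eq_mul, mul_one]; exact hcard
  rcases le_or_gt v u with huv | huv
  · rw [Ioc_eq_empty (by omega)]; simp; positivity
  by_cases h1 : B ≤ 1
  · have : 3 * N ≤ 6 * N / (1 + B) := by rw [le_div_iff₀ (by positivity)]; nlinarith
    have : 0 ≤ 400 * (1 + B) := by positivity
    linarith
  by_cases h2 : N / 160 < B
  · have : 0 ≤ 6 * N / (1 + B) := by positivity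
    linarith
  push Not at h1 h2
  have hβ : 0 < |β| := by
    rcases (abs_nonneg β).eq_or_lt with h | h
    · rw [hB, ← h] at h1; simp at h1; linarith
    · exact h
  set x : ℤ → ℝ := fun n => β * (3 * (n:ℝ) ^ 2 + 3 * n + 1) with hx
  have hrange : ∀ n : ℤ, u < n → n ≤ v + 1 → N ≤ n ∧ (n:ℝ) ≤ 3 * N := by
    intro n a b
    have a' : (u:ℝ) + 1 ≤ n := by exact_mod_cast a
    have b' : (n:ℝ) ≤ v + 1 := by exact_mod_cast b
    constructor <;> linarith
  have hxb : ∀ n : ℤ, u < n → n ≤ v + 1 → |β| * (3 * N ^ 2) ≤ |x n| ∧ |x n| ≤ 1 / 4 := by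
    intro n a b
    obtain ⟨c, d⟩ := hrange n a b
    have hn2 : N ^ 2 ≤ (n:ℝ) ^ 2 := by gcongr
    have hn3 : (n:ℝ) ^ 2 ≤ (3 * N) ^ 2 := by gcongr; linarith
    have : |x n| = |β| * (3 * (n:ℝ) ^ 2 + 3 * n + 1) := by
      rw [hx, abs_mul, abs_of_nonneg (by nlinarith : (0:ℝ) ≤ 3 * (n:ℝ) ^ 2 + 3 * n + 1)]
    rw [this]
    constructor
    · gcongr; linarith
    · have : 3 * (n:ℝ) ^ 2 + 3 * n + 1 ≤ 40 * N ^ 2 := by nlinarith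
      have h5 : |β| * (40 * N ^ 2) * N ≤ N / 4 := by
        have : |β| * (40 * N ^ 2) * N = 40 * B := by rw [hB]; ring
        linarith
      have h6 : |β| * (40 * N ^ 2) ≤ 1 / 4 := by
        by_contra h; push Not at h
        nlinarith
      exact (mul_le_mul_of_nonneg_left this hβ.le).trans h6
  have hden : ∀ n : ℤ, u < n → n ≤ v + 1 → 12 * |β| * N ^ 2 ≤ ‖e (x n) - 1‖ := by
    intro n a b
    have := e_sub_one_ge (x n)
    rw [rn_small _ (hxb n a b).2] at this
    linarith [(hxb n a b).1]
  have hpos : 0 < 12 * |β| * N ^ 2 := by positivity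
  have hne : ∀ n : ℤ, u < n → n ≤ v + 1 → e (x n) - 1 ≠ 0 := by
    intro n a b h
    have := hden n a b
    rw [h, norm_zero] at this; linarith
  have hab := abelb (fun n => e (β * (n:ℝ) ^ 3)) (fun n => (e (x n) - 1)⁻¹) u v huv.le 1 (12 * |β| * N ^ 2)⁻¹
    (fun n _ _ => (e_norm _).le) (fun n a b => by
      rw [norm_inv]; exact inv_anti₀ hpos (hden n a b))
  have e1 : ∑ n ∈ Ioc u v, (e (β * ((n + 1 : ℤ):ℝ) ^ 3) - e (β * (n:ℝ) ^ 3)) * (e (x n) - 1)⁻¹ = ∑ n ∈ Ioc u v, e (β * (n:ℝ) ^ 3) := by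
    refine sum_congr rfl fun n hn => ?_
    rw [mem_Ioc] at hn
    have h3 : e (β * ((n + 1 : ℤ):ℝ) ^ 3) = e (β * (n:ℝ)^3) * e (x n) := by
      rw [← e_add]; congr 1; simp only [hx]; push_cast; ring
    have h4 := hne n hn.1 (by omega)
    rw [h3]; field_simp
  rw [e1] at hab
  refine hab.trans ?_
  have e2 : ∑ n ∈ Ioc u v, ‖(e (x (n + 1)) - 1)⁻¹ - (e (x n) - 1)⁻¹‖ ≤ ∑ n ∈ Ioc u v, 1 / B := by
    refine sum_le_sum fun n hn => ?_
    rw [mem_Ioc] at hn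
    obtain ⟨c, d⟩ := hrange n hn.1 (by omega)
    have d' : (n:ℝ) ≤ 2 * N := le_trans (by exact_mod_cast hn.2) hv
    rw [inv_sub_inv (hne _ (by omega) (by omega)) (hne _ hn.1 (by omega)), norm_div, norm_mul]
    have h3 : ‖e (x n) - 1 - (e (x (n + 1)) - 1)‖ ≤ 7 * (|β| * (18 * N)) := by
      rw [sub_sub_sub_cancel_right]
      refine (e_sub_le _ _).trans ?_
      have : x n - x (n + 1) = - (β * (6 * n + 6)) := by simp only [hx]; push_cast; ring
      rw [this, abs_neg, abs_mul, abs_of_nonneg (by linarith : (0:ℝ) ≤ 6 * n + 6)]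
      gcongr; linarith
    have h4 : (12 * |β| * N ^ 2) * (12 * |β| * N ^ 2) ≤ ‖e (x (n + 1)) - 1‖ * ‖e (x n) - 1‖ :=
      mul_le_mul (hden _ (by omega) (by omega)) (hden _ hn.1 (by omega)) hpos.le (norm_nonneg _)
    calc _ ≤ 7 * (|β| * (18 * N)) / ((12 * |β| * N ^ 2) * (12 * |β| * N ^ 2)) := by gcongr
      _ = (126 / 144) * (1 / B) := by rw [hB]; field_simp; norm_num
      _ ≤ 1 / B := by
        have : 0 ≤ 1 / B := by positivity
        linarith
  rw [sum_const, nsmul_eq_mul] at e2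
  have e3 : (Ioc u v).card * (1 / B) ≤ 2 * N * (1 / B) := by gcongr
  have e4 : (12 * |β| * N ^ 2)⁻¹ = N * (1 / B) / 12 := by rw [hB]; field_simp
  rw [e4]
  have e5 : 6 * N / (1 + B) ≥ 3 * (N * (1 / B)) := by
    rw [ge_iff_le, le_div_iff₀ (by positivity)]
    have : 3 * (N * (1 / B)) * (1 + B) = 3 * N * (1 / B) + 3 * N := by field_simp
    rw [this]
    have : 1 / B ≤ 1 := by rw [div_le_one (by linarith)]; exact h1.le
    nlinarith
  have : 0 ≤ N * (1 / B) := by positivity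
  have : 0 ≤ 400 * (1 + B) := by positivity
  linarith

lemma per_sum (c : ℤ → ℂ) (q : ℕ) (hc : ∀ n, c (n + q) = c n) (n0 n : ℤ) :
    ∑ x ∈ Ioc n (n + q), c x = ∑ x ∈ Ioc n0 (n0 + q), c x := by
  have step : ∀ n : ℤ, ∑ x ∈ Ioc (n + 1) (n + 1 + q), c x = ∑ x ∈ Ioc n (n + q), c x := by
    intro n
    have h1 : ∑ x ∈ Ioc n (n + q + 1), c x = ∑ x ∈ Ioc n (n + q), c x + c (n + q + 1) := sum_Ioc_succ c n (n + q) (by omega)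
    have h2 : ∑ x ∈ Ioc n (n + q + 1), c x = c (n + 1) + ∑ x ∈ Ioc (n + 1) (n + 1 + q), c x := by
      have : Ioc n (n + q + 1) = insert (n + 1) (Ioc (n + 1) (n + 1 + q)) := by ext x; simp only [mem_Ioc, mem_insert]; omega
      rw [this, sum_insert (by simp)]
    have h3 : c (n + q + 1) = c (n + 1) := by rw [← hc (n + 1)]; congr 1; ring
    rw [h3] at h1; rw [h1, add_comm] at h2
    exact (add_left_cancel h2).symm
  have all : ∀ n : ℤ, ∑ x ∈ Ioc n (n + q), c x = ∑ x ∈ Ioc 0 (0 + q : ℤ), c x := by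
    intro n
    induction n with
    | zero => rfl
    | succ i ih => rw [step, ih]
    | pred i ih => rw [← step, ← ih]; congr 2 <;> ring
  rw [all n, all n0]

lemma RC (c : ℤ → ℂ) (q : ℕ) (hq : 0 < q) (hc : ∀ n, c (n + q) = c n) (hc1 : ∀ n, ‖c n‖ ≤ 1) (m : ℝ) (hm1 : m ≤ 1)
    (hm : ‖∑ x ∈ Ioc (q:ℤ) (q + q), c x‖ ≤ q * m) (β N : ℝ) (hN : 1 ≤ N) (u v : ℤ) (hu : N ≤ u + 1) (hv : (v:ℝ) ≤ 2 * N) :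
    ‖∑ n ∈ Ioc u v, c n * e (β * (n:ℝ) ^ 3)‖ ≤ 6 * m * N / (1 + |β| * N ^ 3) + 2000 * q * (1 + |β| * N ^ 3) := by
  have hN0 : 0 < N := by linarith
  have hq' : (0:ℝ) < q := by exact_mod_cast hq
  have hm0 : 0 ≤ m := by
    by_contra h; push Not at h
    have := norm_nonneg (∑ x ∈ Ioc (q:ℤ) (q + q), c x)
    nlinarith
  have hq1 : (1:ℝ) ≤ q := by exact_mod_cast hq
  rcases le_or_gt v u with huv | huv
  · rw [Ioc_eq_empty (by omega)]; simp; positivity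
  set B := |β| * N ^ 3 with hB
  have hB0 : 0 ≤ B := by positivity
  set μ : ℂ := (∑ x ∈ Ioc (q:ℤ) (q + q), c x) / q with hμ
  have hμn : ‖μ‖ ≤ m := by
    rw [hμ, norm_div, Complex.norm_natCast, div_le_iff₀ hq', mul_comm]; exact hm
  set R : ℤ → ℂ := fun n => ∑ j ∈ Ioc u n, c j - μ * ((n - u : ℤ):ℂ) with hR
  have hRb : ∀ k : ℕ, ‖R (u + k)‖ ≤ 2 * q := by
    intro k
    induction k using Nat.strong_induction_on with
    | _ k ih =>
      by_cases hk : k < q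
      · simp only [hR]
        refine (norm_sub_le _ _).trans ?_
        have h1 : ‖∑ j ∈ Ioc u (u + k), c j‖ ≤ k := by
          refine (norm_sum_le _ _).trans ((sum_le_sum fun j _ => hc1 j).trans ?_)
          simp
        have h2 : ‖μ * ((u + k - u : ℤ):ℂ)‖ ≤ k := by
          rw [norm_mul]
          have : ((u + k - u : ℤ):ℂ) = (k:ℂ) := by push_cast; ring
          rw [this, Complex.norm_natCast]
          exact mul_le_of_le_one_left (by positivity) (hμn.trans hm1)
        have : (k:ℝ) ≤ q := by exact_mod_cast hk.le
        linarith
      · have h1 := ih (k - q) (by omega)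
        have h2 : R (u + k) = R (u + (k - q : ℕ)) := by
          have hk' : ((k - q : ℕ):ℤ) = k - q := by omega
          simp only [hR]
          rw [hk']
          have h3 : ∑ j ∈ Ioc u (u + k), c j = ∑ j ∈ Ioc u (u + (k - q : ℤ)), c j + ∑ j ∈ Ioc (u + (k - q : ℤ)) (u + (k - q : ℤ) + q), c j := by
            rw [← sum_union]
            · congr 1; ext x; simp only [mem_Ioc, mem_union]; omega
            · rw [disjoint_left]; intro x; simp only [mem_Ioc]; omega
          rw [h3, per_sum c q hc q]
          have h4 : ∑ x ∈ Ioc (q:ℤ) (q + q), c x = μ * q := by rw [hμ, div_mul_cancel₀ _ (by exact_mod_cast hq.ne')]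
          rw [h4]; push_cast; ring
        rw [h2]; exact h1
  have hsm := smooth_sum β N hN u v hu hv
  have hab := abelb (fun n => R (n - 1)) (fun n => e (β * (n:ℝ) ^ 3)) u v huv.le (2 * q) 1
    (fun n a b => by
      have := hRb (n - 1 - u).toNat
      rwa [Int.toNat_of_nonneg (by omega), show u + (n - 1 - u) = n - 1 by ring] at this) (fun n _ _ => (e_norm _).le)
  have e1 : ∑ n ∈ Ioc u v, c n * e (β * (n:ℝ) ^ 3) = μ * ∑ n ∈ Ioc u v, e (β * (n:ℝ) ^ 3) +
      ∑ n ∈ Ioc u v, (R (n + 1 - 1) - R (n - 1)) * e (β * (n:ℝ) ^ 3) := by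
    rw [mul_sum, ← sum_add_distrib]
    refine sum_congr rfl fun n hn => ?_
    rw [mem_Ioc] at hn
    have h1 := sum_Ioc_succ c u (n - 1) (by omega)
    rw [sub_add_cancel] at h1
    rw [add_sub_cancel_right]
    simp only [hR]
    rw [h1]; push_cast; ring
  rw [e1]
  refine (norm_add_le _ _).trans ?_
  have e2 : ∑ n ∈ Ioc u v, ‖e (β * ((n + 1 : ℤ):ℝ) ^ 3) - e (β * (n:ℝ) ^ 3)‖ ≤ ∑ n ∈ Ioc u v, 140 * |β| * N ^ 2 := by
    refine sum_le_sum fun n hn => ?_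
    rw [mem_Ioc] at hn
    have a' : (u:ℝ) + 1 ≤ n := by exact_mod_cast hn.1
    have b' : (n:ℝ) ≤ v := by exact_mod_cast hn.2
    refine (e_sub_le _ _).trans ?_
    have : β * ((n + 1 : ℤ):ℝ) ^ 3 - β * (n:ℝ) ^ 3 = β * (3 * (n:ℝ) ^ 2 + 3 * n + 1) := by push_cast; ring
    have h1 : (n:ℝ) ^ 2 ≤ (2 * N) ^ 2 := by gcongr <;> linarith
    have h0 : (0:ℝ) ≤ 3 * (n:ℝ) ^ 2 + 3 * n + 1 := by nlinarith
    rw [this, abs_mul, abs_of_nonneg h0]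
    have h2 : 3 * (n:ℝ) ^ 2 + 3 * n + 1 ≤ 20 * N ^ 2 := by nlinarith
    have := mul_le_mul_of_nonneg_left h2 (abs_nonneg β)
    linarith
  rw [sum_const, nsmul_eq_mul] at e2
  have hcard := card_Ioc_le u v N hN hu hv
  have e3 : ((Ioc u v).card : ℝ) * (140 * |β| * N ^ 2) ≤ 2 * N * (140 * |β| * N ^ 2) := by gcongr
  have e4 : 2 * N * (140 * |β| * N ^ 2) = 280 * B := by rw [hB]; ring
  have e5 : 2 * (q:ℝ) * (2 * 1 + ∑ n ∈ Ioc u v, ‖e (β * ((n + 1 : ℤ):ℝ) ^ 3) - e (β * (n:ℝ) ^ 3)‖) ≤ 2 * q * (2 + 280 * B) := by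
    gcongr <;> linarith
  have e6 : ‖μ * ∑ n ∈ Ioc u v, e (β * (n:ℝ) ^ 3)‖ ≤ m * (6 * N / (1 + B)) + 400 * (1 + B) := by
    rw [norm_mul]
    calc _ ≤ m * (6 * N / (1 + B) + 400 * (1 + B)) := mul_le_mul hμn hsm (norm_nonneg _) hm0
      _ ≤ _ := by
        rw [mul_add]
        have : m * (400 * (1 + B)) ≤ 400 * (1 + B) := mul_le_of_le_one_left (by positivity) hm1
        linarith
  have e7 : 6 * m * N / (1 + B) = m * (6 * N / (1 + B)) := by ring
  rw [e7]
  have e8 : 400 * (1 + B) ≤ 400 * (1 + B) * q := le_mul_of_one_le_right (by positivity) hq1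
  have e9 : 0 ≤ q * B := by positivity
  have e10 : 2 * (q:ℝ) * (2 + 280 * B) = 4 * q + 560 * (q * B) := by ring
  have e11 : 2000 * (q:ℝ) * (1 + B) = 2000 * q + 2000 * (q * B) := by ring
  have e12 : 400 * (1 + B) * q = 400 * q + 400 * (q * B) := by ring
  linarith
end W3

namespace W3
open MeasureTheory Finset
open scoped Classical

lemma perm_unit (k : ℕ) (hk : 0 < k) (F : ℤ → ℂ) (hF : ∀ x y : ℤ, (k:ℤ) ∣ x - y → F x = F y) (u : ℤ) (hu : IsCoprime u (k:ℤ)) :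
    ∑ y ∈ (Ioc (k:ℤ) (2 * k)).filter (fun y => IsCoprime y (k:ℤ)), F (u * y) =
      ∑ y ∈ (Ioc (k:ℤ) (2 * k)).filter (fun y => IsCoprime y (k:ℤ)), F y := by
  have hk' : (0:ℤ) < k := by exact_mod_cast hk
  set i : ℤ → ℤ := fun y => k + 1 + (u * y - k - 1) % k with hi
  have hd : ∀ y, (k:ℤ) ∣ u * y - i y := by
    intro y
    have := Int.emod_add_mul_ediv (u * y - k - 1) k
    exact ⟨(u * y - k - 1) / k, by simp only [hi]; linarith⟩
  have h1 : Set.MapsTo i ((Ioc (k:ℤ) (2 * k)).filter (fun y => IsCoprime y (k:ℤ)) : Finset ℤ) ((Ioc (k:ℤ) (2 * k)).filter (fun y => IsCoprime y (k:ℤ)) : Finset ℤ) := by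
    intro y hy
    simp only [coe_filter, mem_Ioc, Set.mem_ofPred_eq] at hy ⊢
    have a := Int.emod_nonneg (u * y - k - 1) hk'.ne'
    have b := Int.emod_lt_of_pos (u * y - k - 1) hk'
    refine ⟨⟨by simp only [hi]; omega, by simp only [hi]; omega⟩, ?_⟩
    obtain ⟨c, hc⟩ := hd y
    have : i y = u * y + k * (-c) := by linarith
    rw [this]
    exact (IsCoprime.add_mul_left_left_iff).2 (hu.mul_left hy.2)
  have h2 : Set.InjOn i ((Ioc (k:ℤ) (2 * k)).filter (fun y => IsCoprime y (k:ℤ)) : Finset ℤ) := by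
    intro x hx y hy hxy
    simp only [coe_filter, mem_Ioc, Set.mem_ofPred_eq] at hx hy
    have : (k:ℤ) ∣ u * (x - y) := by
      have := dvd_sub (hd x) (hd y)
      rw [hxy] at this; exact dvc this (by ring)
    have h3 := hu.symm.dvd_of_dvd_mul_left this
    have h4 := Int.eq_zero_of_abs_lt_dvd h3 (by rw [abs_lt]; constructor <;> omega)
    omega
  refine sum_nbij i (fun y hy => h1 hy) h2 (Finset.surjOn_of_injOn_of_card_le i h1 h2 le_rfl) fun y _ => hF _ _ (hd y)

lemma e_per (b : ℤ) (s : ℕ) (hs : 0 < s) (x y : ℤ) (h : (s:ℤ) ∣ x - y) : e ((b:ℝ) * (x:ℝ) ^ 3 / s) = e ((b:ℝ) * (y:ℝ) ^ 3 / s) := by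
  obtain ⟨c, hc⟩ := h.trans (sub_dvd_pow_sub_pow x y 3)
  refine e_congr (b * c) ?_
  have hs' : (s:ℝ) ≠ 0 := by exact_mod_cast hs.ne'
  have : (x:ℝ) ^ 3 - (y:ℝ) ^ 3 = s * c := by exact_mod_cast hc
  have : (x:ℝ) ^ 3 = y ^ 3 + s * c := by linarith
  rw [this]; push_cast; field_simp

lemma GS {P E : ℝ} (C : Ctx P E) (k s : ℕ) (hk : 0 < k) (hkP : (k:ℝ) ≤ P ^ 20) (hs : s ∣ k) (b : ℤ) (hb : Int.gcd b s = 1) :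
    ‖∑ y ∈ (Ioc (k:ℤ) (2 * k)).filter (fun y => IsCoprime y (k:ℤ)), e ((b:ℝ) * (y:ℝ) ^ 3 / s)‖ ≤ 3 * E ^ 6 * k / √s := by
  have hs0 : 0 < s := Nat.pos_of_dvd_of_pos hs hk
  have hsk : s ≤ k := Nat.le_of_dvd hk hs
  have hs1 : (1:ℝ) ≤ s := by exact_mod_cast hs0
  have hskr : (s:ℝ) ≤ k := by exact_mod_cast hsk
  set U := (Ioc (k:ℤ) (2 * k)).filter (fun y => IsCoprime y (k:ℤ)) with hU
  set G := ∑ y ∈ U, e ((b:ℝ) * (y:ℝ) ^ 3 / s) with hG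
  have hUm : ∀ m ∈ U, (2 * (k:ℝ)) / 64 ≤ m ∧ (m:ℝ) ≤ 2 * k ∧ IsCoprime m (s:ℤ) := by
    intro m hm
    rw [hU, mem_filter, mem_Ioc] at hm
    have h1 : (k:ℝ) < m := by exact_mod_cast hm.1.1
    have h2 : (m:ℝ) ≤ 2 * k := by exact_mod_cast hm.1.2
    refine ⟨by linarith, h2, hm.2.of_isCoprime_of_dvd_right (by exact_mod_cast hs)⟩
  have h9 := L9 C s hs0 (hskr.trans hkP) b hb 0 (2 * k) (2 * k) (by linarith) (by linarith) (by simp; exact pow_nonneg C.P0.le _) U U hUm hUm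
  have h := h9 (fun _ => 1) (fun _ => 1)
  have hUc : (2 * k : ℤ) ∈ Ioc (k:ℤ) (2 * k) := by rw [mem_Ioc]; omega
  have hUne : 0 < (U.card : ℝ) := by
    have : (k + 1 : ℤ) ∈ U := by
      rw [hU, mem_filter, mem_Ioc]
      refine ⟨by omega, 1, -1, by ring⟩
    exact_mod_cast card_pos.2 ⟨_, this⟩
  have e1 : ∑ i ∈ U, ∑ j ∈ U, (1:ℂ) * 1 * e (((b:ℝ) / s + 0) * ((i:ℝ) ^ 3 * (j:ℝ) ^ 3)) = U.card * G := by
    rw [← nsmul_eq_mul, ← sum_const]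
    refine sum_congr rfl fun u hu => ?_
    have hu' := (mem_filter.1 hu).2
    rw [hG, hU, ← perm_unit k hk (fun y => e ((b:ℝ) * (y:ℝ) ^ 3 / s)) (fun x y h => e_per b s hs0 x y (dvd_trans (by exact_mod_cast hs) h)) u hu']
    refine sum_congr rfl fun y _ => ?_
    rw [one_mul, one_mul]; congr 1; push_cast; ring
  rw [e1] at h
  simp only [norm_one, one_pow, sum_const, nsmul_eq_mul, mul_one, abs_zero, zero_mul, add_zero, norm_mul, Complex.norm_natCast] at h
  rw [Real.mul_self_sqrt hUne.le, mul_comm, mul_le_mul_iff_left₀ hUne] at h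
  refine h.trans ?_
  have hs0' : (0:ℝ) < s := by linarith
  rw [le_div_iff₀ (Real.sqrt_pos.2 hs0'), ← Real.sqrt_mul (by have := C.E0; positivity), Real.sqrt_le_left (by have := C.E0; positivity)]
  have hE := C.E0
  have : (2 * (k:ℝ) / s + 1) * (2 * k + s) * s ≤ (3 * k) * (3 * k) := by
    have : (2 * (k:ℝ) / s + 1) * (2 * k + s) * s = (2 * k + s) * (2 * k + s) := by field_simp
    rw [this]; gcongr <;> linarith
  calc _ = E ^ 12 * ((2 * (k:ℝ) / s + 1) * (2 * k + s) * s) := by ring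
    _ ≤ E ^ 12 * ((3 * k) * (3 * k)) := by gcongr
    _ = _ := by ring
end W3

namespace W3
open MeasureTheory Finset
open scoped Classical

lemma FS {P E : ℝ} (C : Ctx P E) (r : ℕ) (hr : 0 < r) (hrP : (r:ℝ) ≤ P ^ 20) (b : ℤ) (hb : Int.gcd b r = 1) :
    ‖∑ x ∈ Ioc (r:ℤ) (r + r), e ((b:ℝ) * (x:ℝ) ^ 3 / r)‖ ≤
      ∑ g ∈ r.divisors, 3 * E ^ 6 * r / (g * √((r / r.gcd (g ^ 3) : ℕ):ℝ)) := by
  rw [← sum_fiberwise_of_maps_to (t := r.divisors) (g := fun x : ℤ => Int.gcd x r)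
    (fun x _ => Nat.mem_divisors.2 ⟨by exact_mod_cast Int.gcd_dvd_right x (r:ℤ), hr.ne'⟩)]
  refine (norm_sum_le _ _).trans (sum_le_sum fun g hg => ?_)
  have hgr := (Nat.mem_divisors.1 hg).1
  have hg0 : 0 < g := Nat.pos_of_dvd_of_pos hgr hr
  obtain ⟨k, hk⟩ := hgr
  have hk0 : 0 < k := by rcases Nat.eq_zero_or_pos k with h | h; · subst h; omega
                         · exact h
  set d := r.gcd (g ^ 3) with hd
  have hd0 : 0 < d := Nat.gcd_pos_of_pos_left _ hr
  obtain ⟨s, hs⟩ : d ∣ r := Nat.gcd_dvd_left _ _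
  obtain ⟨c, hc⟩ : d ∣ g ^ 3 := Nat.gcd_dvd_right _ _
  have hsd : r / d = s := by rw [hs]; exact Nat.mul_div_cancel_left _ hd0
  rw [hsd]
  have hs0 : 0 < s := by rcases Nat.eq_zero_or_pos s with h | h; · subst h; omega
                         · exact h
  have hsk : s ∣ k := by
    obtain ⟨f, hf⟩ : g ∣ d := Nat.dvd_gcd ⟨k, hk⟩ (dvd_pow_self g (by norm_num))
    refine ⟨f, ?_⟩
    have : g * k = g * (s * f) := by rw [← hk, hs, hf]; ring
    exact Nat.eq_of_mul_eq_mul_left hg0 this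
  have hcs : Nat.Coprime c s := by
    have : Nat.gcd (d * s) (d * c) = d := by rw [← hs, ← hc]
    rw [Nat.gcd_mul_left] at this
    have : d * Nat.gcd s c = d * 1 := by omega
    exact (Nat.eq_of_mul_eq_mul_left hd0 this : Nat.gcd s c = 1) |> fun h => (Nat.gcd_comm _ _).trans h
  have hbs : Int.gcd (b * c) s = 1 := by
    rw [← Int.isCoprime_iff_gcd_eq_one]
    refine IsCoprime.mul_left ?_ (Nat.isCoprime_iff_coprime.2 hcs)
    exact (Int.isCoprime_iff_gcd_eq_one.2 hb).of_isCoprime_of_dvd_right (by exact_mod_cast (⟨d, by rw [hs]; ring⟩ : s ∣ r))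
  have hkr : (k:ℝ) ≤ r := by exact_mod_cast Nat.le_of_dvd hr ⟨g, by rw [hk]; ring⟩
  have hG := GS C k s hk0 (hkr.trans hrP) hsk (b * c) hbs
  have e1 : ∑ x ∈ Ioc (r:ℤ) (r + r) with Int.gcd x r = g, e ((b:ℝ) * (x:ℝ) ^ 3 / r) =
      ∑ y ∈ (Ioc (k:ℤ) (2 * k)).filter (fun y => IsCoprime y (k:ℤ)), e (((b * c : ℤ):ℝ) * (y:ℝ) ^ 3 / s) := by
    symm
    have hgz : (0:ℤ) < g := by exact_mod_cast hg0
    have hrz : (r:ℤ) = g * k := by exact_mod_cast hk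
    refine sum_nbij (fun y => g * y) ?_ ?_ ?_ ?_
    · intro y hy
      rw [mem_filter, mem_Ioc] at hy ⊢
      refine ⟨⟨?_, ?_⟩, ?_⟩
      · rw [hrz]; exact mul_lt_mul_of_pos_left hy.1.1 hgz
      · rw [hrz]; have := mul_le_mul_of_nonneg_left hy.1.2 hgz.le; linarith
      · rw [hrz, Int.gcd_mul_left, Int.isCoprime_iff_gcd_eq_one.1 hy.2]; simp
    · intro x _ y _ h; exact mul_left_cancel₀ hgz.ne' h
    · intro x hx
      rw [coe_filter, Set.mem_ofPred_eq, mem_Ioc] at hx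
      obtain ⟨y, hy⟩ : (g:ℤ) ∣ x := by rw [← hx.2]; exact Int.gcd_dvd_left _ _
      subst hy
      refine ⟨y, ?_, rfl⟩
      rw [coe_filter, Set.mem_ofPred_eq, mem_Ioc]
      rw [hrz, Int.gcd_mul_left] at hx
      refine ⟨⟨lt_of_mul_lt_mul_left hx.1.1 hgz.le, le_of_mul_le_mul_left (by linarith [hx.1.2]) hgz⟩, ?_⟩
      rw [Int.isCoprime_iff_gcd_eq_one]
      have : g * Int.gcd y k = g * 1 := by simpa using hx.2
      exact Nat.eq_of_mul_eq_mul_left hg0 this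
    · intro y _
      congr 1
      have h1 : (r:ℝ) = d * s := by exact_mod_cast hs
      have h2 : (g:ℝ) ^ 3 = d * c := by exact_mod_cast hc
      have h3 : (d:ℝ) ≠ 0 := by exact_mod_cast hd0.ne'
      have h4 : (s:ℝ) ≠ 0 := by exact_mod_cast hs0.ne'
      push_cast
      rw [mul_pow, h2, h1]; field_simp
  rw [e1]
  refine hG.trans (le_of_eq ?_)
  have h2 : (r:ℝ) = g * k := by exact_mod_cast hk
  have h4 : (g:ℝ) ≠ 0 := by exact_mod_cast hg0.ne'
  rw [h2, show 3 * E ^ 6 * ((g:ℝ) * k) = g * (3 * E ^ 6 * k) by ring, mul_div_mul_left _ _ h4]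

lemma W' {P E : ℝ} (C : Ctx P E) (γ N Δ : ℝ) (hN : 1 ≤ N) (hNP : 2 * N ≤ P) (hΔ : 1 ≤ Δ) (hΔN : Δ ^ 5 * E ^ 5 ≤ N) (u v : ℤ)
    (hu : N ≤ u + 1) (hv : (v:ℝ) ≤ 2 * N) (hT : N / Δ ≤ ‖∑ n ∈ Ioc u v, e (γ * (n:ℝ) ^ 3)‖) :
    ∃ (b : ℤ) (r g s : ℕ), 0 < r ∧ Int.gcd b r = 1 ∧ g ∣ r ∧ r = r.gcd (g ^ 3) * s ∧
      r * (1 + |γ - b / r| * N ^ 3) ≤ Δ ^ 3 * E ^ 24 ∧ s * g ^ 2 * (1 + |γ - b / r| * N ^ 3) ^ 2 ≤ Δ ^ 2 * E ^ 16 := by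
  have hE := C.hE
  have hE0 := C.E0
  have hE1 := C.E1
  have hN0 : 0 < N := by linarith
  have hΔ0 : 0 < Δ := by linarith
  have hD5 : Δ ^ 4 ≤ Δ ^ 5 := pow_le_pow_right₀ hΔ (by norm_num)
  have hbig : 10 ^ 6 * (Δ ^ 5 * E ^ 4) ≤ N := by
    refine le_trans ?_ hΔN
    calc 10 ^ 6 * (Δ ^ 5 * E ^ 4) ≤ E * (Δ ^ 5 * E ^ 4) := by gcongr
      _ = _ := by ring
  have hb4 : Δ ^ 4 * E ^ 4 ≤ Δ ^ 5 * E ^ 4 := by gcongr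
  have hp4 : 0 < Δ ^ 4 * E ^ 4 := by positivity
  obtain ⟨b, r, hr, hb, hrle, hrb⟩ := weyl C γ (2 * N) (2 * Δ) (by linarith) hNP (by linarith)
    (by rw [mul_pow]; linarith) u v (by push_cast; linarith)
    (by rw [mul_div_mul_left _ _ (by norm_num)]; exact hT)
  have hr' : (0:ℝ) < r := by exact_mod_cast hr
  have hr1 : (1:ℝ) ≤ r := by exact_mod_cast hr
  rw [mul_pow] at hrle hrb
  set β := γ - b / r with hβ
  set B := |β| * N ^ 3 with hB
  have hB0 : 0 ≤ B := by positivity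
  have hrB : r * (1 + B) ≤ 32 * (Δ ^ 4 * E ^ 4) := by
    have : γ * r - b = β * r := by rw [hβ]; field_simp
    rw [this, abs_mul, abs_of_pos hr'] at hrb
    have : r * (1 + B) = r + (2 * N) ^ 3 * (|β| * r) / 8 := by rw [hB]; ring
    rw [this]; linarith
  have hrP : (r:ℝ) ≤ P ^ 20 := by
    have h1 : P ≤ P ^ 20 := le_self_pow₀ C.P1 (by norm_num)
    have : r * 1 ≤ r * (1 + B) := by gcongr; linarith
    linarith
  have hF := FS C r hr hrP b hb
  set c : ℤ → ℂ := fun x => e ((b:ℝ) * (x:ℝ) ^ 3 / r) with hc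
  set m := ‖∑ x ∈ Ioc (r:ℤ) (r + r), c x‖ / r with hm
  have hm1 : m ≤ 1 := by
    rw [hm, div_le_one hr']
    refine (norm_sum_le _ _).trans ?_
    simp [hc, e_norm]
  have hR := RC c r hr (fun n => e_per b r hr _ _ ⟨1, by ring⟩) (fun n => (e_norm _).le) m hm1
    (by rw [hm, mul_div_cancel₀ _ hr'.ne']) β N hN u v hu hv
  have e1 : ∑ n ∈ Ioc u v, c n * e (β * (n:ℝ) ^ 3) = ∑ n ∈ Ioc u v, e (γ * (n:ℝ) ^ 3) := by
    refine sum_congr rfl fun n _ => ?_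
    simp only [hc]; rw [← e_add]; congr 1; rw [hβ]; ring
  rw [e1] at hR
  have h5 : 2000 * r * (1 + B) ≤ N / (2 * Δ) := by
    rw [le_div_iff₀ (by positivity)]
    have : 2000 * r * (1 + B) * (2 * Δ) = 4000 * Δ * (r * (1 + B)) := by ring
    rw [this]
    calc _ ≤ 4000 * Δ * (32 * (Δ ^ 4 * E ^ 4)) := by gcongr
      _ = 128000 * (Δ ^ 5 * E ^ 4) := by ring
      _ ≤ _ := by linarith [hb4]
  have h6 : N / Δ = N / (2 * Δ) + N / (2 * Δ) := by field_simp; norm_num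
  have h7 : N / (2 * Δ) ≤ 6 * m * N / (1 + B) := by linarith [hR, hT]
  rw [div_le_div_iff₀ (by positivity) (by positivity)] at h7
  have h8 : (1 + B) ≤ 12 * Δ * m := by
    have : N * (1 + B) ≤ N * (12 * Δ * m) := by linarith
    exact le_of_mul_le_mul_left this hN0
  have h9 : m ≤ ∑ g ∈ r.divisors, 3 * E ^ 6 / (g * √((r / r.gcd (g ^ 3) : ℕ):ℝ)) := by
    rw [hm, div_le_iff₀ hr', sum_mul]
    refine hF.trans (le_of_eq (sum_congr rfl fun g _ => by ring))
  have hdv : (r.divisors.card : ℝ) ≤ E := C.hd r hrP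
  have hdp : 0 < (r.divisors.card : ℝ) := by exact_mod_cast card_pos.2 ⟨1, Nat.mem_divisors.2 ⟨one_dvd _, hr.ne'⟩⟩
  obtain ⟨g, hg, hgm⟩ : ∃ g ∈ r.divisors, (1 + B) / (12 * Δ * E) ≤ 3 * E ^ 6 / (g * √((r / r.gcd (g ^ 3) : ℕ):ℝ)) := by
    refine exists_le_of_sum_le (card_pos.1 (by exact_mod_cast hdp)) (le_trans ?_ h9)
    rw [sum_const, nsmul_eq_mul]
    calc r.divisors.card * ((1 + B) / (12 * Δ * E)) ≤ E * ((1 + B) / (12 * Δ * E)) := by gcongr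
      _ = (1 + B) / (12 * Δ) := by field_simp
      _ ≤ m := by rw [div_le_iff₀ (by positivity)]; linarith
  have hgr := (Nat.mem_divisors.1 hg).1
  have hg0 : 0 < g := Nat.pos_of_dvd_of_pos hgr hr
  have hd0 : 0 < r.gcd (g ^ 3) := Nat.gcd_pos_of_pos_left _ hr
  set s := r / r.gcd (g ^ 3) with hs
  have hrs : r = r.gcd (g ^ 3) * s := (Nat.mul_div_cancel' (Nat.gcd_dvd_left _ _)).symm
  have hs0 : 0 < s := by rcases Nat.eq_zero_or_pos s with h | h; · rw [h] at hrs; omega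
                         · exact h
  have hg' : (1:ℝ) ≤ g := by exact_mod_cast hg0
  have hs1 : (1:ℝ) ≤ s := by exact_mod_cast hs0
  have hsq : 1 ≤ √(s:ℝ) := Real.one_le_sqrt.2 hs1
  set t := √(s:ℝ) with ht
  have hts : t ^ 2 = s := Real.sq_sqrt (by linarith)
  have hy : g * t * (1 + B) ≤ Δ * E ^ 8 := by
    rw [div_le_div_iff₀ (by positivity) (by positivity)] at hgm
    calc g * t * (1 + B) ≤ 36 * (Δ * E ^ 7) := by linarith
      _ ≤ E * (Δ * E ^ 7) := by gcongr; linarith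
      _ = _ := by ring
  refine ⟨b, r, g, s, hr, hb, hgr, hrs, ?_, ?_⟩
  · have h1 : (r:ℝ) ≤ g ^ 3 * t ^ 2 := by
      rw [hts]
      have : r ≤ g ^ 3 * s := by
        calc r = r.gcd (g ^ 3) * s := hrs
          _ ≤ g ^ 3 * s := Nat.mul_le_mul_right _ (Nat.gcd_le_right _ (by positivity))
      exact_mod_cast this
    calc r * (1 + B) ≤ (g ^ 3 * t ^ 2) * (1 + B) := by gcongr
      _ ≤ (g ^ 3 * t ^ 3) * (1 + B) ^ 3 := by
        gcongr
        · norm_num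
        · exact le_self_pow₀ (by linarith) (by norm_num)
      _ = (g * t * (1 + B)) ^ 3 := by ring
      _ ≤ (Δ * E ^ 8) ^ 3 := by gcongr
      _ = _ := by ring
  · calc s * g ^ 2 * (1 + B) ^ 2 = (g * t * (1 + B)) ^ 2 := by rw [← hts]; ring
      _ ≤ (Δ * E ^ 8) ^ 2 := by gcongr
      _ = _ := by ring
end W3

namespace W3
open MeasureTheory Finset
open scoped Classical

lemma card_Icc_real (S : Finset ℤ) (x y : ℝ) (hS : ∀ n ∈ S, x ≤ n ∧ (n:ℝ) ≤ y) (hxy : x ≤ y) : (S.card : ℝ) ≤ y - x + 1 := by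
  have h : S ⊆ Icc ⌈x⌉ ⌊y⌋ := fun n hn => mem_Icc.2 ⟨Int.ceil_le.2 (hS n hn).1, Int.le_floor.2 (hS n hn).2⟩
  have h1 : (S.card : ℝ) ≤ ((Icc ⌈x⌉ ⌊y⌋).card : ℝ) := by exact_mod_cast card_le_card h
  refine h1.trans ?_
  rw [Int.card_Icc, ← Int.cast_natCast, Int.toNat_eq_max]
  push_cast
  rw [max_le_iff]
  constructor
  · linarith [Int.le_ceil x, Int.floor_le y]
  · linarith

lemma fib_cube {P E : ℝ} (C : Ctx P E) (n1 : ℤ) (r : ℤ → ℕ) (S : Finset ℤ) (v : ℤ) (hv : 0 < v) (hvP : (v:ℝ) ≤ P ^ 20)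
    (hS : ∀ n ∈ S, (r n:ℤ) * |n1 ^ 3 - n ^ 3| = v) : (S.card : ℝ) ≤ 2 * E := by
  have h := card_fib S v.toNat.divisors (fun n => (n1 ^ 3 - n ^ 3).natAbs) 2 ?_ ?_
  · refine h.trans ?_
    have : (v.toNat.divisors.card : ℝ) ≤ E := by
      refine C.hd _ ?_
      have h1 : ((v.toNat : ℤ):ℝ) = v := by rw [Int.toNat_of_nonneg hv.le]
      rw [← Int.cast_natCast, h1]; exact hvP
    linarith
  · intro n hn
    rw [Nat.mem_divisors]
    refine ⟨?_, by omega⟩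
    rw [← Int.natCast_dvd_natCast, Int.natCast_natAbs, Int.toNat_of_nonneg hv.le, ← hS n hn]
    exact dvd_mul_left _ _
  · intro c _
    have hodd : Odd 3 := by decide
    have : (S.filter (fun n => (n1 ^ 3 - n ^ 3).natAbs = c)).card ≤ ({n1 ^ 3 - (c:ℤ), n1 ^ 3 + (c:ℤ)} : Finset ℤ).card := by
      refine card_le_card_of_injOn (fun n => n ^ 3) ?_ ?_
      · intro n hn
        have := (mem_filter.1 hn).2
        simp only [coe_insert, coe_singleton, Set.mem_insert_iff, Set.mem_singleton_iff]
        omega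
      · intro x _ y _ h
        exact hodd.strictMono_pow.injective h
    have h2 := this.trans (card_le_two)
    exact_mod_cast h2

lemma gcd_avoid {P E : ℝ} (C : Ctx P E) (q : ℕ) (hq : 0 < q) (hqP : (q:ℝ) ≤ P ^ 20) (N H : ℝ) (hN : 0 ≤ N) (hH : 0 < H) (n1 : ℤ)
    (S : Finset ℤ) (hb : ∀ x ∈ S, ∀ y ∈ S, ((x - y : ℤ):ℝ) ≤ N) (hc : E ^ 3 * (N / H + 1) < S.card) :
    ∃ n ∈ S, ((Int.gcd q (n1 ^ 3 - n ^ 3) : ℕ):ℝ) ≤ H ^ 3 := by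
  by_contra hcon
  push Not at hcon
  have h := card_fib S q.divisors (fun n => Int.gcd q (n1 ^ 3 - n ^ 3)) (E ^ 2 * (N / H + 1))
    (fun n _ => Nat.mem_divisors.2 ⟨by exact_mod_cast Int.gcd_dvd_left (q:ℤ) _, hq.ne'⟩) (fun h hh => ?_)
  · have h1 := C.hd q hqP
    have h2 : 0 ≤ E ^ 2 * (N / H + 1) := by have := C.E0; positivity
    have h3 := mul_le_mul_of_nonneg_right h1 h2
    have h4 : E * (E ^ 2 * (N / H + 1)) = E ^ 3 * (N / H + 1) := by ring
    linarith
  · have hh' := (Nat.mem_divisors.1 hh).1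
    have hh0 : 0 < h := Nat.pos_of_dvd_of_pos hh' hq
    rcases (S.filter (fun n => Int.gcd q (n1 ^ 3 - n ^ 3) = h)).eq_empty_or_nonempty with he | ⟨n, hn⟩
    · rw [he]; have := C.E0; simp; positivity
    · rw [mem_filter] at hn
      have hl := hcon n hn.1
      rw [hn.2] at hl
      refine CR_coarse C h hh0 (le_trans (by exact_mod_cast Nat.le_of_dvd hq hh') hqP) N H hN hH hl.le n1 _ ?_ ?_
      · intro x hx
        rw [← (mem_filter.1 hx).2]
        have := Int.gcd_dvd_right (q:ℤ) (n1 ^ 3 - x ^ 3)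
        exact dvc ((dvd_neg).2 this) (by ring)
      · intro x hx y hy
        exact hb x (mem_filter.1 hx).1 y (mem_filter.1 hy).1

lemma L8 {P E : ℝ} (C : Ctx P E) (α M N D2 : ℝ) (hMP : M ≤ P) (hNM : N ≤ M) (hD : 1 ≤ D2) (hDN : D2 * E ^ 7 ≤ N)
    (hDM : D2 ^ 4 * E ^ 12 ≤ M) (hDMN : D2 ^ 8 * E ^ 26 * N ^ 2 ≤ M ^ 3) (u v : ℤ) (huv : ((v - u : ℤ):ℝ) ≤ M) (t : Finset ℤ)
    (ht : ∀ n ∈ t, N / 64 ≤ n ∧ (n:ℝ) ≤ N) :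
    OpB (Ioc u v) t (fun m n => e (α * ((m:ℝ) ^ 3 * (n:ℝ) ^ 3))) √(M * N / D2) ∨
    ∃ (a : ℤ) (q : ℕ), 0 < q ∧ Int.gcd a q = 1 ∧ q * (1 + |α - a / q| * (M ^ 3 * N ^ 3)) ≤ D2 ^ 4 * E ^ 24 := by
  have hE := C.hE
  have hE0 := C.E0
  have hE1 := C.E1
  have hE7 : 1 ≤ E ^ 7 := one_le_pow₀ hE1
  have hN1 : 1 ≤ N := le_trans (one_le_mul_of_one_le_of_one_le hD hE7) hDN
  have hM1 : 1 ≤ M := hN1.trans hNM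
  have hM0 : 0 < M := by linarith
  have hN0 : 0 < N := by linarith
  have hD0 : 0 < D2 := by linarith
  by_cases hR : ∀ j ∈ t, ∑ j' ∈ t, ‖∑ i ∈ Ioc u v, e (α * ((i:ℝ) ^ 3 * (j:ℝ) ^ 3)) * (starRingEnd ℂ) (e (α * ((i:ℝ) ^ 3 * (j':ℝ) ^ 3)))‖ ≤ M * N / D2
  · exact Or.inl (OpB.schur hR)
  right
  push Not at hR
  obtain ⟨n1, hn1, hR⟩ := hR
  set T : ℤ → ℂ := fun n => ∑ i ∈ Ioc u v, e (α * ((n1:ℝ) ^ 3 - (n:ℝ) ^ 3) * (i:ℝ) ^ 3) with hT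
  have hRT : M * N / D2 < ∑ n ∈ t, ‖T n‖ := by
    refine hR.trans_le (le_of_eq (sum_congr rfl fun n _ => ?_))
    congr 1
    refine sum_congr rfl fun i _ => ?_
    rw [e_conj, ← e_add]; congr 1; ring
  have hTM : ∀ n, ‖T n‖ ≤ M := by
    intro n
    refine (norm_sum_le _ _).trans ?_
    simp only [e_norm, sum_const, nsmul_eq_mul, mul_one]
    rw [Int.card_Ioc, ← Int.cast_natCast, Int.toNat_eq_max]
    push_cast; push_cast at huv
    rw [max_le_iff]; constructor <;> linarith
  have htc : (t.card : ℝ) ≤ N := by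
    have h := card_Icc_real t 1 N (fun n hn => ⟨?_, (ht n hn).2⟩) hN1
    · linarith
    · have : (0:ℝ) < n := by linarith [(ht n hn).1]
      have : 0 < n := by exact_mod_cast this
      exact_mod_cast this
  have hA1 : 1 ≤ D2 * E ^ 2 := one_le_mul_of_one_le_of_one_le hD (one_le_pow₀ hE1)
  set A := D2 * E ^ 2 with hA
  have hA0 : 0 < A := by positivity
  obtain ⟨k, hk1, hk2⟩ := bits A hA1
  have hA4 : A ^ 4 * E ^ 4 ≤ M := by rw [hA]; refine le_trans (le_of_eq ?_) hDM; ring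
  have hkE : (k:ℝ) + 1 ≤ E ^ 2 := by
    have h1 : (k:ℝ) ≤ E := by
      refine C.hk k ?_
      have h2 : A ≤ A ^ 4 := le_self_pow₀ hA1 (by norm_num)
      have h3 : 2 ≤ E ^ 4 := le_trans (by linarith) (le_self_pow₀ hE1 (by norm_num : 4 ≠ 0))
      have h4 : 2 * A ≤ A ^ 4 * E ^ 4 := by rw [mul_comm]; exact mul_le_mul h2 h3 (by norm_num) (by positivity)
      have h5 : P ≤ P ^ 20 := le_self_pow₀ C.P1 (by norm_num)
      linarith
    have : E * 2 ≤ E * E := by gcongr; linarith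
    rw [sq]; linarith
  obtain ⟨i, hi⟩ : ∃ i : ℕ, N < ((t.filter (fun n => (2:ℝ) ^ i ≤ A * ‖T n‖ / M)).card : ℝ) * 2 ^ i := by
    by_contra hcon
    push Not at hcon
    have h := dyad_sum t (fun n => A * ‖T n‖ / M) k (fun n _ => lt_of_le_of_lt
      (by rw [div_le_iff₀ hM0]; exact mul_le_mul_of_nonneg_left (hTM n) hA0.le) hk2) N 0 (by linarith) (fun i _ => by linarith [hcon i])
    have e1 : ∑ n ∈ t, A * ‖T n‖ / M = A / M * ∑ n ∈ t, ‖T n‖ := by rw [mul_sum]; exact sum_congr rfl fun n _ => by ring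
    rw [e1] at h
    have h2 : A / M * (M * N / D2) < A / M * ∑ n ∈ t, ‖T n‖ := by gcongr
    have h3 : A / M * (M * N / D2) = E ^ 2 * N := by rw [hA]; field_simp
    have h4 : ((k:ℝ) + 1) * N ≤ E ^ 2 * N := by gcongr
    linarith
  set S0 := t.filter (fun n => (2:ℝ) ^ i ≤ A * ‖T n‖ / M) with hS0
  have h2i : (0:ℝ) < 2 ^ i := by positivity
  set Δ := A / 2 ^ i with hΔ
  have hΔ1 : 1 ≤ Δ := by
    have : S0.Nonempty := by
      rw [nonempty_iff_ne_empty]; intro h; rw [h] at hi; simp at hi; linarith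
    obtain ⟨n, hn⟩ := this
    have := (mem_filter.1 hn).2
    rw [hΔ, le_div_iff₀ h2i, one_mul]
    refine this.trans ?_
    rw [div_le_iff₀ hM0]; exact mul_le_mul_of_nonneg_left (hTM n) hA0.le
  have hΔ0 : 0 < Δ := by linarith
  have hΔA : Δ ≤ A := div_le_self hA0.le (one_le_pow₀ (by norm_num))
  set Y := N * Δ / A with hY
  have hY1 : N / 2 ^ i = Y := by rw [hY, hΔ]; field_simp
  have hS0Y : Y < S0.card := by rw [← hY1, div_lt_iff₀ h2i]; exact hi
  have hYb : E ^ 5 ≤ Y := by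
    rw [hY, le_div_iff₀ hA0]
    calc E ^ 5 * A = D2 * E ^ 7 := by rw [hA]; ring
      _ ≤ N * 1 := by linarith
      _ ≤ N * Δ := by gcongr
  have hE5 : E * 10 ^ 12 ≤ E ^ 5 := by
    have : (10:ℝ) ^ 12 ≤ E ^ 4 := by
      calc (10:ℝ) ^ 12 ≤ (10 ^ 6) ^ 4 := by norm_num
        _ ≤ E ^ 4 := by gcongr
    calc E * 10 ^ 12 ≤ E * E ^ 4 := by gcongr
      _ = _ := by ring
  have hY0 : 0 < Y := by linarith
  set S1 := S0.filter (fun n : ℤ => Y / 4 < |(n1:ℝ) - n|) with hS1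
  have hS1c : Y / 4 ≤ S1.card := by
    have h1 := card_filter_add_card_filter_not (s := S0) (fun n : ℤ => Y / 4 < |(n1:ℝ) - n|)
    have h2 := card_Icc_real (S0.filter (fun n : ℤ => ¬ (Y / 4 < |(n1:ℝ) - n|))) (n1 - Y / 4) (n1 + Y / 4) (fun n hn => by
      have := (mem_filter.1 hn).2
      rw [not_lt, abs_le] at this
      constructor <;> linarith) (by linarith)
    have h3 : (S1.card : ℝ) + ((S0.filter (fun n : ℤ => ¬ (Y / 4 < |(n1:ℝ) - n|))).card : ℝ) = S0.card := by rw [hS1, ← Nat.cast_add, h1]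
    linarith
  have hΔ4 : Δ ^ 4 * E ^ 4 ≤ M := le_trans (by gcongr) hA4
  have hW : ∀ n ∈ S1, ∃ (b : ℤ) (r : ℕ), 0 < r ∧ (r:ℝ) ≤ Δ ^ 4 * E ^ 4 ∧ M ^ 3 * |α * ((n1:ℝ) ^ 3 - (n:ℝ) ^ 3) * r - b| ≤ Δ ^ 4 * E ^ 4 := by
    intro n hn
    have h1 := (mem_filter.1 (mem_filter.1 hn).1).2
    obtain ⟨b, r, h2, _, h3, h4⟩ := weyl C (α * ((n1:ℝ) ^ 3 - (n:ℝ) ^ 3)) M Δ hM1 hMP hΔ1 hΔ4 u v huv (by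
      rw [hΔ, div_div_eq_mul_div, div_le_iff₀ hA0]
      rw [le_div_iff₀ hM0] at h1
      simp only [hT] at h1
      linarith)
    exact ⟨b, r, h2, h3, h4⟩
  choose! b r hr0 hr hb using hW
  have hc : ∀ n ∈ S1, Y / 4 * (N ^ 2 / 1500) ≤ |(n1:ℝ) ^ 3 - (n:ℝ) ^ 3| ∧ |(n1:ℝ) ^ 3 - (n:ℝ) ^ 3| ≤ N ^ 3 := by
    intro n hn
    have h1 := (mem_filter.1 hn).2
    have h2 := ht n (mem_filter.1 (mem_filter.1 hn).1).1
    have h3 := ht n1 hn1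
    refine ⟨le_trans (by gcongr) (cube_diff N n1 n hN0.le h3.1 h2.1), ?_⟩
    have a1 : 0 ≤ (n1:ℝ) := by linarith
    have a2 : 0 ≤ (n:ℝ) := by linarith
    have b1 : (n1:ℝ) ^ 3 ≤ N ^ 3 := by gcongr; exact h3.2
    have b2 : (n:ℝ) ^ 3 ≤ N ^ 3 := by gcongr; exact h2.2
    have b3 : 0 ≤ (n1:ℝ) ^ 3 := by positivity
    have b4 : 0 ≤ (n:ℝ) ^ 3 := by positivity
    rw [abs_le]; constructor <;> linarith
  set F : ℤ → ℤ := fun n => (r n:ℤ) * |n1 ^ 3 - n ^ 3| with hF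
  have hFr : ∀ n, (F n:ℝ) = r n * |(n1:ℝ) ^ 3 - (n:ℝ) ^ 3| := by intro n; simp only [hF]; push_cast; rfl
  set V := Δ ^ 4 * E ^ 4 * N ^ 3 with hV
  set κ := Δ ^ 4 * E ^ 4 / M ^ 3 with hκ
  have hF0 : ∀ n ∈ S1, 0 < F n := by
    intro n hn
    have h1 : (0:ℝ) < F n := by
      rw [hFr]
      have a : (0:ℝ) < r n := by exact_mod_cast hr0 n hn
      have b : 0 < Y / 4 * (N ^ 2 / 1500) := by positivity
      exact mul_pos a (b.trans_le (hc n hn).1)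
    exact_mod_cast h1
  have hFV : ∀ n ∈ S1, (F n:ℝ) ≤ V := by
    intro n hn
    rw [hFr]; exact mul_le_mul (hr n hn) (hc n hn).2 (abs_nonneg _) (by positivity)
  have hVP : V ≤ P ^ 20 := by
    calc V ≤ M * M ^ 3 := by rw [hV]; gcongr
      _ ≤ P * P ^ 3 := by have := C.P0; gcongr
      _ = P ^ 4 := by ring
      _ ≤ _ := pow_le_pow_right₀ C.P1 (by norm_num)
  have hV1 : 1 ≤ V := by
    rw [hV]
    have a : 1 ≤ Δ ^ 4 := one_le_pow₀ hΔ1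
    have b : 1 ≤ E ^ 4 := one_le_pow₀ hE1
    have c : 1 ≤ N ^ 3 := one_le_pow₀ hN1
    exact one_le_mul_of_one_le_of_one_le (one_le_mul_of_one_le_of_one_le a b) c
  have hfib := card_fib S1 (S1.image F) F (2 * E) (fun n hn => mem_image_of_mem _ hn) (fun w hw => by
    obtain ⟨n, hn, rfl⟩ := mem_image.1 hw
    exact fib_cube C n1 r _ (F n) (hF0 n hn) ((hFV n hn).trans hVP) (fun x hx => (mem_filter.1 hx).2))
  obtain ⟨a, q, hq0, haq, hqv⟩ := CL α V κ hV1 (by positivity) (S1.image F) (by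
    intro w hw
    obtain ⟨n, hn, rfl⟩ := mem_image.1 hw
    refine ⟨hF0 n hn, hFV n hn, ?_⟩
    have h1 : |α * F n - round (α * F n)| ≤ M ^ 3 * |α * ((n1:ℝ) ^ 3 - (n:ℝ) ^ 3) * r n - b n| / M ^ 3 := by
      rw [mul_div_cancel_left₀ _ (by positivity), hFr]
      rcases abs_choice ((n1:ℝ) ^ 3 - (n:ℝ) ^ 3) with h | h <;> rw [h]
      · refine (round_le _ (b n)).trans (le_of_eq ?_)
        congr 1; ring
      · refine (round_le _ (- b n)).trans (le_of_eq ?_)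
        rw [← abs_neg]; congr 1; push_cast; ring
    refine h1.trans ?_
    rw [hκ]; exact div_le_div_of_nonneg_right (hb n hn) (by positivity)) (by
    have h1 : Y / 4 ≤ (S1.image F).card * (2 * E) := hS1c.trans hfib
    have h2 : 24 * V * κ * (2 * E) < Y / 4 := by
      rw [hV, hκ, hY]
      have h3 : 200 * (Δ ^ 7 * E ^ 9 * N ^ 2 * A) ≤ M ^ 3 := by
        refine le_trans ?_ hDMN
        calc 200 * (Δ ^ 7 * E ^ 9 * N ^ 2 * A) ≤ E * (A ^ 7 * E ^ 9 * N ^ 2 * A) := by gcongr; linarith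
          _ = D2 ^ 8 * E ^ 26 * N ^ 2 := by rw [hA]; ring
      have h4 : 24 * (Δ ^ 4 * E ^ 4 * N ^ 3) * (Δ ^ 4 * E ^ 4 / M ^ 3) * (2 * E) = (192 * (Δ ^ 7 * E ^ 9 * N ^ 2 * A)) * (N * Δ / A / 4) / M ^ 3 := by
        field_simp; ring
      rw [h4, div_lt_iff₀ (by positivity), mul_comm]
      have : 0 < Δ ^ 7 * E ^ 9 * N ^ 2 * A := by positivity
      gcongr
      linarith
    by_contra hcon
    push Not at hcon
    have := mul_le_mul_of_nonneg_right hcon (by positivity : 0 ≤ 2 * E)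
    linarith)
  have hqF : ∀ n ∈ S1, (q:ℤ) ∣ F n ∧ |α - a / q| * F n ≤ κ := fun n hn => hqv _ (mem_image_of_mem _ hn)
  have hS1ne : S1.Nonempty := by
    rw [nonempty_iff_ne_empty]; intro h; rw [h] at hS1c; simp at hS1c; linarith
  have hqP : (q:ℝ) ≤ P ^ 20 := by
    obtain ⟨n, hn⟩ := hS1ne
    refine le_trans ?_ ((hFV n hn).trans hVP)
    exact_mod_cast Int.le_of_dvd (hF0 n hn) (hqF n hn).1
  set H := 16 * E ^ 3 * N / Y with hH
  have hH0 : 0 < H := by positivity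
  obtain ⟨n, hn, hg⟩ := gcd_avoid C q hq0 hqP N H hN0.le hH0 n1 S1 (fun x hx y hy => by
      have h2 := ht x (mem_filter.1 (mem_filter.1 hx).1).1
      have h3 := ht y (mem_filter.1 (mem_filter.1 hy).1).1
      push_cast; linarith) (by
      have h1 : E ^ 3 * (N / H + 1) = Y / 16 + E ^ 3 := by rw [hH]; field_simp
      have h2 : E ^ 3 * 10 ^ 6 ≤ E ^ 5 := by
        calc E ^ 3 * 10 ^ 6 ≤ E ^ 3 * E := by gcongr
          _ = E ^ 4 := by ring
          _ ≤ E ^ 5 := pow_le_pow_right₀ hE1 (by norm_num)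
      rw [h1]; linarith [pow_pos hE0 3])
  obtain ⟨hqd, hqa⟩ := hqF n hn
  have hr' : (0:ℝ) < r n := by exact_mod_cast hr0 n hn
  have hqr : (q:ℝ) ≤ r n * H ^ 3 := by
    have h1 : (q:ℤ) ∣ (n1 ^ 3 - n ^ 3) * r n := by
      have : (q:ℤ) ∣ |n1 ^ 3 - n ^ 3| * r n := by rw [mul_comm]; exact hqd
      rcases abs_choice (n1 ^ 3 - n ^ 3) with h | h
      · rwa [h] at this
      · rw [h, neg_mul, dvd_neg] at this; exact this
    have h2 := Int.le_of_dvd (by exact_mod_cast hr0 n hn) (gcd_split q hq0 _ _ h1)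
    have h3 : q / Int.gcd q (n1 ^ 3 - n ^ 3) ≤ r n := by exact_mod_cast h2
    have h4 : Int.gcd q (n1 ^ 3 - n ^ 3) ∣ q := Int.natCast_dvd_natCast.1 (Int.gcd_dvd_left (q:ℤ) _)
    have h5 : q ≤ r n * Int.gcd q (n1 ^ 3 - n ^ 3) := by
      calc q = q / Int.gcd q (n1 ^ 3 - n ^ 3) * Int.gcd q (n1 ^ 3 - n ^ 3) := (Nat.div_mul_cancel h4).symm
        _ ≤ _ := Nat.mul_le_mul_right _ h3
    calc (q:ℝ) ≤ ((r n * Int.gcd q (n1 ^ 3 - n ^ 3) : ℕ):ℝ) := by exact_mod_cast h5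
      _ = r n * ((Int.gcd q (n1 ^ 3 - n ^ 3) : ℕ):ℝ) := by push_cast; rfl
      _ ≤ _ := by gcongr
  refine ⟨a, q, hq0, haq, ?_⟩
  have hH' : H = 16 * D2 * E ^ 5 / Δ := by rw [hH, hY, hA]; field_simp
  have hX : Δ ^ 4 * E ^ 4 * H ^ 3 ≤ 4096 * (D2 ^ 4 * E ^ 21) := by
    calc Δ ^ 4 * E ^ 4 * H ^ 3 = 4096 * (D2 ^ 3 * E ^ 19) * Δ := by rw [hH']; field_simp; norm_num
      _ ≤ 4096 * (D2 ^ 3 * E ^ 19) * A := by gcongr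
      _ = _ := by rw [hA]; ring
  have hX1 : (q:ℝ) ≤ 4096 * (D2 ^ 4 * E ^ 21) := (hqr.trans (by gcongr; exact hr n hn)).trans hX
  have hX2 : q * (|α - a / q| * (M ^ 3 * N ^ 3)) ≤ 24576000 * (D2 ^ 4 * E ^ 21) := by
    have hcpos : 0 < Y / 4 * (N ^ 2 / 1500) := by positivity
    have hcn := (hc n hn).1
    rw [hFr] at hqa
    have h1 : |α - a / q| * r n ≤ κ / (Y / 4 * (N ^ 2 / 1500)) := by
      rw [le_div_iff₀ hcpos]
      calc |α - a / q| * r n * (Y / 4 * (N ^ 2 / 1500)) ≤ |α - a / q| * r n * |(n1:ℝ) ^ 3 - (n:ℝ) ^ 3| := by gcongr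
        _ ≤ κ := by linarith
    calc q * (|α - a / q| * (M ^ 3 * N ^ 3)) ≤ (r n * H ^ 3) * (|α - a / q| * (M ^ 3 * N ^ 3)) := by gcongr
      _ = (|α - a / q| * r n) * (H ^ 3 * (M ^ 3 * N ^ 3)) := by ring
      _ ≤ (κ / (Y / 4 * (N ^ 2 / 1500))) * (H ^ 3 * (M ^ 3 * N ^ 3)) := by gcongr
      _ = 24576000 * (D2 ^ 4 * E ^ 21) := by
        rw [hκ, hH', hY, hA]; field_simp; norm_num
  have hE3 : 24600000 ≤ E ^ 3 := by
    calc (24600000:ℝ) ≤ (10 ^ 6) ^ 3 := by norm_num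
      _ ≤ E ^ 3 := by gcongr
  calc q * (1 + |α - a / q| * (M ^ 3 * N ^ 3)) = q + q * (|α - a / q| * (M ^ 3 * N ^ 3)) := by ring
    _ ≤ 24600000 * (D2 ^ 4 * E ^ 21) := by
      have : 0 < D2 ^ 4 * E ^ 21 := by positivity
      linarith
    _ ≤ E ^ 3 * (D2 ^ 4 * E ^ 21) := by gcongr
    _ = _ := by ring
end W3

namespace W3
open MeasureTheory Finset
open scoped Classical

lemma gcd_avoid0 {P E : ℝ} (C : Ctx P E) (q : ℕ) (hq : 0 < q) (hqP : (q:ℝ) ≤ P ^ 20) (K H : ℝ) (hK : 0 ≤ K) (hH : 0 < H)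
    (S : Finset ℤ) (hS : ∀ k ∈ S, 1 ≤ k ∧ (k:ℝ) ≤ K) (hc : E ^ 3 * (2 * K / H) < S.card) :
    ∃ k ∈ S, ((Int.gcd q (k ^ 3) : ℕ):ℝ) ≤ H ^ 3 := by
  rcases lt_or_ge K H with h | h
  · have : S.Nonempty := by
      rw [nonempty_iff_ne_empty]; rintro rfl; simp at hc
      have : 0 ≤ E ^ 3 * (2 * K / H) := by have := C.E0; positivity
      linarith
    obtain ⟨k, hk⟩ := this
    refine ⟨k, hk, ?_⟩
    have hk0 : (0:ℝ) ≤ k := by have := (hS k hk).1; exact_mod_cast (by omega : 0 ≤ k)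
    have h1 : ((Int.gcd q (k ^ 3) : ℕ):ℤ) ≤ k ^ 3 := Int.le_of_dvd (pow_pos (by have := (hS k hk).1; omega) 3) (Int.gcd_dvd_right _ _)
    have h2 : ((Int.gcd q (k ^ 3) : ℕ):ℝ) ≤ (k:ℝ) ^ 3 := by exact_mod_cast h1
    refine h2.trans ?_
    have := (hS k hk).2
    gcongr; linarith
  · obtain ⟨k, hk, hg⟩ := gcd_avoid C q hq hqP K H hK hH 0 S (fun x hx y hy => by
      have h1 := hS x hx
      have h2 := hS y hy
      have : (1:ℝ) ≤ y := by exact_mod_cast h2.1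
      push_cast; linarith) (lt_of_le_of_lt (by
        have := C.E0
        have h3 : 1 ≤ K / H := by rw [le_div_iff₀ hH]; linarith
        have h4 : 2 * K / H = K / H + K / H := by ring
        rw [h4]; gcongr) hc)
    refine ⟨k, hk, ?_⟩
    rwa [zero_pow (by norm_num), zero_sub, Int.gcd_neg] at hg

lemma harm (G : ℕ) (hG : 0 < G) (E : ℝ) (hE : Real.log G ≤ E) : ∑ g ∈ Icc 1 G, (1:ℝ) / g ≤ E + 1 := by
  have h := harmonic_le_one_add_log G
  rw [harmonic_eq_sum_Icc] at h
  push_cast at h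
  simp only [one_div]
  linarith

lemma L10a {P E : ℝ} (C : Ctx P E) (α K N D : ℝ) (hK : 1 ≤ K) (hNP : 2 * N ≤ P) (hKP : K ≤ P) (hD : 1 ≤ D) (hDN : D ^ 5 * E ^ 9 ≤ N)
    (hDK : D ^ 5 * E ^ 36 * K ^ 2 ≤ N ^ 3) (S : Finset ℤ) (hS : ∀ k ∈ S, 1 ≤ k ∧ K / 2 ≤ k ∧ (k:ℝ) ≤ K) (hSc : K / (8 * D) ≤ S.card)
    (b : ℤ → ℤ) (r g s : ℤ → ℕ) (hW : ∀ k ∈ S, 0 < r k ∧ g k ∣ r k ∧ r k = (r k).gcd (g k ^ 3) * s k ∧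
      s k * (g k:ℝ) ^ 2 * (1 + |α * k ^ 3 - b k / r k| * N ^ 3) ^ 2 ≤ (4 * D) ^ 2 * E ^ 16) :
    ∃ (a : ℤ) (q : ℕ), 0 < q ∧ (q:ℝ) ≤ D ^ 9 * E ^ 68 ∧ |α * q - a| * (N * K) ^ 3 ≤ D ^ 9 * E ^ 68 := by
  have hE := C.hE
  have hE0 := C.E0
  have hE1 := C.E1
  have hD0 : 0 < D := by linarith
  have hK0 : 0 < K := by linarith
  have hN1 : 1 ≤ N := le_trans (one_le_mul_of_one_le_of_one_le (one_le_pow₀ hD) (one_le_pow₀ hE1)) hDN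
  have hN0 : 0 < N := by linarith
  have hg0 : ∀ k ∈ S, 0 < g k := fun k hk => Nat.pos_of_dvd_of_pos (hW k hk).2.1 (hW k hk).1
  have hs0 : ∀ k ∈ S, 0 < s k := fun k hk => by
    rcases Nat.eq_zero_or_pos (s k) with h | h
    · have h1 := (hW k hk).2.2.1
      have h2 := (hW k hk).1
      rw [h] at h1; omega
    · exact h
  have hW2 : ∀ k ∈ S, s k * (g k:ℝ) ^ 2 ≤ 16 * D ^ 2 * E ^ 16 ∧ (g k:ℝ) ^ 3 * s k * |α * k ^ 3 - b k / r k| * N ^ 3 ≤ 16 * D ^ 2 * E ^ 16 * g k := by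
    intro k hk
    have h1 := (hW k hk).2.2.2
    set B := |α * k ^ 3 - b k / r k| * N ^ 3 with hB
    have hB0 : 0 ≤ B := by positivity
    have h2 : 1 + B ≤ (1 + B) ^ 2 := le_self_pow₀ (by linarith) (by norm_num)
    have h3 : s k * (g k:ℝ) ^ 2 * (1 + B) ≤ 16 * D ^ 2 * E ^ 16 := by
      calc s k * (g k:ℝ) ^ 2 * (1 + B) ≤ s k * (g k:ℝ) ^ 2 * (1 + B) ^ 2 := by gcongr
        _ ≤ _ := h1.trans (le_of_eq (by ring))
    have h4 : 0 ≤ s k * (g k:ℝ) ^ 2 * B := by positivity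
    have h5 : 0 ≤ s k * (g k:ℝ) ^ 2 := by positivity
    constructor
    · linarith
    · calc (g k:ℝ) ^ 3 * s k * |α * k ^ 3 - b k / r k| * N ^ 3 = (s k * (g k:ℝ) ^ 2 * B) * g k := by rw [hB]; ring
        _ ≤ _ := mul_le_mul_of_nonneg_right (by linarith) (by positivity)
  have hgb : ∀ k ∈ S, (g k:ℝ) ≤ 4 * D * E ^ 8 := by
    intro k hk
    have h1 : (1:ℝ) ≤ s k := by exact_mod_cast hs0 k hk
    have h2 : (g k:ℝ) ^ 2 ≤ (4 * D * E ^ 8) ^ 2 := by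
      calc (g k:ℝ) ^ 2 ≤ s k * (g k:ℝ) ^ 2 := le_mul_of_one_le_left (by positivity) h1
        _ ≤ _ := (hW2 k hk).1.trans (le_of_eq (by ring))
    exact le_of_sq_le_sq h2 (by positivity)
  set G := ⌊4 * D * E ^ 8⌋₊ with hG
  have hGr : (G:ℝ) ≤ 4 * D * E ^ 8 := Nat.floor_le (by positivity)
  have hG0 : 0 < G := by
    rw [hG, Nat.floor_pos]
    have : 1 ≤ E ^ 8 := one_le_pow₀ hE1
    exact one_le_mul_of_one_le_of_one_le (by linarith) this
  have hSc0 : 0 < (S.card : ℝ) := lt_of_lt_of_le (by positivity) hSc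
  obtain ⟨g0, hg0m, hg0c⟩ : ∃ g0 ∈ Icc 1 G, K / (8 * D * g0 * E ^ 2) ≤ ((S.filter (fun k => g k = g0)).card : ℝ) := by
    by_contra hcon
    push Not at hcon
    have h1 : S.card = ∑ g0 ∈ Icc 1 G, (S.filter (fun k => g k = g0)).card :=
      Finset.card_eq_sum_card_fiberwise (f := g) (t := Icc 1 G) (fun k hk => by
        rw [coe_Icc, Set.mem_Icc]
        exact ⟨hg0 k hk, Nat.le_floor (hgb k hk)⟩)
    have h2 : (S.card : ℝ) < ∑ g0 ∈ Icc 1 G, K / (8 * D * g0 * E ^ 2) := by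
      rw [h1]; push_cast
      exact sum_lt_sum_of_nonempty ⟨1, mem_Icc.2 ⟨le_rfl, hG0⟩⟩ hcon
    have h3 : ∑ g0 ∈ Icc 1 G, K / (8 * D * g0 * E ^ 2) = K / (8 * D * E ^ 2) * ∑ g0 ∈ Icc 1 G, (1:ℝ) / g0 := by
      rw [mul_sum]; exact sum_congr rfl fun x _ => by ring
    have h4 := harm G hG0 E (by
      refine le_trans (Real.log_le_log (by exact_mod_cast hG0) ?_) C.hl
      calc (G:ℝ) ≤ 4 * D * E ^ 8 := hGr
        _ ≤ E * D ^ 5 * E ^ 8 := by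
          gcongr
          · linarith
          · exact le_self_pow₀ hD (by norm_num)
        _ = D ^ 5 * E ^ 9 := by ring
        _ ≤ P := by linarith)
    have h5 : K / (8 * D * E ^ 2) * ∑ g0 ∈ Icc 1 G, (1:ℝ) / g0 ≤ K / (8 * D * E ^ 2) * E ^ 2 := by
      gcongr
      refine h4.trans ?_
      rw [sq]
      have : E * 2 ≤ E * E := by gcongr; linarith
      linarith
    have h6 : K / (8 * D * E ^ 2) * E ^ 2 = K / (8 * D) := by field_simp
    linarith
  rw [mem_Icc] at hg0m
  set S1 := S.filter (fun k => g k = g0) with hS1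
  have hS1S : ∀ k ∈ S1, k ∈ S ∧ g k = g0 := fun k hk => mem_filter.1 hk
  have hg1 : (1:ℝ) ≤ g0 := by exact_mod_cast hg0m.1
  have hg0' : (0:ℝ) < g0 := by linarith
  have hg2 : (g0:ℝ) ≤ 4 * D * E ^ 8 := le_trans (by exact_mod_cast hg0m.2) hGr
  set F : ℤ → ℤ := fun k => s k * k ^ 3 with hF
  have hFr : ∀ k, (F k:ℝ) = s k * (k:ℝ) ^ 3 := by intro k; simp only [hF]; push_cast; rfl
  set V := 16 * D ^ 2 * E ^ 16 / g0 ^ 2 * K ^ 3 with hV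
  set κ := 16 * D ^ 2 * E ^ 16 * g0 / N ^ 3 with hκ
  have hF0 : ∀ k ∈ S1, 0 < F k := by
    intro k hk
    have h1 := hs0 k (hS1S k hk).1
    have h2 := (hS k (hS1S k hk).1).1
    have h3 : (0:ℤ) < s k := by exact_mod_cast h1
    have h4 : 0 < k := by omega
    simp only [hF]; positivity
  have hk0 : ∀ k ∈ S, (0:ℝ) < k := fun k hk => by have := (hS k hk).1; exact_mod_cast (by omega : 0 < k)
  have hFV : ∀ k ∈ S1, (F k:ℝ) ≤ V := by
    intro k hk
    obtain ⟨h1, h2⟩ := hS1S k hk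
    have h3 := (hW2 k h1).1
    rw [h2] at h3
    rw [hFr, hV]
    have h4 := hk0 k h1
    have h5 : (s k:ℝ) ≤ 16 * D ^ 2 * E ^ 16 / g0 ^ 2 := by rw [le_div_iff₀ (by positivity)]; exact h3
    have h6 := (hS k h1).2.2
    gcongr
  have hS1ne : S1.Nonempty := by
    rw [nonempty_iff_ne_empty]; intro h; rw [h] at hg0c; simp at hg0c
    have : 0 < K / (8 * D * g0 * E ^ 2) := by positivity
    linarith
  have hV1 : 1 ≤ V := by
    obtain ⟨k, hk⟩ := hS1ne
    refine le_trans ?_ (hFV k hk)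
    exact_mod_cast hF0 k hk
  have hVP : V ≤ P ^ 20 := by
    have h0 : E ^ 9 ≤ P := by
      have : E ^ 9 ≤ D ^ 5 * E ^ 9 := le_mul_of_one_le_left (by positivity) (one_le_pow₀ hD)
      linarith
    have h1 : 16 * D ^ 2 * E ^ 16 / g0 ^ 2 ≤ P ^ 2 := by
      calc 16 * D ^ 2 * E ^ 16 / g0 ^ 2 ≤ 16 * D ^ 2 * E ^ 16 := div_le_self (by positivity) (one_le_pow₀ hg1)
        _ ≤ E ^ 2 * (D ^ 5) ^ 2 * E ^ 16 := by
          gcongr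
          · have : (10 ^ 6) ^ 2 ≤ E ^ 2 := by gcongr
            linarith
          · exact le_self_pow₀ hD (by norm_num)
        _ = (D ^ 5 * E ^ 9) ^ 2 := by ring
        _ ≤ P ^ 2 := by gcongr; linarith
    have hP0 := C.P0
    calc V ≤ P ^ 2 * P ^ 3 := by rw [hV]; gcongr
      _ = P ^ 5 := by ring
      _ ≤ _ := pow_le_pow_right₀ C.P1 (by norm_num)
  have hfib := card_fib S1 (S1.image F) F E (fun n hn => mem_image_of_mem _ hn) (fun w hw => by
    obtain ⟨k, hk, rfl⟩ := mem_image.1 hw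
    have hw0 := hF0 k hk
    have h1 := C.hd (F k).toNat (by
      have h1 : (((F k).toNat : ℤ):ℝ) = F k := by rw [Int.toNat_of_nonneg hw0.le]
      rw [← Int.cast_natCast, h1]; exact (hFV k hk).trans hVP)
    refine le_trans ?_ h1
    have : (S1.filter (fun a => F a = F k)).card ≤ (F k).toNat.divisors.card := by
      refine card_le_card_of_injOn (fun k => k.toNat) ?_ ?_
      · intro x hx
        obtain ⟨hx1, hx2⟩ := mem_filter.1 hx
        have hx3 := (hS x (hS1S x hx1).1).1
        rw [mem_coe, Nat.mem_divisors]
        refine ⟨?_, by omega⟩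
        rw [← Int.natCast_dvd_natCast, Int.toNat_of_nonneg hw0.le, Int.toNat_of_nonneg (by omega), ← hx2]
        exact dvd_mul_of_dvd_right (dvd_pow_self x (by norm_num)) _
      · intro x hx y hy hxy
        have hx3 := (hS x (hS1S x (mem_filter.1 hx).1).1).1
        have hy3 := (hS y (hS1S y (mem_filter.1 hy).1).1).1
        simp only at hxy
        omega
    exact_mod_cast this)
  obtain ⟨a, q, hq0, -, hqv⟩ := CL (α * g0 ^ 3) V κ hV1 (by positivity) (S1.image F) (by
    intro w hw
    obtain ⟨k, hk, rfl⟩ := mem_image.1 hw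
    refine ⟨hF0 k hk, hFV k hk, ?_⟩
    obtain ⟨h1, h2⟩ := hS1S k hk
    have h3 := (hW2 k h1).2
    have h4 := (hW k h1).2.2.1
    have h5 := (hW k h1).1
    rw [h2] at h3 h4
    obtain ⟨c, hc⟩ : (r k).gcd (g0 ^ 3) ∣ g0 ^ 3 := Nat.gcd_dvd_right _ _
    set d := (r k).gcd (g0 ^ 3) with hd
    refine (round_le _ (b k * c)).trans ?_
    have h6 : (r k:ℝ) = d * s k := by exact_mod_cast h4
    have h7 : (g0:ℝ) ^ 3 = d * c := by exact_mod_cast hc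
    have h8 : (r k:ℝ) ≠ 0 := by exact_mod_cast h5.ne'
    have h9 : α * g0 ^ 3 * F k - ((b k * c : ℤ):ℝ) = g0 ^ 3 * s k * (α * k ^ 3 - b k / r k) := by
      have : (g0:ℝ) ^ 3 * s k * (b k / r k) = c * b k := by
        rw [h7, show (d:ℝ) * c * s k = c * (d * s k) by ring, ← h6]; field_simp
      rw [mul_sub, this, hFr]; push_cast; ring
    rw [h9, abs_mul, abs_of_nonneg (by positivity), hκ, le_div_iff₀ (by positivity)]
    exact h3) (by
    have h1 : K / (8 * D * g0 * E ^ 2) ≤ (S1.image F).card * E := hg0c.trans hfib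
    have h2 : 24 * V * κ * E < K / (8 * D * g0 * E ^ 2) := by
      rw [hV, hκ]
      have h4 : 24 * (16 * D ^ 2 * E ^ 16 / g0 ^ 2 * K ^ 3) * (16 * D ^ 2 * E ^ 16 * g0 / N ^ 3) * E =
          49152 * (D ^ 5 * E ^ 35 * K ^ 2) * (K / (8 * D * g0 * E ^ 2)) / N ^ 3 := by field_simp; norm_num
      have h5 : 49152 * (D ^ 5 * E ^ 35 * K ^ 2) < N ^ 3 := by
        refine lt_of_lt_of_le ?_ hDK
        calc 49152 * (D ^ 5 * E ^ 35 * K ^ 2) < E * (D ^ 5 * E ^ 35 * K ^ 2) := by gcongr; linarith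
          _ = _ := by ring
      rw [h4, div_lt_iff₀ (by positivity), mul_comm]
      gcongr
    by_contra hcon
    push Not at hcon
    have := mul_le_mul_of_nonneg_right hcon hE0.le
    linarith)
  have hqF : ∀ k ∈ S1, (q:ℤ) ∣ F k ∧ |α * g0 ^ 3 - a / q| * F k ≤ κ := fun n hn => hqv _ (mem_image_of_mem _ hn)
  have hqP : (q:ℝ) ≤ P ^ 20 := by
    obtain ⟨n, hn⟩ := hS1ne
    refine le_trans ?_ ((hFV n hn).trans hVP)
    exact_mod_cast Int.le_of_dvd (hF0 n hn) (hqF n hn).1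
  set H := 32 * D * g0 * E ^ 6 with hH
  have hH0 : 0 < H := by positivity
  obtain ⟨k, hk, hg⟩ := gcd_avoid0 C q hq0 hqP K H hK0.le hH0 S1 (fun x hx => by
      have := hS x (hS1S x hx).1; exact ⟨this.1, this.2.2⟩) (by
      refine lt_of_lt_of_le ?_ hg0c
      have : E ^ 3 * (2 * K / H) = (K / (8 * D * g0 * E ^ 2)) * (1 / (2 * E)) := by rw [hH]; field_simp; norm_num
      rw [this]
      refine mul_lt_of_lt_one_right (by positivity) ?_
      rw [div_lt_one (by positivity)]; linarith)
  obtain ⟨hqd, hqa⟩ := hqF k hk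
  obtain ⟨hkS, hkg⟩ := hS1S k hk
  have hs1 : (0:ℝ) < s k := by exact_mod_cast hs0 k hkS
  have hkp := hk0 k hkS
  have hqs : (q:ℝ) ≤ s k * H ^ 3 := by
    have h1 : (q:ℤ) ∣ k ^ 3 * s k := dvc hqd (by simp only [hF]; ring)
    have h2 := Int.le_of_dvd (by exact_mod_cast hs0 k hkS) (gcd_split q hq0 _ _ h1)
    have h3 : q / Int.gcd q (k ^ 3) ≤ s k := by exact_mod_cast h2
    have h4 : Int.gcd q (k ^ 3) ∣ q := Int.natCast_dvd_natCast.1 (Int.gcd_dvd_left (q:ℤ) _)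
    have h5 : q ≤ s k * Int.gcd q (k ^ 3) := by
      calc q = q / Int.gcd q (k ^ 3) * Int.gcd q (k ^ 3) := (Nat.div_mul_cancel h4).symm
        _ ≤ _ := Nat.mul_le_mul_right _ h3
    calc (q:ℝ) ≤ ((s k * Int.gcd q (k ^ 3) : ℕ):ℝ) := by exact_mod_cast h5
      _ = s k * ((Int.gcd q (k ^ 3) : ℕ):ℝ) := by push_cast; rfl
      _ ≤ _ := by gcongr
  have hE2 : 2 ^ 30 ≤ E ^ 2 := by
    calc (2:ℝ) ^ 30 ≤ (10 ^ 6) ^ 2 := by norm_num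
      _ ≤ E ^ 2 := by gcongr
  have hX : (32 * D * E ^ 6) ^ 3 * (16 * D ^ 2 * E ^ 16) * (g0:ℝ) ^ 4 * 8 ≤ D ^ 9 * E ^ 68 := by
    calc (32 * D * E ^ 6) ^ 3 * (16 * D ^ 2 * E ^ 16) * (g0:ℝ) ^ 4 * 8 ≤ (32 * D * E ^ 6) ^ 3 * (16 * D ^ 2 * E ^ 16) * (4 * D * E ^ 8) ^ 4 * 8 := by gcongr
      _ = 2 ^ 30 * (D ^ 9 * E ^ 66) := by ring
      _ ≤ E ^ 2 * (D ^ 9 * E ^ 66) := by gcongr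
      _ = _ := by ring
  refine ⟨a, q * g0 ^ 3, Nat.mul_pos hq0 (pow_pos hg0m.1 3), ?_, ?_⟩
  · refine le_trans ?_ hX
    have h3 := (hW2 k hkS).1
    rw [hkg] at h3
    push_cast
    calc (q:ℝ) * (g0:ℝ) ^ 3 ≤ (s k * H ^ 3) * (g0:ℝ) ^ 3 := by gcongr
      _ = (32 * D * E ^ 6) ^ 3 * (s k * (g0:ℝ) ^ 2) * (g0:ℝ) ^ 4 := by rw [hH]; ring
      _ ≤ (32 * D * E ^ 6) ^ 3 * (16 * D ^ 2 * E ^ 16) * (g0:ℝ) ^ 4 := by gcongr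
      _ ≤ _ := le_mul_of_one_le_right (by positivity) (by norm_num)
  · refine le_trans ?_ hX
    have hq' : (0:ℝ) < q := by exact_mod_cast hq0
    have h1 : α * ((q * g0 ^ 3 : ℕ):ℝ) - a = q * (α * g0 ^ 3 - a / q) := by push_cast; field_simp
    rw [h1, abs_mul, abs_of_pos hq']
    rw [hFr] at hqa
    have h2 : K ^ 3 ≤ 8 * (k:ℝ) ^ 3 := by
      have := (hS k hkS).2.1
      calc K ^ 3 ≤ (2 * (k:ℝ)) ^ 3 := by gcongr; linarith
        _ = _ := by ring
    calc q * |α * g0 ^ 3 - a / q| * (N * K) ^ 3 = q * |α * g0 ^ 3 - a / q| * (N ^ 3 * K ^ 3) := by ring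
      _ ≤ (s k * H ^ 3) * |α * g0 ^ 3 - a / q| * (N ^ 3 * (8 * (k:ℝ) ^ 3)) := by gcongr
      _ = (|α * g0 ^ 3 - a / q| * (s k * (k:ℝ) ^ 3)) * (H ^ 3 * N ^ 3 * 8) := by ring
      _ ≤ κ * (H ^ 3 * N ^ 3 * 8) := by gcongr
      _ = _ := by rw [hκ, hH]; field_simp
end W3

namespace W3
open MeasureTheory Finset
open scoped Classical

lemma mult_cnt (S : Finset ℤ) (L : ℝ) (hL : 0 ≤ L) (h : ℕ) (hh : 0 < h) (hS : ∀ x ∈ S, 1 ≤ x ∧ (x:ℝ) ≤ L ∧ (h:ℤ) ∣ x) : (S.card : ℝ) ≤ L / h := by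
  have hh' : (0:ℝ) < h := by exact_mod_cast hh
  have hz : (0:ℤ) < h := by exact_mod_cast hh
  have h1 : S.card ≤ (Icc 1 ⌊L / h⌋₊).card := by
    refine card_le_card_of_injOn (fun x => (x / h).toNat) ?_ ?_
    · intro x hx
      obtain ⟨a, b, y, rfl⟩ := hS x hx
      have hy : 0 < y := by
        by_contra hc; push Not at hc
        have := mul_nonpos_of_nonneg_of_nonpos hz.le hc
        omega
      simp only [coe_Icc, Set.mem_Icc]
      rw [Int.mul_ediv_cancel_left _ hz.ne']
      refine ⟨by omega, Nat.le_floor ?_⟩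
      rw [le_div_iff₀ hh', ← Int.cast_natCast, Int.toNat_of_nonneg hy.le]
      push_cast at b; linarith
    · intro x hx x' hx' hxx
      obtain ⟨a, b, y, rfl⟩ := hS x hx
      obtain ⟨a', b', y', rfl⟩ := hS x' hx'
      simp only [Int.mul_ediv_cancel_left _ hz.ne'] at hxx
      have hy : 0 < y := by
        by_contra hc; push Not at hc
        have := mul_nonpos_of_nonneg_of_nonpos hz.le hc
        omega
      have hy' : 0 < y' := by
        by_contra hc; push Not at hc
        have := mul_nonpos_of_nonneg_of_nonpos hz.le hc
        omega
      have : y = y' := by omega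
      rw [this]
  rw [Nat.card_Icc, Nat.add_sub_cancel] at h1
  exact le_trans (by exact_mod_cast h1) (Nat.floor_le (by positivity))

lemma pair_avoid {P E : ℝ} (C : Ctx P E) (q : ℕ) (hq : 0 < q) (hqP : (q:ℝ) ≤ P ^ 20) (L K H : ℝ) (hL : 0 ≤ L) (hK : 0 ≤ K) (hH : 0 < H)
    (S : Finset (ℤ × ℤ)) (hS : ∀ p ∈ S, 1 ≤ p.1 ∧ (p.1:ℝ) ≤ L ∧ 1 ≤ p.2 ∧ (p.2:ℝ) ≤ K) (hc : E ^ 2 * (L * K / H) < S.card) :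
    ∃ p ∈ S, ((Int.gcd q (p.1 * p.2) : ℕ):ℝ) ≤ H := by
  by_contra hcon
  push Not at hcon
  have hE0 := C.E0
  have h := card_fib S q.divisors (fun p => Int.gcd q (p.1 * p.2)) (E * (L * K / H))
    (fun n _ => Nat.mem_divisors.2 ⟨Int.natCast_dvd_natCast.1 (Int.gcd_dvd_left (q:ℤ) _), hq.ne'⟩) (fun h hh => ?_)
  · have h1 := C.hd q hqP
    have h2 : 0 ≤ E * (L * K / H) := by positivity
    have h3 := mul_le_mul_of_nonneg_right h1 h2
    have h4 : E * (E * (L * K / H)) = E ^ 2 * (L * K / H) := by ring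
    linarith
  · have hh' := (Nat.mem_divisors.1 hh).1
    have hh0 : 0 < h := Nat.pos_of_dvd_of_pos hh' hq
    rcases (S.filter (fun p => Int.gcd q (p.1 * p.2) = h)).eq_empty_or_nonempty with he | ⟨n, hn⟩
    · rw [he]; simp; positivity
    · rw [mem_filter] at hn
      have hl := hcon n hn.1
      rw [hn.2] at hl
      have hhp : (0:ℝ) < h := by exact_mod_cast hh0
      have h2 := card_fib (S.filter (fun p => Int.gcd q (p.1 * p.2) = h)) h.divisors (fun p => Int.gcd h p.1) (L * K / h)
        (fun n _ => Nat.mem_divisors.2 ⟨Int.natCast_dvd_natCast.1 (Int.gcd_dvd_left (h:ℤ) _), hh0.ne'⟩) (fun h1 hh1 => ?_)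
      · have h3 : (h.divisors.card : ℝ) ≤ E := C.hdv hq hqP h hh'
        refine h2.trans ?_
        gcongr
      · obtain ⟨h2, hh2⟩ := (Nat.mem_divisors.1 hh1).1
        have h1p : 0 < h1 := Nat.pos_of_dvd_of_pos ⟨h2, hh2⟩ hh0
        have h2p : 0 < h2 := Nat.pos_of_dvd_of_pos ⟨h1, by rw [hh2]; ring⟩ hh0
        set W := (S.filter (fun p => Int.gcd q (p.1 * p.2) = h)).filter (fun p => Int.gcd h p.1 = h1) with hW
        have hWm : ∀ p ∈ W, p ∈ S ∧ (h1:ℤ) ∣ p.1 ∧ (h2:ℤ) ∣ p.2 := by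
          intro p hp
          rw [hW, mem_filter, mem_filter] at hp
          obtain ⟨⟨a, b⟩, c⟩ := hp
          refine ⟨a, by rw [← c]; exact Int.gcd_dvd_right _ _, ?_⟩
          have h3 := gcd_split h hh0 p.1 p.2 (by rw [← b]; exact Int.gcd_dvd_right _ _)
          rw [c] at h3
          have h4 : h / h1 = h2 := by rw [hh2]; exact Nat.mul_div_cancel_left _ h1p
          rwa [h4] at h3
        have h3 : W ⊆ (W.image Prod.fst) ×ˢ (W.image Prod.snd) := fun p hp => mem_product.2 ⟨mem_image_of_mem _ hp, mem_image_of_mem _ hp⟩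
        have h4 := card_le_card h3
        rw [card_product] at h4
        have h5 := mult_cnt (W.image Prod.fst) L hL h1 h1p (fun x hx => by
          obtain ⟨p, hp, rfl⟩ := mem_image.1 hx
          obtain ⟨a, b, c⟩ := hWm p hp
          exact ⟨(hS p a).1, (hS p a).2.1, b⟩)
        have h6 := mult_cnt (W.image Prod.snd) K hK h2 h2p (fun x hx => by
          obtain ⟨p, hp, rfl⟩ := mem_image.1 hx
          obtain ⟨a, b, c⟩ := hWm p hp
          exact ⟨(hS p a).2.2.1, (hS p a).2.2.2, c⟩)
        calc (W.card : ℝ) ≤ (W.image Prod.fst).card * (W.image Prod.snd).card := by exact_mod_cast h4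
          _ ≤ L / h1 * (K / h2) := by gcongr
          _ = L * K / h := by rw [hh2]; push_cast; field_simp

lemma card_le_of_pos (S : Finset ℤ) (L : ℝ) (hL : 0 ≤ L) (hS : ∀ x ∈ S, 1 ≤ x ∧ (x:ℝ) ≤ L) : (S.card : ℝ) ≤ L := by
  have := mult_cnt S L hL 1 one_pos (fun x hx => ⟨(hS x hx).1, (hS x hx).2, by simp⟩)
  simpa using this

lemma int_zero (x : ℤ) (y : ℝ) (h : |(x:ℝ)| ≤ y) (hy : y < 1) : x = 0 := by
  have h1 : |(x:ℝ)| < 1 := by linarith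
  have h2 : |x| < 1 := by exact_mod_cast h1
  exact Int.abs_lt_one_iff.1 h2

lemma L10 {P E : ℝ} (C : Ctx P E) (α L K N D Q0 : ℝ) (hL : 1 ≤ L) (hK : 1 ≤ K) (hNP : 2 * N ≤ P) (hKP : K ≤ P) (hD : 1 ≤ D) (hDN : D ^ 5 * E ^ 9 ≤ N)
    (hDK : D ^ 5 * E ^ 36 * K ^ 2 ≤ N ^ 3) (hQ0 : 1 ≤ Q0) (hQP : Q0 ≤ P ^ 20) (hQ1 : 4 * D ^ 9 * E ^ 68 * Q0 ≤ (N * K) ^ 3)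
    (hQ2 : 4 * D ^ 9 * E ^ 68 * L ^ 3 ≤ Q0) (hDN3 : D ^ 12 * E ^ 93 ≤ N ^ 3)
    (sL sK : Finset ℤ) (hsL : ∀ l ∈ sL, 1 ≤ l ∧ L / 64 ≤ l ∧ (l:ℝ) ≤ L) (hsK : ∀ k ∈ sK, 1 ≤ k ∧ K / 2 ≤ k ∧ (k:ℝ) ≤ K)
    (u v : ℤ → ℤ → ℤ) (hu : ∀ l ∈ sL, ∀ k ∈ sK, N ≤ u l k + 1) (hv : ∀ l ∈ sL, ∀ k ∈ sK, (v l k:ℝ) ≤ 2 * N)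
    (hT : L * K * N / D < ∑ l ∈ sL, ∑ k ∈ sK, ‖∑ n ∈ Ioc (u l k) (v l k), e (α * (l:ℝ) ^ 3 * (k:ℝ) ^ 3 * (n:ℝ) ^ 3)‖) :
    ∃ (a : ℤ) (q : ℕ), 0 < q ∧ Int.gcd a q = 1 ∧ q * (1 + |α - a / q| * (L * K * N) ^ 3) ≤ D ^ 6 * E ^ 32 := by
  have hE := C.hE
  have hE0 := C.E0
  have hE1 := C.E1
  have hD0 : 0 < D := by linarith
  have hK0 : 0 < K := by linarith
  have hL0 : 0 < L := by linarith
  have hN1 : 1 ≤ N := le_trans (one_le_mul_of_one_le_of_one_le (one_le_pow₀ hD) (one_le_pow₀ hE1)) hDN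
  have hN0 : 0 < N := by linarith
  set T : ℤ → ℤ → ℝ := fun l k => ‖∑ n ∈ Ioc (u l k) (v l k), e (α * (l:ℝ) ^ 3 * (k:ℝ) ^ 3 * (n:ℝ) ^ 3)‖ with hTd
  have hTb : ∀ l ∈ sL, ∀ k ∈ sK, T l k ≤ 2 * N := by
    intro l hl k hk
    refine (norm_sum_le _ _).trans ?_
    simp only [e_norm, sum_const, nsmul_eq_mul, mul_one]
    exact card_Ioc_le _ _ N hN1 (hu l hl k hk) (hv l hl k hk)
  have hcL : (sL.card : ℝ) ≤ L := card_le_of_pos sL L hL0.le fun x hx => ⟨(hsL x hx).1, (hsL x hx).2.2⟩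
  have hcK : (sK.card : ℝ) ≤ K := card_le_of_pos sK K hK0.le fun x hx => ⟨(hsK x hx).1, (hsK x hx).2.2⟩
  set Bd : ℤ → Finset ℤ := fun l => sK.filter (fun k => N / (4 * D) ≤ T l k) with hBd
  set Gd := sL.filter (fun l => K / (8 * D) ≤ (Bd l).card) with hGd
  have hrow : ∀ l ∈ sL, ∑ k ∈ sK, T l k ≤ 2 * N * (Bd l).card + K * (N / (4 * D)) := by
    intro l hl
    have h1 : ∀ k ∈ sK, T l k ≤ (if N / (4 * D) ≤ T l k then 2 * N else 0) + N / (4 * D) := by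
      intro k hk
      split_ifs with h
      · have := hTb l hl k hk
        have : 0 ≤ N / (4 * D) := by positivity
        linarith
      · linarith
    refine (sum_le_sum h1).trans ?_
    rw [sum_add_distrib, ← sum_filter, sum_const, sum_const, nsmul_eq_mul, nsmul_eq_mul]
    have : (sK.card : ℝ) * (N / (4 * D)) ≤ K * (N / (4 * D)) := by gcongr
    simp only [hBd]; linarith
  have hBK : ∀ l, ((Bd l).card : ℝ) ≤ K := fun l => le_trans (by exact_mod_cast card_le_card (filter_subset _ _)) hcK
  have hcount : L * K / (16 * D) < ((Gd.sigma Bd).card : ℝ) := by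
    rw [card_sigma]; push_cast
    have h1 : ∑ l ∈ sL, ((Bd l).card : ℝ) ≤ ∑ l ∈ Gd, ((Bd l).card : ℝ) + L * (K / (8 * D)) := by
      rw [← sum_filter_add_sum_filter_not sL (fun l => K / (8 * D) ≤ ((Bd l).card : ℝ))]
      have : ∑ l ∈ sL with ¬ K / (8 * D) ≤ ((Bd l).card : ℝ), ((Bd l).card : ℝ) ≤ ∑ l ∈ sL with ¬ K / (8 * D) ≤ ((Bd l).card : ℝ), K / (8 * D) :=
        sum_le_sum fun l hl => (not_le.1 (mem_filter.1 hl).2).le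
      rw [sum_const, nsmul_eq_mul] at this
      have h2 : ((sL.filter (fun l => ¬ K / (8 * D) ≤ ((Bd l).card : ℝ))).card : ℝ) ≤ L :=
        le_trans (by exact_mod_cast card_le_card (filter_subset _ _)) hcL
      have h3 := mul_le_mul_of_nonneg_right h2 (by positivity : 0 ≤ K / (8 * D))
      linarith
    have h2 : ∑ l ∈ sL, ∑ k ∈ sK, T l k ≤ 2 * N * ∑ l ∈ sL, ((Bd l).card : ℝ) + L * (K * (N / (4 * D))) := by
      refine (sum_le_sum hrow).trans ?_
      rw [sum_add_distrib, ← mul_sum, sum_const, nsmul_eq_mul]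
      have := mul_le_mul_of_nonneg_right hcL (by positivity : 0 ≤ K * (N / (4 * D)))
      linarith
    have h3 : L * K * N / D < 2 * N * (∑ l ∈ Gd, ((Bd l).card : ℝ) + L * (K / (8 * D))) + L * (K * (N / (4 * D))) := by
      refine hT.trans_le (h2.trans ?_)
      gcongr
    have h4 : L * K * N / D = 2 * N * (8 * (L * K / (16 * D))) := by field_simp; norm_num
    have h5 : 2 * N * (∑ l ∈ Gd, ((Bd l).card : ℝ) + L * (K / (8 * D))) + L * (K * (N / (4 * D))) =
        2 * N * (∑ l ∈ Gd, ((Bd l).card : ℝ) + 4 * (L * K / (16 * D))) := by field_simp; ring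
    rw [h4, h5] at h3
    have h6 := lt_of_mul_lt_mul_left h3 (by positivity)
    have : 0 < L * K / (16 * D) := by positivity
    linarith
  have hD4 : 1 ≤ 4 * D := by linarith
  have hWy : ∀ l ∈ sL, ∀ k ∈ Bd l, ∃ (b : ℤ) (r g s : ℕ), 0 < r ∧ Int.gcd b r = 1 ∧ g ∣ r ∧ r = r.gcd (g ^ 3) * s ∧
      r * (1 + |α * l ^ 3 * k ^ 3 - b / r| * N ^ 3) ≤ (4 * D) ^ 3 * E ^ 24 ∧ s * g ^ 2 * (1 + |α * l ^ 3 * k ^ 3 - b / r| * N ^ 3) ^ 2 ≤ (4 * D) ^ 2 * E ^ 16 := by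
    intro l hl k hk
    obtain ⟨hk1, hk2⟩ := mem_filter.1 hk
    refine W' C (α * l ^ 3 * k ^ 3) N (4 * D) hN1 hNP hD4 ?_ (u l k) (v l k) (hu l hl k hk1) (hv l hl k hk1) hk2
    refine le_trans ?_ hDN
    calc (4 * D) ^ 5 * E ^ 5 = 1024 * (D ^ 5 * E ^ 5) := by ring
      _ ≤ E ^ 4 * (D ^ 5 * E ^ 5) := by
        gcongr
        exact le_trans (by linarith) (le_self_pow₀ hE1 (by norm_num : 4 ≠ 0))
      _ = _ := by ring
  choose! b r g s h1r h2r h3r h4r h5r h6r using hWy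
  have hA : ∀ l ∈ Gd, ∃ (a : ℤ) (q : ℕ), 0 < q ∧ (q:ℝ) ≤ D ^ 9 * E ^ 68 ∧ |α * l ^ 3 * q - a| * (N * K) ^ 3 ≤ D ^ 9 * E ^ 68 := by
    intro l hl
    obtain ⟨hl1, hl2⟩ := mem_filter.1 hl
    refine L10a C (α * l ^ 3) K N D hK hNP hKP hD hDN hDK (Bd l) (fun k hk => hsK k (mem_filter.1 hk).1) hl2 (b l) (r l) (g l) (s l) ?_
    intro k hk
    exact ⟨h1r l hl1 k hk, h3r l hl1 k hk, h4r l hl1 k hk, h6r l hl1 k hk⟩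
  choose! a' q' hq'0 hq'1 hq'2 using hA
  obtain ⟨a0, q0, hq0, hg0, hq0Q, hb0⟩ := dirichlet α Q0 hQ0
  have hq0' : (0:ℝ) < q0 := by exact_mod_cast hq0
  set X := D ^ 9 * E ^ 68 with hX
  have hX0 : 0 < X := by positivity
  have hQ0' : 0 < Q0 := by linarith
  have hNK3 : 0 < (N * K) ^ 3 := by positivity
  have hcmp1 : ∀ l ∈ Gd, a' l * q0 = a0 * l ^ 3 * q' l := by
    intro l hl
    have hl0 : (1:ℝ) ≤ l := by exact_mod_cast (hsL l (mem_filter.1 hl).1).1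
    have hlL := (hsL l (mem_filter.1 hl).1).2.2
    rw [← sub_eq_zero]
    refine int_zero _ (q0 * |α * l ^ 3 * q' l - a' l| + l ^ 3 * q' l * |α * q0 - a0|) ?_ ?_
    · have : ((a' l * q0 - a0 * l ^ 3 * q' l : ℤ):ℝ) = l ^ 3 * q' l * (α * q0 - a0) - q0 * (α * l ^ 3 * q' l - a' l) := by push_cast; ring
      rw [this]
      refine (abs_sub _ _).trans ?_
      rw [abs_mul ((l:ℝ) ^ 3 * q' l), abs_mul (q0:ℝ), abs_of_pos hq0', abs_of_nonneg (by positivity : 0 ≤ (l:ℝ) ^ 3 * q' l)]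
      linarith
    · have h1 : q0 * |α * l ^ 3 * q' l - a' l| ≤ 1 / 4 := by
        have := hq'2 l hl
        rw [← le_div_iff₀ hNK3] at this
        calc q0 * |α * l ^ 3 * q' l - a' l| ≤ Q0 * (X / (N * K) ^ 3) := by gcongr
          _ = X * Q0 / (N * K) ^ 3 := by ring
          _ ≤ 1 / 4 := by rw [div_le_iff₀ hNK3]; linarith
      have h2 : l ^ 3 * q' l * |α * q0 - a0| ≤ 1 / 4 := by
        calc l ^ 3 * q' l * |α * q0 - a0| ≤ L ^ 3 * X * (1 / Q0) := by
              gcongr; exact hq'1 l hl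
          _ = X * L ^ 3 / Q0 := by ring
          _ ≤ 1 / 4 := by rw [div_le_iff₀ hQ0']; linarith
      linarith
  have hE92 : 200 * (D ^ 12 * E ^ 92) ≤ N ^ 3 := by
    refine le_trans ?_ hDN3
    calc 200 * (D ^ 12 * E ^ 92) ≤ E * (D ^ 12 * E ^ 92) := by gcongr; linarith
      _ = _ := by ring
  have hcmp2 : ∀ l ∈ Gd, ∀ k ∈ Bd l, b l k * q0 = a0 * (l * k) ^ 3 * r l k := by
    intro l hl k hk
    have hl1 := (mem_filter.1 hl).1
    have hk1 := (mem_filter.1 hk).1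
    have hk0 : (1:ℝ) ≤ k := by exact_mod_cast (hsK k hk1).1
    have hkK := (hsK k hk1).2.2
    have hr0 : (0:ℝ) < r l k := by exact_mod_cast h1r l hl1 k hk
    have hr5 := h5r l hl1 k hk
    set β := α * l ^ 3 * k ^ 3 - b l k / r l k with hβ
    have hr6 : r l k * |β| * N ^ 3 ≤ 64 * D ^ 3 * E ^ 24 := by
      calc r l k * |β| * N ^ 3 ≤ r l k * (1 + |β| * N ^ 3) := by linarith
        _ ≤ _ := hr5.trans (le_of_eq (by ring))
    have hr7 : r l k ≤ 64 * D ^ 3 * E ^ 24 := by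
      have : 0 ≤ r l k * (|β| * N ^ 3) := by positivity
      calc (r l k:ℝ) ≤ r l k * (1 + |β| * N ^ 3) := by linarith
        _ ≤ _ := hr5.trans (le_of_eq (by ring))
    have hkey : b l k * q' l - a' l * k ^ 3 * r l k = 0 := by
      refine int_zero _ (q' l * (r l k * |β|) + k ^ 3 * r l k * |α * l ^ 3 * q' l - a' l|) ?_ ?_
      · have : ((b l k * q' l - a' l * k ^ 3 * r l k : ℤ):ℝ) = k ^ 3 * r l k * (α * l ^ 3 * q' l - a' l) - q' l * (r l k * β) := by
          rw [hβ]; push_cast; field_simp; ring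
        rw [this]
        refine (abs_sub _ _).trans ?_
        rw [abs_mul ((k:ℝ) ^ 3 * r l k), abs_mul (q' l:ℝ), abs_mul (r l k:ℝ), abs_of_pos hr0, abs_of_nonneg (by positivity : 0 ≤ (k:ℝ) ^ 3 * r l k), abs_of_nonneg (by positivity : (0:ℝ) ≤ q' l)]
        linarith
      · have hN3 : 0 < N ^ 3 := by positivity
        have h1 : q' l * (r l k * |β|) ≤ 64 * (D ^ 12 * E ^ 92) / N ^ 3 := by
          rw [← le_div_iff₀ hN3] at hr6
          calc q' l * (r l k * |β|) ≤ X * (64 * D ^ 3 * E ^ 24 / N ^ 3) := by gcongr; exact hq'1 l hl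
            _ = _ := by rw [hX]; ring
        have h2 : k ^ 3 * r l k * |α * l ^ 3 * q' l - a' l| ≤ 64 * (D ^ 12 * E ^ 92) / N ^ 3 := by
          have := hq'2 l hl
          rw [← le_div_iff₀ hNK3] at this
          calc k ^ 3 * r l k * |α * l ^ 3 * q' l - a' l| ≤ K ^ 3 * (64 * D ^ 3 * E ^ 24) * (X / (N * K) ^ 3) := by gcongr
            _ = _ := by rw [hX]; field_simp
        have h3 : 64 * (D ^ 12 * E ^ 92) / N ^ 3 < 1 / 2 := by
          rw [div_lt_iff₀ hN3]
          have : 0 < D ^ 12 * E ^ 92 := by positivity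
          linarith
        linarith
    have h1 := hcmp1 l hl
    have hq'z : (q' l:ℤ) ≠ 0 := by exact_mod_cast (hq'0 l hl).ne'
    refine mul_left_cancel₀ hq'z ?_
    calc (q' l:ℤ) * (b l k * q0) = (b l k * q' l) * q0 := by ring
      _ = (a' l * k ^ 3 * r l k) * q0 := by rw [sub_eq_zero.1 hkey]
      _ = (a' l * q0) * (k ^ 3 * r l k) := by ring
      _ = _ := by rw [h1]; ring
  set H := 16 * D * E ^ 2 with hH
  have hH0 : 0 < H := by positivity
  set PS := (Gd.sigma Bd).map ⟨fun x : (_ : ℤ) × ℤ => (x.1, x.2), by rintro ⟨a, b⟩ ⟨c, d⟩ h; simpa using h⟩ with hPS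
  have hPm : ∀ p ∈ PS, p.1 ∈ Gd ∧ p.2 ∈ Bd p.1 := by
    intro p hp
    rw [hPS, mem_map] at hp
    obtain ⟨⟨x, y⟩, h1, rfl⟩ := hp
    exact mem_sigma.1 h1
  obtain ⟨⟨l, k⟩, hlk, hgcd⟩ := pair_avoid C q0 hq0 (hq0Q.trans hQP) L K H hL0.le hK0.le hH0 PS (fun p hp => by
    obtain ⟨h1, h2⟩ := hPm p hp
    have h3 := hsL p.1 (mem_filter.1 h1).1
    have h4 := hsK p.2 (mem_filter.1 h2).1
    exact ⟨h3.1, h3.2.2, h4.1, h4.2.2⟩) (by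
    rw [hPS, card_map]
    refine lt_of_le_of_lt (le_of_eq ?_) hcount
    rw [hH]; field_simp)
  obtain ⟨hl, hk⟩ := hPm _ hlk
  simp only at hl hk hgcd
  have hl1 := (mem_filter.1 hl).1
  have hk1 := (mem_filter.1 hk).1
  have hid := hcmp2 l hl k hk
  have hr0n := h1r l hl1 k hk
  have hr0 : (0:ℝ) < r l k := by exact_mod_cast hr0n
  have hq0r : (q0:ℝ) ≤ r l k * H ^ 3 := by
    have h1 : (q0:ℤ) ∣ (l * k) ^ 3 * r l k := by
      have h2 : (q0:ℤ) ∣ a0 * ((l * k) ^ 3 * r l k) := ⟨b l k, by linarith⟩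
      exact (Int.isCoprime_iff_gcd_eq_one.2 hg0).symm.dvd_of_dvd_mul_left h2
    have h2 := Int.le_of_dvd (by exact_mod_cast hr0n) (gcd_split q0 hq0 _ _ h1)
    have h3 : q0 / Int.gcd q0 ((l * k) ^ 3) ≤ r l k := by exact_mod_cast h2
    have h4 : Int.gcd q0 ((l * k) ^ 3) ∣ q0 := Int.natCast_dvd_natCast.1 (Int.gcd_dvd_left (q0:ℤ) _)
    have h5 : q0 ≤ r l k * Int.gcd q0 ((l * k) ^ 3) := by
      calc q0 = q0 / Int.gcd q0 ((l * k) ^ 3) * Int.gcd q0 ((l * k) ^ 3) := (Nat.div_mul_cancel h4).symm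
        _ ≤ _ := Nat.mul_le_mul_right _ h3
    have h6 : Int.gcd q0 ((l * k) ^ 3) ≤ Int.gcd q0 (l * k) ^ 3 := by
      have hpos : 0 < Int.gcd q0 (l * k) := Int.gcd_pos_of_ne_zero_left _ (by exact_mod_cast hq0.ne')
      refine Nat.le_of_dvd (by positivity) ?_
      simp only [Int.gcd, Int.natAbs_pow, Int.natAbs_natCast]
      set m := (l * k).natAbs
      rw [pow_succ, pow_two, pow_succ, pow_two]
      exact (Nat.gcd_mul_right_dvd_mul_gcd _ _ _).trans (Nat.mul_dvd_mul_right (Nat.gcd_mul_right_dvd_mul_gcd _ _ _) _)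
    calc (q0:ℝ) ≤ ((r l k * Int.gcd q0 (l * k) ^ 3 : ℕ):ℝ) := by exact_mod_cast h5.trans (Nat.mul_le_mul_left _ h6)
      _ = r l k * ((Int.gcd q0 (l * k) : ℕ):ℝ) ^ 3 := by push_cast; rfl
      _ ≤ _ := by gcongr
  refine ⟨a0, q0, hq0, hg0, ?_⟩
  have hr5 := h5r l hl1 k hk
  have hl0 : (0:ℝ) < l := by have := (hsL l hl1).1; exact_mod_cast (by omega : 0 < l)
  have hk0 : (0:ℝ) < k := by have := (hsK k hk1).1; exact_mod_cast (by omega : 0 < k)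
  have hβ : α * l ^ 3 * k ^ 3 - b l k / r l k = (l * k) ^ 3 * (α - a0 / q0) := by
    have : (b l k:ℝ) * q0 = a0 * (l * k) ^ 3 * r l k := by exact_mod_cast hid
    have h2 : (b l k:ℝ) / r l k = (l * k) ^ 3 * (a0 / q0) := by
      rw [div_eq_iff hr0.ne', mul_div_assoc', div_mul_eq_mul_div, eq_div_iff hq0'.ne']; linarith
    rw [h2]; ring
  rw [hβ, abs_mul, abs_of_pos (by positivity : 0 < ((l:ℝ) * k) ^ 3)] at hr5
  have hLK : (L * K * N) ^ 3 ≤ 128 ^ 3 * (((l:ℝ) * k) ^ 3 * N ^ 3) := by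
    have h1 : L ≤ 64 * l := by linarith [(hsL l hl1).2.1]
    have h2 : K ≤ 2 * k := by linarith [(hsK k hk1).2.1]
    calc (L * K * N) ^ 3 ≤ ((64 * l) * (2 * k) * N) ^ 3 := by gcongr
      _ = _ := by ring
  have hE2 : 2 ^ 39 ≤ E ^ 2 := by
    calc (2:ℝ) ^ 39 ≤ (10 ^ 6) ^ 2 := by norm_num
      _ ≤ E ^ 2 := by gcongr
  calc q0 * (1 + |α - a0 / q0| * (L * K * N) ^ 3) ≤ (r l k * H ^ 3) * (128 ^ 3 * (1 + ((l:ℝ) * k) ^ 3 * |α - a0 / q0| * N ^ 3)) := by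
        refine mul_le_mul hq0r ?_ (by positivity) (by positivity)
        have := mul_le_mul_of_nonneg_left hLK (abs_nonneg (α - a0 / q0))
        linarith
    _ = 128 ^ 3 * H ^ 3 * (r l k * (1 + ((l:ℝ) * k) ^ 3 * |α - a0 / q0| * N ^ 3)) := by ring
    _ ≤ 128 ^ 3 * H ^ 3 * ((4 * D) ^ 3 * E ^ 24) := by gcongr
    _ = 2 ^ 39 * (D ^ 6 * E ^ 30) := by rw [hH]; ring
    _ ≤ E ^ 2 * (D ^ 6 * E ^ 30) := by gcongr
    _ = _ := by ring
end W3

namespace W3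
open MeasureTheory Finset
open scoped Classical
abbrev AF := ArithmeticFunction ℝ

lemma af_ne (a b : AF) (n : ℕ) (h : (a * b) n ≠ 0) : ∃ x y, x * y = n ∧ a x ≠ 0 ∧ b y ≠ 0 := by
  rw [ArithmeticFunction.mul_apply] at h
  obtain ⟨p, hp, h2⟩ := exists_ne_zero_of_sum_ne_zero h
  exact ⟨p.1, p.2, (Nat.mem_divisorsAntidiagonal.1 hp).1, left_ne_zero_of_mul h2, right_ne_zero_of_mul h2⟩

lemma af_pos (a : AF) (n : ℕ) (h : a n ≠ 0) : 1 ≤ n := by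
  rcases Nat.eq_zero_or_pos n with rfl | h0
  · simp at h
  · exact h0

lemma af_van (a b : AF) (A B : ℕ) (ha : ∀ n < A, a n = 0) (hb : ∀ n < B, b n = 0) : ∀ n < A * B, (a * b) n = 0 := by
  intro n hn
  by_contra h
  obtain ⟨x, y, rfl, hx, hy⟩ := af_ne a b n h
  have h1 : A ≤ x := by by_contra h; exact hx (ha x (by omega))
  have h2 : B ≤ y := by by_contra h; exact hy (hb y (by omega))
  exact absurd (Nat.mul_le_mul h1 h2) (by omega)

/-- truncated Moebius function -/
noncomputable def mo (z : ℕ) : AF := ⟨fun n => if n ≤ z then ((ArithmeticFunction.moebius n : ℤ) : ℝ) else 0, by simp⟩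

lemma mo_apply (z n : ℕ) : mo z n = if n ≤ z then ((ArithmeticFunction.moebius n : ℤ) : ℝ) else 0 := rfl

/-- the zeta arithmetic function over the reals -/
noncomputable def ze : AF := ((ArithmeticFunction.zeta : ArithmeticFunction ℕ) : ArithmeticFunction ℝ)

lemma HBid (z n : ℕ) (hn : n ≤ z ^ 3) : ArithmeticFunction.vonMangoldt n =
    3 * (mo z * ArithmeticFunction.log) n - 3 * (mo z * mo z * ze * ArithmeticFunction.log) n +
      (mo z * mo z * mo z * ze * ze * ArithmeticFunction.log) n := by
  set μ' : AF := ((ArithmeticFunction.moebius : ArithmeticFunction ℤ) : ArithmeticFunction ℝ) with hμ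
  set R : AF := μ' - mo z with hR
  have hz : ze * μ' = 1 := ArithmeticFunction.coe_zeta_mul_coe_moebius
  have hl : ArithmeticFunction.log = ArithmeticFunction.vonMangoldt * ze := ArithmeticFunction.vonMangoldt_mul_zeta.symm
  have hRv : ∀ n < z + 1, R n = 0 := by
    intro n hn
    have : R n = μ' n - mo z n := by rw [hR, sub_eq_add_neg, ArithmeticFunction.add_apply]; rfl
    rw [this, mo_apply, if_pos (by omega)]; simp [hμ]
  have h3 := af_van _ _ _ _ (af_van _ _ _ _ (af_van (ArithmeticFunction.vonMangoldt * ze * ze * ze) R 1 (z+1) (by simp) hRv) hRv) hRv n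
    (lt_of_le_of_lt hn (by ring_nf; nlinarith))
  have key : ArithmeticFunction.vonMangoldt * ze * ze * ze * R * R * R + 3 • (mo z * ArithmeticFunction.log)
     + (mo z * mo z * mo z * ze * ze * ArithmeticFunction.log) = ArithmeticFunction.vonMangoldt
      + 3 • (mo z * mo z * ze * ArithmeticFunction.log) := by
    rw [hl, hR]
    have h1 : ArithmeticFunction.vonMangoldt * ze * ze * ze * (μ' - mo z) * (μ' - mo z) * (μ' - mo z) =
      ArithmeticFunction.vonMangoldt * (ze * μ' - ze * mo z) ^ 3 := by ring
    rw [h1, hz]; simp only [nsmul_eq_mul, Nat.cast_ofNat]; ring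
  have hk := congrArg (fun f : AF => f n) key
  have hs : ∀ a : AF, (3 • a) n = 3 * a n := by
    intro a
    rw [show 3 • a = a + a + a by rw [nsmul_eq_mul]; push_cast; ring]
    simp only [ArithmeticFunction.add_apply]; ring
  simp only [ArithmeticFunction.add_apply, hs, h3] at hk
  linarith

/-- dyadic box restriction -/
noncomputable def bx (i : ℕ) (g : AF) : AF := ⟨fun n => if 2 ^ i ≤ n ∧ n < 2 ^ (i + 1) then g n else 0, by simp⟩

lemma bx_apply (i n : ℕ) (g : AF) : bx i g n = if 2 ^ i ≤ n ∧ n < 2 ^ (i + 1) then g n else 0 := rfl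

lemma af_sum {ι : Type*} (s : Finset ι) (h : ι → AF) (n : ℕ) : (∑ i ∈ s, h i) n = ∑ i ∈ s, h i n := by
  induction s using Finset.induction_on with
  | empty => simp
  | insert a s ha ih => rw [sum_insert ha, sum_insert ha, ArithmeticFunction.add_apply, ih]

lemma sum_bx (L n : ℕ) (g : AF) (hn : n < 2 ^ L) : (∑ i ∈ range L, bx i g) n = g n := by
  rw [af_sum]
  rcases Nat.eq_zero_or_pos n with rfl | h0
  · simp
  have hlog : ∀ i, (2 ^ i ≤ n ∧ n < 2 ^ (i + 1)) ↔ Nat.log 2 n = i := by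
    intro i
    rw [Nat.log_eq_iff (Or.inr ⟨by norm_num, h0.ne'⟩)]
  have : Nat.log 2 n < L := Nat.log_lt_of_lt_pow h0.ne' hn
  simp only [bx_apply, hlog]
  rw [sum_ite_eq, if_pos (mem_range.2 this)]

lemma af_mul_congr (Y : ℕ) (a a' b b' : AF) (ha : ∀ n ≤ Y, a n = a' n) (hb : ∀ n ≤ Y, b n = b' n) :
    ∀ n ≤ Y, (a * b) n = (a' * b') n := by
  intro n hn
  rw [ArithmeticFunction.mul_apply, ArithmeticFunction.mul_apply]
  refine sum_congr rfl fun p hp => ?_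
  have h1 := Nat.fst_mem_divisors_of_mem_antidiagonal hp
  have h2 := Nat.snd_mem_divisors_of_mem_antidiagonal hp
  rw [ha _ ((Nat.divisor_le h1).trans hn), hb _ ((Nat.divisor_le h2).trans hn)]

lemma af_prod_congr {ι : Type*} (s : Finset ι) (Y : ℕ) (a a' : ι → AF) (ha : ∀ i ∈ s, ∀ n ≤ Y, a i n = a' i n) :
    ∀ n ≤ Y, (∏ i ∈ s, a i) n = (∏ i ∈ s, a' i) n := by
  induction s using Finset.induction_on with
  | empty => simp
  | insert x s hx ih =>
    rw [prod_insert hx, prod_insert hx]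
    exact af_mul_congr Y _ _ _ _ (ha x (mem_insert_self _ _)) (ih fun i hi => ha i (mem_insert_of_mem hi))

lemma af_prod_bd {ι : Type*} {P E : ℝ} (C : Ctx P E) (s : Finset ι) (a : ι → AF) (ha : ∀ i ∈ s, ∀ n : ℕ, (n:ℝ) ≤ P → |a i n| ≤ E) :
    ∀ n : ℕ, (n:ℝ) ≤ P → |(∏ i ∈ s, a i) n| ≤ E ^ (2 * s.card) := by
  have hE1 := C.E1
  induction s using Finset.induction_on with
  | empty =>
    intro n _
    simp only [prod_empty, ArithmeticFunction.one_apply]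
    split_ifs <;> simp
  | insert x s hx ih =>
    intro n hn
    rcases Nat.eq_zero_or_pos n with rfl | h0
    · simp; positivity
    rw [prod_insert hx, card_insert_of_notMem hx, ArithmeticFunction.mul_apply]
    refine (abs_sum_le_sum_abs _ _).trans ?_
    have hP1 : n.divisors.card ≤ E := C.hd n (hn.trans (le_self_pow₀ C.P1 (by norm_num)))
    calc ∑ p ∈ n.divisorsAntidiagonal, |a x p.1 * (∏ i ∈ s, a i) p.2| ≤ ∑ p ∈ n.divisorsAntidiagonal, E * E ^ (2 * s.card) := by
          refine sum_le_sum fun p hp => ?_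
          have h1 := Nat.divisor_le (Nat.fst_mem_divisors_of_mem_antidiagonal hp)
          have h2 := Nat.divisor_le (Nat.snd_mem_divisors_of_mem_antidiagonal hp)
          rw [abs_mul]
          gcongr
          · exact ha x (mem_insert_self _ _) _ (le_trans (by exact_mod_cast h1) hn)
          · exact ih (fun i hi => ha i (mem_insert_of_mem hi)) _ (le_trans (by exact_mod_cast h2) hn)
      _ = n.divisors.card * (E * E ^ (2 * s.card)) := by
          rw [sum_const, nsmul_eq_mul, ← Nat.map_div_right_divisors]; simp
      _ ≤ E * (E * E ^ (2 * s.card)) := by gcongr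
      _ = _ := by ring

lemma af_prod_supp {ι : Type*} (s : Finset ι) (p : ι → ℕ) (a : ι → AF) : ∀ n, (∏ i ∈ s, bx (p i) (a i)) n ≠ 0 →
    2 ^ (∑ i ∈ s, p i) ≤ n ∧ n ≤ 2 ^ (∑ i ∈ s, p i + s.card) := by
  induction s using Finset.induction_on with
  | empty =>
    intro n h
    simp only [prod_empty, ArithmeticFunction.one_apply] at h
    have : n = 1 := by by_contra h'; simp [h'] at h
    simp [this]
  | insert x s hx ih =>
    intro n h
    rw [prod_insert hx] at h
    obtain ⟨y, z, rfl, h1, h2⟩ := af_ne _ _ _ h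
    have h3 := ih z h2
    rw [bx_apply] at h1
    have h4 : 2 ^ (p x) ≤ y ∧ y < 2 ^ (p x + 1) := by by_contra h'; simp [h'] at h1
    rw [sum_insert hx, card_insert_of_notMem hx]
    constructor
    · rw [pow_add]; exact Nat.mul_le_mul h4.1 h3.1
    · rw [show p x + ∑ i ∈ s, p i + (s.card + 1) = (p x + 1) + (∑ i ∈ s, p i + s.card) by ring, pow_add]
      exact Nat.mul_le_mul h4.2.le h3.2

/-- linear functional -/
noncomputable def Ph (Y : ℕ) (f : ℕ → ℂ) (h : AF) : ℂ := ∑ n ∈ Icc 1 Y, (h n : ℂ) * f n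

lemma Ph_sum {ι : Type*} (Y : ℕ) (f : ℕ → ℂ) (s : Finset ι) (h : ι → AF) : Ph Y f (∑ i ∈ s, h i) = ∑ i ∈ s, Ph Y f (h i) := by
  simp only [Ph, af_sum]
  push_cast
  simp only [sum_mul]
  rw [sum_comm]

lemma Ph_mul (Y : ℕ) (f : ℕ → ℂ) (hf : ∀ n, Y < n → f n = 0) (a b : AF) :
    Ph Y f (a * b) = ∑ x ∈ Icc 1 Y, (a x : ℂ) * Ph Y (fun n => f (x * n)) b := by
  have h1 : ∀ n ∈ Icc 1 Y, (((a * b) n : ℝ):ℂ) * f n = ∑ x ∈ Icc 1 Y, ∑ y ∈ Icc 1 Y, if x * y = n then (a x : ℂ) * b y * f (x * y) else 0 := by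
    intro n hn
    rw [mem_Icc] at hn
    have : n.divisorsAntidiagonal = (Icc 1 Y ×ˢ Icc 1 Y).filter (fun p => p.1 * p.2 = n) := by
      ext ⟨x, y⟩
      simp only [Nat.mem_divisorsAntidiagonal, mem_filter, mem_product, mem_Icc]
      constructor
      · rintro ⟨rfl, h0⟩
        have hx : 1 ≤ x := Nat.one_le_iff_ne_zero.2 (left_ne_zero_of_mul h0)
        have hy : 1 ≤ y := Nat.one_le_iff_ne_zero.2 (right_ne_zero_of_mul h0)
        exact ⟨⟨⟨hx, (Nat.le_mul_of_pos_right x hy).trans hn.2⟩, hy, (Nat.le_mul_of_pos_left y hx).trans hn.2⟩, rfl⟩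
      · rintro ⟨_, h⟩; exact ⟨h, by omega⟩
    rw [ArithmeticFunction.mul_apply, this, ← sum_product', ← sum_filter]
    push_cast
    rw [sum_mul]
    refine sum_congr rfl fun p hp => ?_
    rw [(mem_filter.1 hp).2]
  unfold Ph
  rw [sum_congr rfl h1, sum_comm]
  refine sum_congr rfl fun x hx => ?_
  rw [sum_comm, mul_sum]
  refine sum_congr rfl fun y hy => ?_
  rw [sum_ite_eq]
  split_ifs with h
  · ring
  · rw [mem_Icc] at h hx hy
    have := Nat.mul_pos hx.1 hy.1
    show (0:ℂ) = (a x : ℂ) * (b y * f (x * y))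
    rw [hf (x * y) (by omega)]; simp
end W3

namespace W3
open MeasureTheory Finset
open scoped Classical

/-- partial-summation property -/
def Sm (E : ℝ) (Y : ℕ) (g : AF) : Prop := ∀ (c : ℕ → ℂ) (u v : ℕ), v ≤ Y → ∃ u', u ≤ u' ∧
  ‖∑ n ∈ Ioc u v, (g n : ℂ) * c n‖ ≤ E * ‖∑ n ∈ Ioc u' v, c n‖

lemma Sm_ze {E : ℝ} (hE : 1 ≤ E) (Y : ℕ) : Sm E Y ze := by
  intro c u v _
  refine ⟨u, le_rfl, ?_⟩
  have : ∑ n ∈ Ioc u v, (ze n : ℂ) * c n = ∑ n ∈ Ioc u v, c n := by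
    refine sum_congr rfl fun n hn => ?_
    have : n ≠ 0 := by rw [mem_Ioc] at hn; omega
    simp [ze, this]
  rw [this]
  exact le_mul_of_one_le_left (norm_nonneg _) hE

lemma log_mono_nat {m n : ℕ} (h : m ≤ n) : Real.log m ≤ Real.log n := by
  rcases Nat.eq_zero_or_pos m with rfl | h0
  · simp [Real.log_natCast_nonneg]
  · exact Real.log_le_log (by exact_mod_cast h0) (by exact_mod_cast h)

lemma log_abel (c : ℕ → ℂ) (v : ℕ) (B : ℝ) (d : ℕ) : ∀ u, u + d = v → (∀ m, u ≤ m → m ≤ v → ‖∑ n ∈ Ioc m v, c n‖ ≤ B) →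
    ‖∑ n ∈ Ioc u v, ((Real.log n - Real.log u : ℝ) : ℂ) * c n‖ ≤ (Real.log v - Real.log u) * B := by
  induction d with
  | zero => intro u h _; rw [← h]; simp
  | succ d ih =>
    intro u h hB
    have h1 := ih (u + 1) (by omega) (fun m hm hm' => hB m (by omega) hm')
    have h2 : ∑ n ∈ Ioc u v, ((Real.log n - Real.log u : ℝ) : ℂ) * c n = ∑ n ∈ Ioc (u + 1) v, ((Real.log n - Real.log (u + 1 : ℕ) : ℝ) : ℂ) * c n
        + ((Real.log (u + 1 : ℕ) - Real.log u : ℝ) : ℂ) * ∑ n ∈ Ioc u v, c n := by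
      have h3 : ∑ n ∈ Ioc (u + 1) v, ((Real.log n - Real.log (u + 1 : ℕ) : ℝ) : ℂ) * c n = ∑ n ∈ Ioc u v, ((Real.log n - Real.log (u + 1 : ℕ) : ℝ) : ℂ) * c n := by
        refine sum_subset (Ioc_subset_Ioc_left (by omega)) fun n hn hn' => ?_
        rw [mem_Ioc] at hn hn'
        have : n = u + 1 := by omega
        rw [this]; simp
      rw [h3, mul_sum, ← sum_add_distrib]
      refine sum_congr rfl fun n _ => ?_
      push_cast; ring
    rw [h2]
    refine (norm_add_le _ _).trans ?_
    rw [norm_mul, Complex.norm_real, Real.norm_eq_abs, abs_of_nonneg (sub_nonneg.2 (log_mono_nat (by omega)))]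
    have h4 : (Real.log (u + 1 : ℕ) - Real.log u) * ‖∑ n ∈ Ioc u v, c n‖ ≤ (Real.log (u + 1 : ℕ) - Real.log u) * B :=
      mul_le_mul_of_nonneg_left (hB u le_rfl (by omega)) (sub_nonneg.2 (log_mono_nat (by omega)))
    linarith

lemma Sm_log {E : ℝ} (hE : 1 ≤ E) (Y : ℕ) (hY : Real.log Y ≤ E) : Sm E Y ArithmeticFunction.log := by
  intro c u v hv
  rcases lt_or_ge v u with h | h
  · refine ⟨u, le_rfl, ?_⟩
    simp [Ioc_eq_empty_of_le h.le]
  obtain ⟨u', hu', hmax⟩ := exists_max_image (Icc u v) (fun m => ‖∑ n ∈ Ioc m v, c n‖) ⟨u, by simp [h]⟩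
  rw [mem_Icc] at hu'
  refine ⟨u', hu'.1, ?_⟩
  set B := ‖∑ n ∈ Ioc u' v, c n‖ with hB
  have h1 := log_abel c v B (v - u) u (by omega) (fun m hm hm' => hmax m (mem_Icc.2 ⟨hm, hm'⟩))
  have h2 : ∑ n ∈ Ioc u v, ((ArithmeticFunction.log n : ℝ) : ℂ) * c n = ∑ n ∈ Ioc u v, ((Real.log n - Real.log u : ℝ) : ℂ) * c n + ((Real.log u : ℝ):ℂ) * ∑ n ∈ Ioc u v, c n := by
    rw [mul_sum, ← sum_add_distrib]
    refine sum_congr rfl fun n _ => ?_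
    rw [ArithmeticFunction.log_apply]
    push_cast; ring
  rw [h2]
  refine (norm_add_le _ _).trans ?_
  have h0 := Real.log_natCast_nonneg u
  rw [norm_mul, Complex.norm_real, Real.norm_eq_abs, abs_of_nonneg h0]
  have h4 : Real.log u * ‖∑ n ∈ Ioc u v, c n‖ ≤ Real.log u * B :=
    mul_le_mul_of_nonneg_left (hmax u (mem_Icc.2 ⟨le_rfl, h⟩)) h0
  have h5 : Real.log v * B ≤ E * B := mul_le_mul_of_nonneg_right ((log_mono_nat hv).trans hY) (norm_nonneg _)
  linarith

/-- truncation of a function -/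
noncomputable def trn (y Y : ℕ) (f : ℕ → ℂ) (n : ℕ) : ℂ := if y ≤ n ∧ n ≤ Y then f n else 0

lemma typeI {P E : ℝ} (C : Ctx P E) (Y y i k j : ℕ) (hY : (Y:ℝ) ≤ P) (hy : 1 ≤ y) (f : ℕ → ℂ) (A B g : AF) (T : ℝ) (hg : Sm E Y g)
    (hA : ∀ n : ℕ, (n:ℝ) ≤ P → |A n| ≤ E ^ 12) (hB : ∀ n : ℕ, (n:ℝ) ≤ P → |B n| ≤ E)
    (hA' : ∀ n, A n ≠ 0 → n ∈ Icc (2 ^ i) (2 ^ (i + 6))) (hB' : ∀ n, B n ≠ 0 → n ∈ Icc (2 ^ k) (2 ^ (k + 1)))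
    (H : ∀ u v : ℕ → ℕ → ℕ, (∀ l k, 2 ^ j ≤ u l k + 1) → (∀ l k, v l k ≤ 2 ^ (j + 1)) →
      ∑ l ∈ Icc (2 ^ i) (2 ^ (i + 6)), ∑ k ∈ Icc (2 ^ k) (2 ^ (k + 1)), ‖∑ n ∈ Ioc (u l k) (v l k), f (l * k * n)‖ ≤ T) :
    ‖Ph Y (trn y Y f) (A * (B * bx j g))‖ ≤ E ^ 14 * T := by
  have hE1 := C.E1
  have hsm : ∀ l k, ∃ u', max (2 ^ j - 1) ((y - 1) / (l * k)) ≤ u' ∧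
      ‖∑ n ∈ Ioc (max (2 ^ j - 1) ((y - 1) / (l * k))) (min (2 ^ (j + 1) - 1) (Y / (l * k))), (g n : ℂ) * f (l * k * n)‖ ≤
      E * ‖∑ n ∈ Ioc u' (min (2 ^ (j + 1) - 1) (Y / (l * k))), f (l * k * n)‖ := fun l k =>
    hg (fun n => f (l * k * n)) _ _ ((min_le_right _ _).trans (Nat.div_le_self _ _))
  choose u hu1 hu2 using hsm
  have hH := H u (fun l k => min (2 ^ (j + 1) - 1) (Y / (l * k))) (fun l k => by
    have := (le_max_left _ _).trans (hu1 l k); exact Nat.sub_le_iff_le_add.1 this) (fun l k => (min_le_left _ _).trans (Nat.sub_le _ _))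
  have hf0 : ∀ n, Y < n → trn y Y f n = 0 := fun n hn => by rw [trn, if_neg (by omega)]
  rw [Ph_mul _ _ hf0]
  have inner : ∀ l ∈ Icc 1 Y, ∀ k ∈ Icc 1 Y, Ph Y (fun n => trn y Y f (l * (k * n))) (bx j g) =
      ∑ n ∈ Ioc (max (2 ^ j - 1) ((y - 1) / (l * k))) (min (2 ^ (j + 1) - 1) (Y / (l * k))), (g n : ℂ) * f (l * k * n) := by
    intro l hl k hk
    rw [mem_Icc] at hl hk
    have hlk : 0 < l * k := Nat.mul_pos hl.1 hk.1
    unfold Ph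
    have hsub : Ioc (max (2 ^ j - 1) ((y - 1) / (l * k))) (min (2 ^ (j + 1) - 1) (Y / (l * k))) ⊆ Icc 1 Y := by
      intro n hn
      rw [mem_Ioc] at hn
      rw [mem_Icc]
      have : Y / (l * k) ≤ Y := Nat.div_le_self _ _
      omega
    rw [← sum_subset hsub]
    · refine sum_congr rfl fun n hn => ?_
      rw [mem_Ioc, max_lt_iff, le_min_iff, Nat.div_lt_iff_lt_mul hlk, Nat.le_div_iff_mul_le hlk] at hn
      have : l * (k * n) = n * (l * k) := by ring
      show (bx j g n : ℂ) * trn y Y f (l * (k * n)) = _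
      rw [bx_apply, if_pos (by omega), trn, this, if_pos (by omega), mul_comm n]
    · intro n hn hn'
      rw [mem_Ioc, max_lt_iff, le_min_iff, Nat.div_lt_iff_lt_mul hlk, Nat.le_div_iff_mul_le hlk] at hn'
      have : l * (k * n) = n * (l * k) := by ring
      show (bx j g n : ℂ) * trn y Y f (l * (k * n)) = _
      rw [bx_apply, trn, this]
      by_cases h1 : 2 ^ j ≤ n ∧ n < 2 ^ (j + 1)
      · rw [if_neg (show ¬ (y ≤ n * (l * k) ∧ n * (l * k) ≤ Y) by omega)]; simp
      · rw [if_neg h1]; simp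
  set F : ℕ → ℕ → ℝ := fun l k => ‖∑ n ∈ Ioc (u l k) (min (2 ^ (j + 1) - 1) (Y / (l * k))), f (l * k * n)‖ with hF
  have hF0 : ∀ l k, 0 ≤ F l k := fun l k => norm_nonneg _
  have h2 : ∀ l ∈ Icc 1 Y, ‖Ph Y (fun n => trn y Y f (l * n)) (B * bx j g)‖ ≤ ∑ k ∈ Icc (2 ^ k) (2 ^ (k + 1)), E ^ 2 * F l k := by
    intro l hl
    have hl1 : 1 ≤ l := (mem_Icc.1 hl).1
    rw [Ph_mul _ _ (fun n hn => hf0 _ (lt_of_lt_of_le hn (Nat.le_mul_of_pos_left n hl1)))]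
    refine (norm_sum_le _ _).trans ?_
    rw [← sum_filter_ne_zero]
    refine (sum_le_sum (g := fun k => E ^ 2 * F l k) fun m hm => ?_).trans (sum_le_sum_of_subset_of_nonneg ?_ fun _ _ _ => mul_nonneg (by positivity) (hF0 _ _))
    · rw [mem_filter] at hm
      rw [norm_mul, inner l hl m hm.1, Complex.norm_real, Real.norm_eq_abs]
      have : (m:ℝ) ≤ P := le_trans (by exact_mod_cast (mem_Icc.1 hm.1).2) hY
      calc |B m| * _ ≤ E * (E * F l m) := mul_le_mul (hB m this) (hu2 l m) (norm_nonneg _) (by linarith)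
        _ = _ := by ring
    · intro m hm
      rw [mem_filter] at hm
      refine hB' m fun h0 => hm.2 ?_
      rw [h0]; simp
  refine (norm_sum_le _ _).trans ?_
  rw [← sum_filter_ne_zero]
  calc _ ≤ ∑ l ∈ Icc (2 ^ i) (2 ^ (i + 6)), E ^ 12 * ∑ k ∈ Icc (2 ^ k) (2 ^ (k + 1)), E ^ 2 * F l k := by
        refine (sum_le_sum (g := fun l => E ^ 12 * ∑ k ∈ Icc (2 ^ k) (2 ^ (k + 1)), E ^ 2 * F l k) fun l hl => ?_).trans
          (sum_le_sum_of_subset_of_nonneg ?_ fun _ _ _ => mul_nonneg (by positivity) (sum_nonneg fun _ _ => mul_nonneg (by positivity) (hF0 _ _)))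
        · rw [mem_filter] at hl
          have : (l:ℝ) ≤ P := le_trans (by exact_mod_cast (mem_Icc.1 hl.1).2) hY
          rw [norm_mul, Complex.norm_real, Real.norm_eq_abs]
          exact mul_le_mul (hA l this) (h2 l hl.1) (norm_nonneg _) (by positivity)
        · intro l hl
          rw [mem_filter] at hl
          refine hA' l fun h0 => hl.2 ?_
          rw [h0]; simp
    _ = E ^ 14 * ∑ l ∈ Icc (2 ^ i) (2 ^ (i + 6)), ∑ k ∈ Icc (2 ^ k) (2 ^ (k + 1)), F l k := by
        simp only [← mul_sum]; ring
    _ ≤ _ := by gcongr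

end W3

namespace W3
open MeasureTheory Finset
open scoped Classical

lemma OpB.sub {ι κ : Type*} {s : Finset ι} {t : Finset κ} {K K' : ι → κ → ℂ} {C C' : ℝ} (hC' : 0 ≤ C') (h : OpB s t K C) (h' : OpB s t K' C') :
    OpB s t (fun i j => K i j - K' i j) (C + C') := by
  have h2 := h'.wt hC' (fun _ => -1) (fun _ => 1) (by simp) (by simp)
  refine (h.add h2).congr fun i _ j _ => by ring

lemma OpB_trn {s t : Finset ℕ} {f : ℕ → ℂ} {C : ℝ} (hC : 0 ≤ C) (h : OpB s t (fun b a => f (a * b)) C) (k Y y : ℕ)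
    (hs : ∀ b ∈ s, b < 2 ^ k) (ht : ∀ a ∈ t, 1 ≤ a) (hY : Y + 1 < 2 ^ k) (hy : 1 ≤ y) (hyY : y ≤ Y) :
    OpB s t (fun b a => trn y Y f (a * b)) (k * C + k * C) := by
  have h1 := h.trunc hC k (fun b => b) (fun a => Y / a + 1) hs (fun a _ => by
    have := Nat.div_le_self Y a; omega)
  have h2 := h.trunc hC k (fun b => b) (fun a => (y - 1) / a + 1) hs (fun a _ => by
    have := Nat.div_le_self (y - 1) a; omega)
  refine (h1.sub (by positivity) h2).congr fun b hb a ha => ?_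
  have ha0 : 0 < a := ht a ha
  simp only [trn, Nat.lt_succ_iff, Nat.le_div_iff_mul_le ha0]
  rw [mul_comm b a]
  by_cases h1 : a * b ≤ Y
  · by_cases h2 : a * b ≤ y - 1
    · rw [if_pos h1, if_pos h2, if_neg (by omega)]; simp
    · rw [if_pos h1, if_neg h2, if_pos (by omega)]; simp
  · rw [if_neg h1, if_neg (by omega), if_neg (by omega)]; simp

lemma sum_sq_le (F : ℝ) (i : ℕ) (a : ℕ → ℂ) (ha : ∀ n, ‖a n‖ ≤ F) : √(∑ n ∈ Icc (2 ^ i) (2 ^ (i + 6)), ‖a n‖ ^ 2) ≤ 8 * F * √(2 ^ i) := by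
  have hF : 0 ≤ F := (norm_nonneg _).trans (ha 0)
  rw [show 8 * F * √(2 ^ i) = √((8 * F) ^ 2 * 2 ^ i) by rw [Real.sqrt_mul (by positivity), Real.sqrt_sq (by positivity)]]
  refine Real.sqrt_le_sqrt ?_
  calc ∑ n ∈ Icc (2 ^ i) (2 ^ (i + 6)), ‖a n‖ ^ 2 ≤ ∑ n ∈ Icc (2 ^ i) (2 ^ (i + 6)), F ^ 2 :=
        sum_le_sum fun n _ => pow_le_pow_left₀ (norm_nonneg _) (ha n) 2
    _ = ((2 ^ (i + 6) + 1 - 2 ^ i : ℕ) : ℝ) * F ^ 2 := by rw [sum_const, nsmul_eq_mul, Nat.card_Icc]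
    _ ≤ ((2 ^ (i + 6) : ℕ) : ℝ) * F ^ 2 := by
        have : 1 ≤ 2 ^ i := Nat.one_le_two_pow
        gcongr; exact Nat.sub_le_iff_le_add.2 (Nat.add_le_add_left this _)
    _ = _ := by push_cast; ring

lemma typeII {P E : ℝ} (C : Ctx P E) (Y y i i' : ℕ) (hY : 256 * (Y:ℝ) ≤ P) (hy : 1 ≤ y) (hyY : y ≤ Y) (f : ℕ → ℂ) (A B : AF) (C2 : ℝ) (hC2 : 0 ≤ C2)
    (hA : ∀ n : ℕ, (n:ℝ) ≤ P → |A n| ≤ E ^ 12) (hB : ∀ n : ℕ, (n:ℝ) ≤ P → |B n| ≤ E ^ 12)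
    (hA' : ∀ n, A n ≠ 0 → n ∈ Icc (2 ^ i) (2 ^ (i + 6))) (hB' : ∀ n, B n ≠ 0 → n ∈ Icc (2 ^ i') (2 ^ (i' + 6)))
    (hii : 2 ^ (i + i') ≤ Y) (H : OpB (Icc (2 ^ i') (2 ^ (i' + 6))) (Icc (2 ^ i) (2 ^ (i + 6))) (fun b a => f (a * b)) C2) :
    ‖Ph Y (trn y Y f) (A * B)‖ ≤ E ^ 26 * (√P * C2) := by
  have hE1 := C.E1
  have hE := C.hE
  have hP1 := C.P1
  have hY1 : (1:ℝ) ≤ Y := by exact_mod_cast hy.trans hyY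
  obtain ⟨k, hk1, hk2⟩ := bits (64 * Y + 2) (by linarith)
  have hkE : (k:ℝ) ≤ E := by
    refine C.hk k (hk1.trans ?_)
    calc 2 * (64 * (Y:ℝ) + 2) ≤ P := by linarith
      _ ≤ _ := le_self_pow₀ hP1 (by norm_num)
  have hk3 : 64 * Y + 2 < 2 ^ k := by exact_mod_cast hk2
  have hi' : 2 ^ i' ≤ Y := le_trans (Nat.pow_le_pow_right (by norm_num) (by omega)) hii
  have hop := OpB_trn hC2 H k Y y (fun b hb => by rw [mem_Icc, pow_add] at hb; omega)
    (fun a ha => (Nat.one_le_two_pow).trans (mem_Icc.1 ha).1) (by omega) hy hyY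
  have hf0 : ∀ n, Y < n → trn y Y f n = 0 := fun n hn => by rw [trn, if_neg (by omega)]
  set a : ℕ → ℂ := fun n => if n ≤ Y then (A n : ℂ) else 0 with ha
  set b : ℕ → ℂ := fun n => if n ≤ Y then (B n : ℂ) else 0 with hb
  have hres : ∀ (G : AF) (j : ℕ) (hG : ∀ n, G n ≠ 0 → n ∈ Icc (2 ^ j) (2 ^ (j + 6))) (φ : ℕ → ℂ),
      ∑ x ∈ Icc 1 Y, (G x : ℂ) * φ x = ∑ x ∈ Icc (2 ^ j) (2 ^ (j + 6)), (if x ≤ Y then (G x:ℂ) else 0) * φ x := by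
    intro G j hG φ
    rw [← sum_filter_ne_zero, ← sum_filter_ne_zero (s := Icc (2 ^ j) (2 ^ (j + 6)))]
    refine sum_congr ?_ fun x hx => ?_
    · ext x
      simp only [mem_filter]
      constructor
      · rintro ⟨h1, h2⟩
        have h3 := (mem_Icc.1 h1).2
        refine ⟨hG x fun h0 => h2 (by rw [h0]; simp), by rw [if_pos h3]; exact h2⟩
      · rintro ⟨h1, h2⟩
        have h3 : x ≤ Y := by by_contra h; rw [if_neg h] at h2; simp at h2
        rw [if_pos h3] at h2
        exact ⟨mem_Icc.2 ⟨(Nat.one_le_two_pow).trans (mem_Icc.1 h1).1, h3⟩, h2⟩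
    · have h3 : x ≤ Y := by
        by_contra h
        have := (mem_filter.1 hx).2
        rw [if_neg h] at this; simp at this
      rw [if_pos h3]
  have e1 : Ph Y (trn y Y f) (A * B) = ∑ x ∈ Icc (2 ^ i') (2 ^ (i' + 6)), ∑ z ∈ Icc (2 ^ i) (2 ^ (i + 6)), b x * a z * trn y Y f (z * x) := by
    rw [Ph_mul _ _ hf0, hres A i hA', sum_comm]
    refine sum_congr rfl fun z hz => ?_
    rw [Ph, hres B i' hB', mul_sum]
    refine sum_congr rfl fun x hx => ?_
    simp only [ha, hb]; ring
  have hbd : ∀ (G : AF) (hG : ∀ n : ℕ, (n:ℝ) ≤ P → |G n| ≤ E ^ 12) (n : ℕ), ‖(if n ≤ Y then (G n:ℂ) else 0)‖ ≤ E ^ 12 := by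
    intro G hG n
    split_ifs with h
    · rw [Complex.norm_real, Real.norm_eq_abs]
      exact hG n ((by exact_mod_cast h : (n:ℝ) ≤ Y).trans (by linarith))
    · simp; positivity
  rw [e1]
  refine (hop b a).trans ?_
  have hsq : √(2 ^ i') * √(2 ^ i) ≤ √P := by
    rw [← Real.sqrt_mul (by positivity), ← pow_add]
    refine Real.sqrt_le_sqrt ?_
    calc (2:ℝ) ^ (i' + i) ≤ Y := by rw [add_comm]; exact_mod_cast hii
      _ ≤ P := by linarith
  calc _ ≤ (E * C2 + E * C2) * ((8 * E ^ 12 * √(2 ^ i')) * (8 * E ^ 12 * √(2 ^ i))) := by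
        refine mul_le_mul ?_ (mul_le_mul (sum_sq_le _ _ _ (hbd B hB)) (sum_sq_le _ _ _ (hbd A hA)) (Real.sqrt_nonneg _) (by positivity))
          (by positivity) (by positivity)
        gcongr
    _ = 128 * (E ^ 25 * C2 * (√(2 ^ i') * √(2 ^ i))) := by ring
    _ ≤ E * (E ^ 25 * C2 * √P) := by
        gcongr
        linarith
    _ = _ := by ring

end W3

namespace W3
open MeasureTheory Finset
open scoped Classical

lemma bx_bd {P E : ℝ} (hE : 0 ≤ E) (g : AF) (i : ℕ) (hg : ∀ n : ℕ, (n:ℝ) ≤ P → |g n| ≤ E) (n : ℕ) (hn : (n:ℝ) ≤ P) : |bx i g n| ≤ E := by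
  rw [bx_apply]; split_ifs
  · exact hg n hn
  · simpa using hE

lemma boxL {P E : ℝ} (C : Ctx P E) (Y y ω W : ℕ) (hY : 256 * (Y:ℝ) ≤ P) (hy : 1 ≤ y) (hyY : y ≤ Y) (hY6 : Y < 2 ^ (6 * ω))
    (hW : 2 * ω ≤ W) (hyω : 2 ^ (ω + 6) < y) (f : ℕ → ℂ) (C2 T : ℝ) (hC2 : 0 ≤ C2) (hT : 0 ≤ T)
    (H2 : ∀ i i', ω ≤ i → i ≤ W → 2 ^ (i + i') ≤ Y → y ≤ 2 ^ (i + i' + 6) →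
      OpB (Icc (2 ^ i') (2 ^ (i' + 6))) (Icc (2 ^ i) (2 ^ (i + 6))) (fun b a => f (a * b)) C2)
    (H1 : ∀ i k j, i < ω → W < j → (k = 0 ∨ W < k ∧ k ≤ j) → 2 ^ (i + k + j) ≤ Y → y ≤ 2 ^ (i + k + j + 6) →
      ∀ u v : ℕ → ℕ → ℕ, (∀ l k, 2 ^ j ≤ u l k + 1) → (∀ l k, v l k ≤ 2 ^ (j + 1)) →
      ∑ l ∈ Icc (2 ^ i) (2 ^ (i + 6)), ∑ k ∈ Icc (2 ^ k) (2 ^ (k + 1)), ‖∑ n ∈ Ioc (u l k) (v l k), f (l * k * n)‖ ≤ T)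
    (g : Fin 6 → AF) (hg : ∀ j, ∀ n : ℕ, (n:ℝ) ≤ P → |g j n| ≤ E) (hg2 : ∀ j, (∀ n, 2 ^ (2 * ω) < n → g j n = 0) ∨ Sm E Y (g j)) (p : Fin 6 → ℕ) :
    ‖Ph Y (trn y Y f) (∏ j, bx (p j) (g j))‖ ≤ E ^ 26 * (√P * C2) + E ^ 14 * T := by
  have hE1 := C.E1
  have hE0 : 0 ≤ E := by linarith
  have hYP : (Y:ℝ) ≤ P := by have : (0:ℝ) ≤ Y := by positivity
                             linarith
  by_cases hz : Ph Y (trn y Y f) (∏ j, bx (p j) (g j)) = 0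
  · rw [hz, norm_zero]; positivity
  set h : Fin 6 → AF := fun j => bx (p j) (g j) with hh
  have hsupp := fun s : Finset (Fin 6) => af_prod_supp s p g
  have hbd := fun s : Finset (Fin 6) => af_prod_bd C s h (fun j _ n hn => bx_bd hE0 (g j) (p j) (hg j) n hn)
  have hbd12 : ∀ s : Finset (Fin 6), ∀ n : ℕ, (n:ℝ) ≤ P → |(∏ j ∈ s, h j) n| ≤ E ^ 12 := by
    intro s n hn
    refine (hbd s n hn).trans (pow_le_pow_right₀ hE1 ?_)
    have := card_le_univ s
    simp at this; omega
  have hcard : ∀ s : Finset (Fin 6), s.card ≤ 6 := fun s => by simpa using card_le_univ s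
  have hsupp6 : ∀ s : Finset (Fin 6), ∀ n, (∏ j ∈ s, h j) n ≠ 0 → n ∈ Icc (2 ^ (∑ j ∈ s, p j)) (2 ^ (∑ j ∈ s, p j + 6)) := by
    intro s n hn
    obtain ⟨h1, h2⟩ := hsupp s n hn
    exact mem_Icc.2 ⟨h1, h2.trans (Nat.pow_le_pow_right (by norm_num) (by have := hcard s; omega))⟩
  obtain ⟨n, hn, hn'⟩ := exists_ne_zero_of_sum_ne_zero hz
  have hn1 : y ≤ n ∧ n ≤ Y := by
    by_contra h'
    rw [trn, if_neg h'] at hn'; simp at hn'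
  have hn2 := mem_Icc.1 (hsupp6 univ n (fun h0 => hn' (by rw [h0]; simp)))
  set tp := ∑ j, p j with htp
  have hlo : 2 ^ tp ≤ Y := hn2.1.trans hn1.2
  have hhi : y ≤ 2 ^ (tp + 6) := hn1.1.trans hn2.2
  have htp6 : tp < 6 * ω := (Nat.pow_lt_pow_iff_right (by norm_num)).1 (lt_of_le_of_lt hlo hY6)
  have hsplit : ∀ s : Finset (Fin 6), ∑ j ∈ s, p j + ∑ j ∈ sᶜ, p j = tp := fun s => sum_add_sum_compl s p
  by_cases hS : ∃ s : Finset (Fin 6), ω ≤ ∑ j ∈ s, p j ∧ ∑ j ∈ s, p j ≤ W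
  · obtain ⟨s, hs1, hs2⟩ := hS
    have := typeII C Y y _ _ hY hy hyY f (∏ j ∈ s, h j) (∏ j ∈ sᶜ, h j) C2 hC2 (hbd12 s) (hbd12 sᶜ) (hsupp6 s) (hsupp6 sᶜ)
      (by rw [hsplit]; exact hlo) (H2 _ _ hs1 hs2 (by rw [hsplit]; exact hlo) (by rw [hsplit]; exact hhi))
    rw [prod_mul_prod_compl] at this
    exact this.trans (le_add_of_nonneg_right (by positivity))
  push Not at hS
  have hsm : ∀ s : Finset (Fin 6), (∀ j ∈ s, p j < ω) → ∑ j ∈ s, p j < ω := by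
    intro s
    induction s using Finset.induction_on with
    | empty => intro _; simp only [sum_empty]; by_contra h'; have : ω = 0 := by omega
               subst this; simp at hY6; omega
    | insert a s ha ih =>
      intro hj
      have h1 := ih fun j hj' => hj j (mem_insert_of_mem hj')
      have h2 := hj a (mem_insert_self _ _)
      by_contra h3
      have h4 := hS (insert a s) (by omega)
      rw [sum_insert ha] at h4
      omega
  have hlg : ∀ j, ¬ p j < ω → W < p j := by
    intro j hj
    have := hS {j} (by simpa using hj)
    simpa using this
  have hlgS : ∀ j, ¬ p j < ω → Sm E Y (g j) := by
    intro j hj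
    refine (hg2 j).resolve_left fun h0 => hz ?_
    have hb : bx (p j) (g j) = 0 := by
      ext m
      rw [bx_apply]
      split_ifs with hm
      · refine h0 m (lt_of_lt_of_le (Nat.pow_lt_pow_right (by norm_num) ?_) hm.1)
        have := hlg j hj; omega
      · rfl
    have : ∏ j, h j = 0 := prod_eq_zero (mem_univ j) hb
    rw [this]; simp [Ph]
  set S := univ.filter (fun j => p j < ω) with hSdef
  have hSsum := hsm S (fun j hj => (mem_filter.1 hj).2)
  have hnS : ∀ j, j ∈ Sᶜ → ¬ p j < ω := by
    intro j hj h'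
    rw [mem_compl] at hj
    exact hj (mem_filter.2 ⟨mem_univ _, h'⟩)
  have hcS : Sᶜ.card ≤ 2 := by
    by_contra h'
    have h1 : Sᶜ.card * (2 * ω) ≤ ∑ j ∈ Sᶜ, p j := by
      rw [← smul_eq_mul]
      exact card_nsmul_le_sum _ _ _ fun j hj => by have := hlg j (hnS j hj); omega
    have h2 := hsplit S
    have : 3 * (2 * ω) ≤ Sᶜ.card * (2 * ω) := Nat.mul_le_mul_right _ (by omega)
    omega
  have hcases : Sᶜ.card = 0 ∨ Sᶜ.card = 1 ∨ Sᶜ.card = 2 := by omega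
  have hTle : E ^ 14 * T ≤ E ^ 26 * (√P * C2) + E ^ 14 * T := le_add_of_nonneg_left (by positivity)
  rcases hcases with hc | hc | hc
  · exfalso
    rw [card_eq_zero] at hc
    have h2 := hsplit S
    rw [hc, sum_empty] at h2
    have : 2 ^ (tp + 6) ≤ 2 ^ (ω + 6) := Nat.pow_le_pow_right (by norm_num) (by omega)
    omega
  · obtain ⟨j, hj⟩ := card_eq_one.1 hc
    have hjm : j ∈ Sᶜ := by rw [hj]; simp
    have h2 := hsplit S
    rw [hj, sum_singleton] at h2
    have := typeI C Y y _ 0 (p j) hYP hy f (∏ j ∈ S, h j) 1 (g j) T (hlgS j (hnS j hjm)) (hbd12 S)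
      (fun n _ => by rw [ArithmeticFunction.one_apply]; split_ifs <;> simp <;> linarith) (hsupp6 S)
      (fun n hn => by
        rw [ArithmeticFunction.one_apply] at hn
        have : n = 1 := by by_contra h'; simp [h'] at hn
        simp [this])
      (H1 _ _ _ hSsum (hlg j (hnS j hjm)) (Or.inl rfl) (by rw [add_zero, h2]; exact hlo) (by rw [add_zero, h2]; exact hhi))
    have e1 : ∏ j, h j = (∏ j ∈ S, h j) * (1 * bx (p j) (g j)) := by
      rw [← prod_mul_prod_compl S, hj, prod_singleton, one_mul]
    rw [e1]
    exact this.trans hTle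
  · obtain ⟨j, k, hjk, hj⟩ : ∃ j k, j ≠ k ∧ Sᶜ = {k, j} ∧ p k ≤ p j := by
      obtain ⟨j, k, hjk, hj⟩ := card_eq_two.1 hc
      rcases le_total (p j) (p k) with h' | h'
      · exact ⟨k, j, hjk.symm, hj, h'⟩
      · exact ⟨j, k, hjk, by rw [hj, pair_comm], h'⟩
    obtain ⟨hj, hkj⟩ := hj
    have hjm : j ∈ Sᶜ := by rw [hj]; simp
    have hkm : k ∈ Sᶜ := by rw [hj]; simp
    have h2 := hsplit S
    rw [hj, sum_pair hjk.symm, ← add_assoc] at h2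
    have := typeI C Y y _ (p k) (p j) hYP hy f (∏ j ∈ S, h j) (h k) (g j) T (hlgS j (hnS j hjm)) (hbd12 S)
      (fun n hn => bx_bd hE0 (g k) (p k) (hg k) n hn) (hsupp6 S)
      (fun n hn => by
        have h3 : 2 ^ (p k) ≤ n ∧ n < 2 ^ (p k + 1) := by
          by_contra h'
          exact hn (by rw [hh]; show bx _ _ _ = 0; rw [bx_apply, if_neg h'])
        exact mem_Icc.2 ⟨h3.1, h3.2.le⟩)
      (H1 _ _ _ hSsum (hlg j (hnS j hjm)) (Or.inr ⟨hlg k (hnS k hkm), hkj⟩) (by rw [h2]; exact hlo) (by rw [h2]; exact hhi))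
    have e1 : ∏ j, h j = (∏ j ∈ S, h j) * (h k * bx (p j) (g j)) := by
      rw [← prod_mul_prod_compl S, hj, prod_pair hjk.symm]
    rw [e1]
    exact this.trans hTle

end W3

namespace W3
open MeasureTheory Finset
open scoped Classical

lemma Ph_congr (Y : ℕ) (f : ℕ → ℂ) (a b : AF) (h : ∀ n ≤ Y, a n = b n) : Ph Y f a = Ph Y f b :=
  sum_congr rfl fun n hn => by rw [h n (mem_Icc.1 hn).2]

lemma genL {P E : ℝ} (C : Ctx P E) (Y L : ℕ) (hL : Y < 2 ^ L) (hLP : (2:ℝ) ^ L ≤ P) (f : ℕ → ℂ) (g : Fin 6 → AF) (B : ℝ) (hB : 0 ≤ B)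
    (H : ∀ p : Fin 6 → ℕ, ‖Ph Y f (∏ j, bx (p j) (g j))‖ ≤ B) : ‖Ph Y f (∏ j, g j)‖ ≤ E ^ 6 * B := by
  have h1 : Ph Y f (∏ j, g j) = Ph Y f (∏ j, ∑ i ∈ range L, bx i (g j)) :=
    Ph_congr _ _ _ _ fun n hn => af_prod_congr univ Y _ _ (fun j _ m hm => (sum_bx L m (g j) (lt_of_le_of_lt hm hL)).symm) n hn
  rw [h1, prod_univ_sum, Ph_sum]
  refine (norm_sum_le _ _).trans ((sum_le_sum fun p _ => H p).trans ?_)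
  rw [sum_const, nsmul_eq_mul, Fintype.card_piFinset]
  have : (L:ℝ) ≤ E := C.hk L (hLP.trans (le_self_pow₀ C.P1 (by norm_num)))
  simp only [card_range, prod_const, Finset.card_univ, Fintype.card_fin]
  push_cast
  gcongr

lemma HB {P E : ℝ} (C : Ctx P E) (Y y ω W : ℕ) (hY : 256 * (Y:ℝ) ≤ P) (hy : 1 ≤ y) (hyY : y ≤ Y) (hY6 : Y < 2 ^ (6 * ω)) (hP6 : (2:ℝ) ^ (6 * ω) ≤ P)
    (hW : 2 * ω ≤ W) (hyω : 2 ^ (ω + 6) < y) (f : ℕ → ℂ) (C2 T : ℝ) (hC2 : 0 ≤ C2) (hT : 0 ≤ T)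
    (H2 : ∀ i i', ω ≤ i → i ≤ W → 2 ^ (i + i') ≤ Y → y ≤ 2 ^ (i + i' + 6) →
      OpB (Icc (2 ^ i') (2 ^ (i' + 6))) (Icc (2 ^ i) (2 ^ (i + 6))) (fun b a => f (a * b)) C2)
    (H1 : ∀ i k j, i < ω → W < j → (k = 0 ∨ W < k ∧ k ≤ j) → 2 ^ (i + k + j) ≤ Y → y ≤ 2 ^ (i + k + j + 6) →
      ∀ u v : ℕ → ℕ → ℕ, (∀ l k, 2 ^ j ≤ u l k + 1) → (∀ l k, v l k ≤ 2 ^ (j + 1)) →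
      ∑ l ∈ Icc (2 ^ i) (2 ^ (i + 6)), ∑ k ∈ Icc (2 ^ k) (2 ^ (k + 1)), ‖∑ n ∈ Ioc (u l k) (v l k), f (l * k * n)‖ ≤ T) :
    ‖∑ n ∈ Icc y Y, (ArithmeticFunction.vonMangoldt n : ℂ) * f n‖ ≤ E ^ 33 * (√P * C2) + E ^ 21 * T := by
  have hE1 := C.E1
  have hE := C.hE
  set B := E ^ 26 * (√P * C2) + E ^ 14 * T with hB
  have hB0 : 0 ≤ B := by positivity
  set lg : AF := ArithmeticFunction.log with hlg
  have hmo : ∀ n : ℕ, |mo (2 ^ (2 * ω)) n| ≤ E := by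
    intro n
    rw [mo_apply]
    split_ifs
    · have h1 : |ArithmeticFunction.moebius n| ≤ 1 := ArithmeticFunction.abs_moebius_le_one
      have h2 : |((ArithmeticFunction.moebius n : ℤ) : ℝ)| ≤ 1 := by exact_mod_cast h1
      linarith
    · simp; linarith
  have hone : ∀ n : ℕ, |(1 : AF) n| ≤ E := by
    intro n; rw [ArithmeticFunction.one_apply]; split_ifs <;> simp <;> linarith
  have hze : ∀ n : ℕ, |ze n| ≤ E := by
    intro n
    by_cases h : n = 0
    · simp [ze, h]; linarith
    · simp [ze, h]; linarith
  have hlog : ∀ n : ℕ, (n:ℝ) ≤ P → |lg n| ≤ E := by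
    intro n hn
    rw [hlg, ArithmeticFunction.log_apply, abs_of_nonneg (Real.log_natCast_nonneg n)]
    rcases Nat.eq_zero_or_pos n with rfl | h0
    · simp; linarith
    · exact (Real.log_le_log (by exact_mod_cast h0) hn).trans C.hl
  have hmo2 : ∀ n, 2 ^ (2 * ω) < n → mo (2 ^ (2 * ω)) n = 0 := fun n hn => by rw [mo_apply, if_neg (by omega)]
  have hone2 : ∀ n, 2 ^ (2 * ω) < n → (1 : AF) n = 0 := fun n hn => by
    rw [ArithmeticFunction.one_apply, if_neg]
    have : 1 ≤ 2 ^ (2 * ω) := Nat.one_le_two_pow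
    omega
  have hY1 : (1:ℝ) ≤ Y := by exact_mod_cast hy.trans hyY
  have hSl : Sm E Y lg := Sm_log hE1 Y ((Real.log_le_log (by linarith) (by linarith)).trans C.hl)
  have hSz : Sm E Y ze := Sm_ze hE1 Y
  have gen : ∀ g : Fin 6 → AF, (∀ j, ∀ n : ℕ, (n:ℝ) ≤ P → |g j n| ≤ E) → (∀ j, (∀ n, 2 ^ (2 * ω) < n → g j n = 0) ∨ Sm E Y (g j)) →
      ‖Ph Y (trn y Y f) (∏ j, g j)‖ ≤ E ^ 6 * B := by
    intro g hg hg2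
    exact genL C Y (6 * ω) hY6 hP6 _ g B hB0 fun p => boxL C Y y ω W hY hy hyY hY6 hW hyω f C2 T hC2 hT H2 H1 g hg hg2 p
  set m : AF := mo (2 ^ (2 * ω)) with hm
  have g1 := gen ![m, 1, 1, 1, 1, lg] (by
    intro j n hn
    fin_cases j
    exacts [hmo n, hone n, hone n, hone n, hone n, hlog n hn]) (by
    intro j
    fin_cases j
    exacts [Or.inl hmo2, Or.inl hone2, Or.inl hone2, Or.inl hone2, Or.inl hone2, Or.inr hSl])
  have g2 := gen ![m, m, 1, ze, 1, lg] (by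
    intro j n hn
    fin_cases j
    exacts [hmo n, hmo n, hone n, hze n, hone n, hlog n hn]) (by
    intro j
    fin_cases j
    exacts [Or.inl hmo2, Or.inl hmo2, Or.inl hone2, Or.inr hSz, Or.inl hone2, Or.inr hSl])
  have g3 := gen ![m, m, m, ze, ze, lg] (by
    intro j n hn
    fin_cases j
    exacts [hmo n, hmo n, hmo n, hze n, hze n, hlog n hn]) (by
    intro j
    fin_cases j
    exacts [Or.inl hmo2, Or.inl hmo2, Or.inl hmo2, Or.inr hSz, Or.inr hSz, Or.inr hSl])
  rw [Fin.prod_univ_six] at g1 g2 g3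
  simp only [Matrix.cons_val, mul_one] at g1 g2 g3
  have e1 : ∑ n ∈ Icc y Y, (ArithmeticFunction.vonMangoldt n : ℂ) * f n = 3 * Ph Y (trn y Y f) (m * lg) - 3 * Ph Y (trn y Y f) (m * m * ze * lg)
      + Ph Y (trn y Y f) (m * m * m * ze * ze * lg) := by
    have e2 : ∑ n ∈ Icc y Y, (ArithmeticFunction.vonMangoldt n : ℂ) * f n = ∑ n ∈ Icc 1 Y, (ArithmeticFunction.vonMangoldt n : ℂ) * trn y Y f n := by
      rw [← sum_subset (Icc_subset_Icc_left hy)]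
      · refine sum_congr rfl fun n hn => ?_
        rw [trn, if_pos (mem_Icc.1 hn)]
      · intro n hn hn'
        rw [trn, if_neg (fun h => hn' (mem_Icc.2 h)), mul_zero]
    rw [e2]
    unfold Ph
    rw [mul_sum, mul_sum, ← sum_sub_distrib, ← sum_add_distrib]
    refine sum_congr rfl fun n hn => ?_
    rw [HBid (2 ^ (2 * ω)) n ((mem_Icc.1 hn).2.trans (by rw [← pow_mul, show 2 * ω * 3 = 6 * ω by ring]; exact hY6.le))]
    push_cast
    ring
  rw [e1]
  refine (norm_add_le _ _).trans ((add_le_add (norm_sub_le _ _) le_rfl).trans ?_)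
  rw [norm_mul, norm_mul]
  simp only [Complex.norm_ofNat]
  have : 7 * (E ^ 6 * B) ≤ E * (E ^ 6 * B) := by gcongr; linarith
  have e3 : E * (E ^ 6 * B) = E ^ 33 * (√P * C2) + E ^ 21 * T := by rw [hB]; ring
  linarith

end W3

namespace W3
open MeasureTheory Finset
open scoped Classical

/-- standing assumptions -/
structure Dat (P E D : ℝ) (Y y ω : ℕ) : Prop where
  C : Ctx P E
  hY : 4096 * (Y:ℝ) ≤ P
  hy : 1 ≤ y
  hyY : y ≤ Y
  hyP : P ≤ E * y
  hY6 : Y < 2 ^ (6 * ω)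
  hP6 : (2:ℝ) ^ (6 * ω) ≤ P
  hD : 1 ≤ D
  hDw : D ^ 2 * E ^ 100 ≤ 2 ^ ω

variable {P E D : ℝ} {Y y ω : ℕ}

lemma Dat.pw (d : Dat P E D Y y ω) (a b c : ℕ) (ha : a ≤ 2 * c) (hb : b ≤ 100 * c) : D ^ a * E ^ b ≤ ((2:ℝ) ^ ω) ^ c := by
  have hE1 := d.C.E1
  have hD := d.hD
  calc D ^ a * E ^ b ≤ D ^ (2 * c) * E ^ (100 * c) := by gcongr
    _ = (D ^ 2 * E ^ 100) ^ c := by rw [mul_pow, ← pow_mul, ← pow_mul]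
    _ ≤ _ := pow_le_pow_left₀ (by positivity) d.hDw c

lemma Dat.w6 (d : Dat P E D Y y ω) : ((2:ℝ) ^ ω) ^ 6 ≤ P := by rw [← pow_mul, mul_comm]; exact d.hP6

lemma Dat.w6' (d : Dat P E D Y y ω) (t : ℕ) (h : y ≤ 2 ^ t) : ((2:ℝ) ^ ω) ^ 6 ≤ E * 2 ^ t :=
  d.w6.trans (d.hyP.trans (mul_le_mul_of_nonneg_left (by exact_mod_cast h) d.C.E0.le))

lemma Dat.Pt (d : Dat P E D Y y ω) (t : ℕ) (h : y ≤ 2 ^ t) : P ≤ E * 2 ^ t :=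
  (d.hyP.trans (mul_le_mul_of_nonneg_left (by exact_mod_cast h) d.C.E0.le))

lemma Dat.Yt (d : Dat P E D Y y ω) (t : ℕ) (h : 2 ^ t ≤ Y) : 4096 * (2:ℝ) ^ t ≤ P :=
  le_trans (by have : (2:ℝ) ^ t ≤ Y := by exact_mod_cast h
               linarith) d.hY

lemma OpB.nat {s t : Finset ℕ} {K : ℤ → ℤ → ℂ} {C : ℝ} (h : OpB (s.map (Nat.castEmbedding : ℕ ↪ ℤ)) (t.map (Nat.castEmbedding : ℕ ↪ ℤ)) K C) :
    OpB s t (fun m n => K m n) C := by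
  intro a b
  simpa [sum_map] using h (fun x => a x.toNat) (fun x => b x.toNat)

lemma mapIcc (a b : ℕ) : (Icc a b).map (Nat.castEmbedding : ℕ ↪ ℤ) = Icc (a:ℤ) b := by
  ext x
  simp only [mem_map, mem_Icc, Nat.castEmbedding_apply]
  constructor
  · rintro ⟨n, hn, rfl⟩; omega
  · intro h; exact ⟨x.toNat, by omega, by omega⟩

lemma mapIoc (a b : ℕ) : (Ioc a b).map (Nat.castEmbedding : ℕ ↪ ℤ) = Ioc (a:ℤ) b := by
  ext x
  simp only [mem_map, mem_Ioc, Nat.castEmbedding_apply]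
  constructor
  · rintro ⟨n, hn, rfl⟩; omega
  · intro h; exact ⟨x.toNat, by omega, by omega⟩

/-- shorthand -/
noncomputable def ph (α : ℝ) (n : ℕ) : ℂ := e (α * (n:ℝ) ^ 3)

lemma p1_typeII (d : Dat P E D Y y ω) (α : ℝ) (i i' : ℕ) (hi : ω ≤ i) (hi2 : i ≤ 2 * ω) (h1 : 2 ^ (i + i') ≤ Y) (h2 : y ≤ 2 ^ (i + i' + 6)) :
    OpB (Icc (2 ^ i') (2 ^ (i' + 6))) (Icc (2 ^ i) (2 ^ (i + 6))) (fun b a => ph α (a * b)) √(P / (D ^ 2 * E ^ 68)) ∨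
    ∃ (a : ℤ) (q : ℕ), 0 < q ∧ Int.gcd a q = 1 ∧ q * (1 + |α - a / q| * P ^ 3) ≤ D ^ 8 * E ^ 299 := by
  have hE1 := d.C.E1
  have hE := d.C.hE
  have hD := d.hD
  set w : ℝ := 2 ^ ω with hw
  have hw0 : 0 < w := by positivity
  have hw1 : w ≤ 2 ^ i := pow_le_pow_right₀ (by norm_num) hi
  have hw2 : (2:ℝ) ^ i ≤ w ^ 2 := by rw [hw, ← pow_mul, mul_comm]; exact pow_le_pow_right₀ (by norm_num) hi2
  have hpos : (0:ℝ) < 2 ^ i := by positivity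
  have hpos' : (0:ℝ) < 2 ^ i' := by positivity
  have h6 : w ^ 6 ≤ E * ((2:ℝ) ^ i * 2 ^ i' * 64) := by
    have := d.w6' _ h2
    rwa [pow_add, pow_add, show (2:ℝ) ^ 6 = 64 by norm_num] at this
  have hMw : w ^ 4 ≤ E * (2 ^ i' * 64) := by
    have : w ^ 2 * w ^ 4 ≤ w ^ 2 * (E * (2 ^ i' * 64)) := by
      calc w ^ 2 * w ^ 4 = w ^ 6 := by ring
        _ ≤ E * ((2:ℝ) ^ i * 2 ^ i' * 64) := h6
        _ ≤ E * (w ^ 2 * 2 ^ i' * 64) := by gcongr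
        _ = _ := by ring
    exact le_of_mul_le_mul_left this (by positivity)
  have hMN := d.Yt _ h1
  rw [pow_add] at hMN
  have hi1 : (1:ℝ) ≤ 2 ^ i := one_le_pow₀ (by norm_num)
  have hi1' : (1:ℝ) ≤ 2 ^ i' := one_le_pow₀ (by norm_num)
  have hD1 : ∀ k, 1 ≤ D ^ k := fun k => one_le_pow₀ hD
  have hEk : ∀ k, 1 ≤ E ^ k := fun k => one_le_pow₀ hE1
  have hD2 : 1 ≤ D ^ 2 * E ^ 68 := one_le_mul_of_one_le_of_one_le (hD1 2) (hEk 68)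
  have c1 : (2:ℝ) ^ i * 64 ≤ 2 ^ i' * 64 := by
    have h3 : E * w ^ 2 * 64 ≤ w ^ 4 := by
      calc E * w ^ 2 * 64 ≤ E * w ^ 2 * E := by gcongr; linarith
        _ = (D ^ 0 * E ^ 2) * w ^ 2 := by ring
        _ ≤ w ^ 2 * w ^ 2 := mul_le_mul_of_nonneg_right (d.pw 0 2 2 (by norm_num) (by norm_num)) (by positivity)
        _ = _ := by ring
    have h4 : E * (2 ^ i * 64) ≤ E * (2 ^ i' * 64) := by
      calc E * (2 ^ i * 64) ≤ E * (w ^ 2 * 64) := by gcongr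
        _ = E * w ^ 2 * 64 := by ring
        _ ≤ _ := h3.trans hMw
    exact le_of_mul_le_mul_left h4 d.C.E0
  have c2 : D ^ 2 * E ^ 68 * E ^ 7 ≤ 2 ^ i * 64 := by
    calc D ^ 2 * E ^ 68 * E ^ 7 = D ^ 2 * E ^ 75 := by ring
      _ ≤ w ^ 1 := d.pw 2 75 1 (by norm_num) (by norm_num)
      _ ≤ _ := by rw [pow_one]; linarith
  have c3 : (D ^ 2 * E ^ 68) ^ 4 * E ^ 12 ≤ 2 ^ i' * 64 := by
    refine le_of_mul_le_mul_left ?_ d.C.E0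
    calc E * ((D ^ 2 * E ^ 68) ^ 4 * E ^ 12) = D ^ 8 * E ^ 285 := by ring
      _ ≤ w ^ 4 := d.pw 8 285 4 (by norm_num) (by norm_num)
      _ ≤ _ := hMw
  have c4 : (D ^ 2 * E ^ 68) ^ 8 * E ^ 26 * (2 ^ i * 64) ^ 2 ≤ (2 ^ i' * 64) ^ 3 := by
    refine le_of_mul_le_mul_left ?_ (pow_pos d.C.E0 3)
    calc E ^ 3 * ((D ^ 2 * E ^ 68) ^ 8 * E ^ 26 * (2 ^ i * 64) ^ 2) ≤ E ^ 3 * ((D ^ 2 * E ^ 68) ^ 8 * E ^ 26 * (w ^ 2 * E) ^ 2) := by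
          gcongr; linarith
      _ = (D ^ 16 * E ^ 575) * w ^ 4 := by ring
      _ ≤ w ^ 8 * w ^ 4 := mul_le_mul_of_nonneg_right (d.pw 16 575 8 (by norm_num) (by norm_num)) (by positivity)
      _ = (w ^ 4) ^ 3 := by ring
      _ ≤ (E * (2 ^ i' * 64)) ^ 3 := by gcongr
      _ = _ := by ring
  have hN1 : ((2 ^ (i + 6) : ℕ) : ℝ) = 2 ^ i * 64 := by push_cast; rw [pow_add]; norm_num
  have hM1 : ((2 ^ (i' + 6) : ℕ) : ℝ) = 2 ^ i' * 64 := by push_cast; rw [pow_add]; norm_num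
  rcases L8 d.C α (2 ^ i' * 64) (2 ^ i * 64) (D ^ 2 * E ^ 68) (by nlinarith) c1 hD2 c2 c3 c4 ((2 ^ i' : ℕ) - 1) (2 ^ (i' + 6) : ℕ)
    (by push_cast at hM1 ⊢; linarith) ((Icc (2 ^ i) (2 ^ (i + 6))).map Nat.castEmbedding) (by
      intro n hn
      rw [mapIcc, mem_Icc] at hn
      have h3 : ((2 ^ i : ℕ):ℝ) ≤ n := by exact_mod_cast hn.1
      have h4 : (n:ℝ) ≤ ((2 ^ (i + 6) : ℕ):ℝ) := by exact_mod_cast hn.2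
      rw [hN1] at h4
      push_cast at h3
      constructor
      · linarith
      · exact h4) with h | ⟨a, q, hq, hg, hb⟩
  · left
    have hset : (Ioc (((2 ^ i' : ℕ):ℤ) - 1) ((2 ^ (i' + 6) : ℕ):ℤ)) = (Icc (2 ^ i') (2 ^ (i' + 6))).map Nat.castEmbedding := by
      rw [mapIcc]; ext x; simp only [mem_Ioc, mem_Icc]; omega
    rw [hset] at h
    refine (OpB.mono h.nat (Real.sqrt_le_sqrt ?_)).congr fun b _ a _ => ?_
    · gcongr; linarith
    · unfold ph; congr 1; push_cast; ring
  · right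
    refine ⟨a, q, hq, hg, ?_⟩
    have hP3 : P ^ 3 ≤ E ^ 3 * ((2 ^ i' * 64) ^ 3 * (2 ^ i * 64) ^ 3) := by
      have h5 := d.Pt _ h2
      rw [pow_add, pow_add] at h5
      have h6 : P ≤ E * ((2 ^ i' * 64) * (2 ^ i * 64)) := by
        refine h5.trans ?_
        have : (0:ℝ) ≤ 2 ^ i * 2 ^ i' := by positivity
        refine mul_le_mul_of_nonneg_left ?_ (by linarith)
        linarith
      calc P ^ 3 ≤ (E * ((2 ^ i' * 64) * (2 ^ i * 64))) ^ 3 := pow_le_pow_left₀ d.C.P0.le h6 3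
        _ = _ := by ring
    calc q * (1 + |α - a / q| * P ^ 3) ≤ q * (E ^ 3 * 1 + |α - a / q| * (E ^ 3 * ((2 ^ i' * 64) ^ 3 * (2 ^ i * 64) ^ 3))) := by
          have := hEk 3
          gcongr; linarith
      _ = E ^ 3 * (q * (1 + |α - a / q| * ((2 ^ i' * 64) ^ 3 * (2 ^ i * 64) ^ 3))) := by ring
      _ ≤ E ^ 3 * ((D ^ 2 * E ^ 68) ^ 4 * E ^ 24) := by gcongr
      _ = _ := by ring
end W3

namespace W3
open MeasureTheory Finset
open scoped Classical
variable {P E D : ℝ} {Y y ω : ℕ}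

lemma sumIcc {M : Type*} [AddCommMonoid M] (a b : ℕ) (F : ℤ → M) : ∑ x ∈ Icc (a:ℤ) b, F x = ∑ n ∈ Icc a b, F n := by
  rw [← mapIcc, sum_map]; rfl

lemma sumIoc {M : Type*} [AddCommMonoid M] (a b : ℕ) (F : ℤ → M) : ∑ x ∈ Ioc (a:ℤ) b, F x = ∑ n ∈ Ioc a b, F n := by
  rw [← mapIoc, sum_map]; rfl

lemma p1_typeI (d : Dat P E D Y y ω) (α : ℝ) (i k j : ℕ) (hi : i < ω) (hj : 2 * ω < j) (hk : k = 0 ∨ 2 * ω < k ∧ k ≤ j)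
    (h1 : 2 ^ (i + k + j) ≤ Y) (h2 : y ≤ 2 ^ (i + k + j + 6)) (u v : ℕ → ℕ → ℕ) (hu : ∀ l k, 2 ^ j ≤ u l k + 1) (hv : ∀ l k, v l k ≤ 2 ^ (j + 1))
    (hT : P / (D * E ^ 22) < ∑ l ∈ Icc (2 ^ i) (2 ^ (i + 6)), ∑ k ∈ Icc (2 ^ k) (2 ^ (k + 1)), ‖∑ n ∈ Ioc (u l k) (v l k), ph α (l * k * n)‖) :
    ∃ (a : ℤ) (q : ℕ), 0 < q ∧ Int.gcd a q = 1 ∧ q * (1 + |α - a / q| * P ^ 3) ≤ D ^ 8 * E ^ 299 := by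
  have hE1 := d.C.E1
  have hE := d.C.hE
  have hE0 := d.C.E0
  have hD := d.hD
  have hD0 : 0 < D := by linarith
  have hkj : k ≤ j := by rcases hk with rfl | h <;> omega
  set w : ℝ := 2 ^ ω with hw
  have hw1 : 1 ≤ w := one_le_pow₀ (by norm_num)
  have hw0 : 0 < w := by positivity
  obtain ⟨I, hI⟩ : ∃ I : ℝ, I = 2 ^ i := ⟨_, rfl⟩
  obtain ⟨K, hK⟩ : ∃ K : ℝ, K = 2 ^ k := ⟨_, rfl⟩
  obtain ⟨N, hN⟩ : ∃ N : ℝ, N = 2 ^ j := ⟨_, rfl⟩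
  have hI1 : 1 ≤ I := by rw [hI]; exact one_le_pow₀ (by norm_num)
  have hK1 : 1 ≤ K := by rw [hK]; exact one_le_pow₀ (by norm_num)
  have hN1 : 1 ≤ N := by rw [hN]; exact one_le_pow₀ (by norm_num)
  have hIw : I ≤ w := by rw [hI]; exact pow_le_pow_right₀ (by norm_num) hi.le
  have hKN : K ≤ N := by rw [hK, hN]; exact pow_le_pow_right₀ (by norm_num) hkj
  have hNw : w ^ 2 ≤ N := by rw [hw, hN, ← pow_mul, mul_comm]; exact pow_le_pow_right₀ (by norm_num) hj.le
  have hD1 : ∀ k, 1 ≤ D ^ k := fun k => one_le_pow₀ hD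
  have hEk : ∀ k, 1 ≤ E ^ k := fun k => one_le_pow₀ hE1
  have hY := d.Yt _ h1
  rw [pow_add, pow_add, ← hI, ← hK, ← hN] at hY
  have hPt := d.Pt _ h2
  rw [pow_add, pow_add, pow_add, ← hI, ← hK, ← hN] at hPt
  have hPw := d.w6
  rw [← hw] at hPw
  have hNK5 : w ^ 5 ≤ E ^ 2 * (N * K) := by
    refine le_of_mul_le_mul_left ?_ hw0
    calc w * w ^ 5 = w ^ 6 := by ring
      _ ≤ E * (I * K * N * 2 ^ 6) := hPw.trans hPt
      _ ≤ E * (w * K * N * E) := by gcongr; linarith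
      _ = _ := by ring
  have hN2 : w ^ 5 ≤ E ^ 2 * N ^ 2 := hNK5.trans (by rw [sq N]; gcongr)
  have c1 : 4 * (D ^ 5 * E ^ 146) ≤ N := by
    refine le_of_sq_le_sq ?_ (by linarith)
    refine le_of_mul_le_mul_left ?_ (pow_pos hE0 2)
    calc E ^ 2 * (4 * (D ^ 5 * E ^ 146)) ^ 2 = 16 * (D ^ 10 * E ^ 294) := by ring
      _ ≤ E * (D ^ 10 * E ^ 294) := by gcongr; linarith
      _ = D ^ 10 * E ^ 295 := by ring
      _ ≤ w ^ 5 := d.pw 10 295 5 (by norm_num) (by norm_num)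
      _ ≤ _ := hN2
  have c1' : (D * E ^ 22) ^ 5 * E ^ 9 ≤ N := by
    refine le_trans ?_ c1
    calc (D * E ^ 22) ^ 5 * E ^ 9 = 1 * (D ^ 5 * E ^ 119) := by ring
      _ ≤ 4 * (D ^ 5 * E ^ 146) := by gcongr <;> norm_num
  have c2 : (D * E ^ 22) ^ 5 * E ^ 36 * (2 * K) ^ 2 ≤ N ^ 3 := by
    calc (D * E ^ 22) ^ 5 * E ^ 36 * (2 * K) ^ 2 = 4 * (D ^ 5 * E ^ 146) * K ^ 2 := by ring
      _ ≤ N * N ^ 2 := by gcongr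
      _ = _ := by ring
  have c12 : D ^ 12 * E ^ 400 ≤ w ^ 6 := d.pw 12 400 6 (by norm_num) (by norm_num)
  have c9 : D ^ 9 * E ^ 274 ≤ w ^ 6 := d.pw 9 274 6 (by norm_num) (by norm_num)
  have c3 : w ^ 9 ≤ P ^ 20 := by
    calc w ^ 9 ≤ w ^ 120 := pow_le_pow_right₀ hw1 (by norm_num)
      _ = (w ^ 6) ^ 20 := by ring
      _ ≤ _ := by gcongr
  have c4 : 4 * (D * E ^ 22) ^ 9 * E ^ 68 * w ^ 9 ≤ (N * (2 * K)) ^ 3 := by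
    refine le_of_mul_le_mul_left ?_ (pow_pos hE0 6)
    calc E ^ 6 * (4 * (D * E ^ 22) ^ 9 * E ^ 68 * w ^ 9) = 4 * (D ^ 9 * E ^ 272) * w ^ 9 := by ring
      _ ≤ E ^ 2 * (D ^ 9 * E ^ 272) * w ^ 9 := by
          have : E ≤ E ^ 2 := le_self_pow₀ hE1 (by norm_num)
          gcongr; linarith
      _ = (D ^ 9 * E ^ 274) * w ^ 9 := by ring
      _ ≤ w ^ 6 * w ^ 9 := by gcongr
      _ = (w ^ 5) ^ 3 := by ring
      _ ≤ (E ^ 2 * (N * K)) ^ 3 := by gcongr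
      _ ≤ (E ^ 2 * (N * (2 * K))) ^ 3 := by gcongr; linarith
      _ = _ := by ring
  have c5 : 4 * (D * E ^ 22) ^ 9 * E ^ 68 * (64 * I) ^ 3 ≤ w ^ 9 := by
    calc 4 * (D * E ^ 22) ^ 9 * E ^ 68 * (64 * I) ^ 3 ≤ E * (D * E ^ 22) ^ 9 * E ^ 68 * (E * w) ^ 3 := by
          gcongr <;> linarith
      _ = D ^ 9 * E ^ 270 * w ^ 3 := by ring
      _ ≤ D ^ 9 * E ^ 274 * w ^ 3 := by gcongr; norm_num
      _ ≤ w ^ 6 * w ^ 3 := by gcongr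
      _ = _ := by ring
  have c6 : (D * E ^ 22) ^ 12 * E ^ 93 ≤ N ^ 3 := by
    calc (D * E ^ 22) ^ 12 * E ^ 93 = D ^ 12 * E ^ 357 := by ring
      _ ≤ D ^ 12 * E ^ 400 := by gcongr; norm_num
      _ ≤ w ^ 6 := c12
      _ = (w ^ 2) ^ 3 := by ring
      _ ≤ _ := by gcongr
  have hIKN : 1 ≤ I * K := one_le_mul_of_one_le_of_one_le hI1 hK1
  have hNle : N ≤ I * K * N := le_mul_of_one_le_left (by linarith) hIKN
  have hcast : ∀ m t : ℕ, ((2 ^ (m + t) : ℕ):ℝ) = 2 ^ m * 2 ^ t := fun m t => by push_cast; rw [pow_add]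
  obtain ⟨a, q, hq, hg, hb⟩ := L10 d.C α (64 * I) (2 * K) N (D * E ^ 22) (w ^ 9) (by linarith) (by linarith)
    (by linarith) (by linarith) (one_le_mul_of_one_le_of_one_le hD (hEk 22)) c1' c2 (one_le_pow₀ hw1) c3 c4 c5 c6
    (Icc ((2 ^ i : ℕ):ℤ) (2 ^ (i + 6) : ℕ)) (Icc ((2 ^ k : ℕ):ℤ) (2 ^ (k + 1) : ℕ)) (by
      intro l hl
      rw [mem_Icc] at hl
      have h3 : ((2 ^ i : ℕ):ℝ) ≤ l := by exact_mod_cast hl.1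
      have h4 : (l:ℝ) ≤ ((2 ^ (i + 6) : ℕ):ℝ) := by exact_mod_cast hl.2
      have h5 : 1 ≤ 2 ^ i := Nat.one_le_two_pow
      rw [hcast, ← hI] at h4
      push_cast at h3
      rw [← hI] at h3
      exact ⟨by omega, by linarith, by linarith⟩) (by
      intro l hl
      rw [mem_Icc] at hl
      have h3 : ((2 ^ k : ℕ):ℝ) ≤ l := by exact_mod_cast hl.1
      have h4 : (l:ℝ) ≤ ((2 ^ (k + 1) : ℕ):ℝ) := by exact_mod_cast hl.2
      have h5 : 1 ≤ 2 ^ k := Nat.one_le_two_pow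
      rw [hcast, ← hK] at h4
      push_cast at h3
      rw [← hK] at h3
      exact ⟨by omega, by linarith, by linarith⟩)
    (fun l k => u l.toNat k.toNat) (fun l k => v l.toNat k.toNat) (by
      intro l _ k _
      rw [hN]
      exact_mod_cast hu l.toNat k.toNat) (by
      intro l _ k _
      have : ((v l.toNat k.toNat : ℕ):ℝ) ≤ ((2 ^ (j + 1) : ℕ):ℝ) := by exact_mod_cast hv l.toNat k.toNat
      rw [hcast, ← hN] at this
      push_cast at this ⊢
      linarith) (by
      rw [sumIcc]
      simp only [sumIcc, sumIoc, Int.toNat_natCast]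
      refine lt_of_le_of_lt ?_ (hT.trans_eq ?_)
      · refine div_le_div_of_nonneg_right ?_ (by positivity)
        linarith
      · refine sum_congr rfl fun l _ => sum_congr rfl fun k _ => ?_
        congr 1
        refine sum_congr rfl fun n _ => ?_
        unfold ph; congr 1; push_cast; ring)
  refine ⟨a, q, hq, hg, ?_⟩
  have hP3 : P ^ 3 ≤ E ^ 3 * (64 * I * (2 * K) * N) ^ 3 := by
    rw [← mul_pow]
    refine pow_le_pow_left₀ d.C.P0.le (hPt.trans (mul_le_mul_of_nonneg_left ?_ hE0.le)) 3
    linarith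
  calc q * (1 + |α - a / q| * P ^ 3) ≤ q * (E ^ 3 * 1 + |α - a / q| * (E ^ 3 * (64 * I * (2 * K) * N) ^ 3)) := by
        have := hEk 3
        gcongr; linarith
    _ = E ^ 3 * (q * (1 + |α - a / q| * (64 * I * (2 * K) * N) ^ 3)) := by ring
    _ ≤ E ^ 3 * ((D * E ^ 22) ^ 6 * E ^ 32) := by gcongr
    _ = D ^ 6 * E ^ 167 := by ring
    _ ≤ _ := by gcongr <;> norm_num

lemma Dat.yw (d : Dat P E D Y y ω) : 2 ^ (ω + 6) < y := by
  have hE := d.C.hE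
  have hE0 := d.C.E0
  have h : (2:ℝ) ^ (ω + 6) < y := by
    refine lt_of_mul_lt_mul_left (lt_of_lt_of_le ?_ (d.w6.trans d.hyP)) hE0.le
    set w : ℝ := 2 ^ ω with hw
    have hw0 : 0 < w := by positivity
    rw [pow_add]
    calc E * (w * 2 ^ 6) < E * (w * E) := by gcongr; linarith
      _ = w * (D ^ 0 * E ^ 2) := by ring
      _ ≤ w * w ^ 5 := mul_le_mul_of_nonneg_left (d.pw 0 2 5 (by norm_num) (by norm_num)) hw0.le
      _ = w ^ 6 := by ring
  exact_mod_cast h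

lemma pass1 (d : Dat P E D Y y ω) (α : ℝ) (hS : P / (2 * D) < ‖∑ n ∈ Icc y Y, (ArithmeticFunction.vonMangoldt n : ℂ) * ph α n‖) :
    ∃ (a : ℤ) (q : ℕ), 0 < q ∧ Int.gcd a q = 1 ∧ q * (1 + |α - a / q| * P ^ 3) ≤ D ^ 8 * E ^ 299 := by
  by_contra hno
  have hE := d.C.hE
  have hE0 := d.C.E0
  have hE1 := d.C.E1
  have hD := d.hD
  have hD0 : 0 < D := by linarith
  have hP0 := d.C.P0
  have hY0 : (0:ℝ) ≤ Y := by positivity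
  have h := HB d.C Y y ω (2 * ω) (by linarith [d.hY]) d.hy d.hyY d.hY6 d.hP6 le_rfl d.yw (ph α) √(P / (D ^ 2 * E ^ 68)) (P / (D * E ^ 22))
    (Real.sqrt_nonneg _) (by positivity) (fun i i' hi hi2 h1 h2 => (p1_typeII d α i i' hi hi2 h1 h2).resolve_right hno)
    (fun i k j hi hj hk h1 h2 u v hu hv => by
      by_contra h
      exact hno (p1_typeI d α i k j hi hj hk h1 h2 u v hu hv (lt_of_not_ge h)))
  have e1 : √P * √(P / (D ^ 2 * E ^ 68)) = P / (D * E ^ 34) := by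
    rw [← Real.sqrt_mul hP0.le, show P * (P / (D ^ 2 * E ^ 68)) = (P / (D * E ^ 34)) ^ 2 by field_simp, Real.sqrt_sq (by positivity)]
  rw [e1] at h
  have e2 : E ^ 33 * (P / (D * E ^ 34)) + E ^ 21 * (P / (D * E ^ 22)) = 2 * (P / D) / E := by field_simp; ring
  rw [e2] at h
  have h3 : 2 * (P / D) / E ≤ P / (2 * D) := by
    rw [div_le_iff₀ hE0, show P / (2 * D) * E = (P / D) * (E / 2) by field_simp, mul_comm 2]
    gcongr; linarith
  linarith

end W3

namespace W3
open MeasureTheory Finset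
open scoped Classical
variable {P E D : ℝ} {Y y ω : ℕ}

lemma OpB.filt {ι κ : Type*} {s : Finset ι} {t : Finset κ} {K : ι → κ → ℂ} {C : ℝ} (hC : 0 ≤ C) (p : ι → Prop) (r : κ → Prop)
    [DecidablePred p] [DecidablePred r]
    (h : OpB (s.filter p) (t.filter r) K C) : OpB s t (fun i j => if p i ∧ r j then K i j else 0) C := by
  intro a b
  have e1 : ∑ i ∈ s, ∑ j ∈ t, a i * b j * (if p i ∧ r j then K i j else 0) = ∑ i ∈ s.filter p, ∑ j ∈ t.filter r, a i * b j * K i j := by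
    rw [sum_filter]
    refine sum_congr rfl fun i _ => ?_
    by_cases hp : p i
    · rw [if_pos hp, sum_filter]
      refine sum_congr rfl fun j _ => ?_
      by_cases hr : r j <;> simp [hp, hr]
    · simp [hp]
  rw [e1]
  refine (h a b).trans (mul_le_mul_of_nonneg_left ?_ hC)
  refine mul_le_mul (Real.sqrt_le_sqrt ?_) (Real.sqrt_le_sqrt ?_) (Real.sqrt_nonneg _) (Real.sqrt_nonneg _)
  · exact sum_le_sum_of_subset_of_nonneg (filter_subset _ _) fun _ _ _ => by positivity
  · exact sum_le_sum_of_subset_of_nonneg (filter_subset _ _) fun _ _ _ => by positivity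

/-- the restricted phase -/
noncomputable def pc (α : ℝ) (q n : ℕ) : ℂ := if Nat.Coprime n q then ph α n else 0

lemma p2_typeII (d : Dat P E D Y y ω) (a : ℤ) (q : ℕ) (hq : 0 < q) (hg : Int.gcd a q = 1) (β : ℝ)
    (hQ : q * (1 + |β| * P ^ 3) ≤ D ^ 8 * E ^ 299) (hQ2 : D ^ 2 * E ^ 90 < q * (1 + |β| * P ^ 3))
    (i i' : ℕ) (hi : ω ≤ i) (hi2 : i ≤ 3 * ω) (h1 : 2 ^ (i + i') ≤ Y) (h2 : y ≤ 2 ^ (i + i' + 6)) :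
    OpB (Icc (2 ^ i') (2 ^ (i' + 6))) (Icc (2 ^ i) (2 ^ (i + 6))) (fun b n => pc (a / q + β) q (n * b)) √(P / (D ^ 2 * E ^ 68)) := by
  have hE1 := d.C.E1
  have hE := d.C.hE
  have hE0 := d.C.E0
  have hD := d.hD
  have hP1 := d.C.P1
  have hP0 := d.C.P0
  have hEk : ∀ k, 1 ≤ E ^ k := fun k => one_le_pow₀ hE1
  have hq1 : (1:ℝ) ≤ q := by exact_mod_cast hq
  obtain ⟨w, hw⟩ : ∃ w : ℝ, w = 2 ^ ω := ⟨_, rfl⟩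
  have hw1 : 1 ≤ w := by rw [hw]; exact one_le_pow₀ (by norm_num)
  have hw0 : 0 < w := by linarith
  have hwi : w ≤ 2 ^ i := by rw [hw]; exact pow_le_pow_right₀ (by norm_num) hi
  have hwi2 : (2:ℝ) ^ i ≤ w ^ 3 := by rw [hw, ← pow_mul, mul_comm]; exact pow_le_pow_right₀ (by norm_num) hi2
  have h6 : w ^ 6 ≤ P := by rw [hw]; exact d.w6
  have hpw : ∀ a b c : ℕ, a ≤ 2 * c → b ≤ 100 * c → D ^ a * E ^ b ≤ w ^ c := by rw [hw]; exact d.pw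
  obtain ⟨M, hM⟩ : ∃ M : ℝ, M = 2 ^ i' * 64 := ⟨_, rfl⟩
  obtain ⟨N, hN⟩ : ∃ N : ℝ, N = 2 ^ i * 64 := ⟨_, rfl⟩
  have hM1 : 1 ≤ M := by have : (1:ℝ) ≤ 2 ^ i' := one_le_pow₀ (by norm_num)
                         linarith
  have hN1 : 1 ≤ N := by have : (1:ℝ) ≤ 2 ^ i := one_le_pow₀ (by norm_num)
                         linarith
  have hMN : M * N ≤ P := by
    have := d.Yt _ h1
    rw [pow_add] at this
    rw [hM, hN]; linarith
  have hMN2 : P ≤ E * (M * N) := by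
    refine (d.Pt _ h2).trans (mul_le_mul_of_nonneg_left ?_ hE0.le)
    have : (0:ℝ) ≤ 2 ^ i * 2 ^ i' := by positivity
    rw [pow_add, pow_add, hM, hN]; linarith
  have hMN3 : M ^ 3 * N ^ 3 ≤ P ^ 3 := by rw [← mul_pow]; gcongr
  have hB : |β| * M ^ 3 * N ^ 3 ≤ |β| * P ^ 3 := by rw [mul_assoc]; gcongr
  obtain ⟨Q, hQd⟩ : ∃ Q : ℝ, Q = q * (1 + |β| * P ^ 3) := ⟨_, rfl⟩
  obtain ⟨Q', hQd'⟩ : ∃ Q' : ℝ, Q' = q * (1 + |β| * M ^ 3 * N ^ 3) := ⟨_, rfl⟩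
  rw [← hQd] at hQ hQ2
  have hb0 : 0 ≤ |β| * P ^ 3 := by positivity
  have hb0' : 0 ≤ |β| * M ^ 3 * N ^ 3 := by positivity
  have hQ'Q : Q' ≤ Q := by rw [hQd, hQd']; gcongr
  have hQ'1 : 1 ≤ Q' := by rw [hQd']; exact one_le_mul_of_one_le_of_one_le hq1 (by linarith)
  have hQQ' : Q ≤ E ^ 3 * Q' := by
    rw [hQd, hQd']
    have h3 : P ^ 3 ≤ E ^ 3 * (M ^ 3 * N ^ 3) := by
      calc P ^ 3 ≤ (E * (M * N)) ^ 3 := by gcongr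
        _ = _ := by ring
    calc q * (1 + |β| * P ^ 3) ≤ q * (E ^ 3 + |β| * (E ^ 3 * (M ^ 3 * N ^ 3))) := by
          have := hEk 3
          gcongr
      _ = _ := by ring
  have hQw : Q ≤ w ^ 4 := hQ.trans (hpw 8 299 4 (by norm_num) (by norm_num))
  have hwP : w ^ 4 ≤ P ^ 1 := by rw [pow_one]; exact (pow_le_pow_right₀ hw1 (by norm_num)).trans h6
  have hqQ : (q:ℝ) ≤ Q := by rw [hQd]; exact le_mul_of_one_le_right (by linarith) (by linarith)
  have hBQ : |β| * P ^ 3 ≤ Q := by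
    rw [hQd]
    calc |β| * P ^ 3 ≤ 1 * (1 + |β| * P ^ 3) := by linarith
      _ ≤ _ := by gcongr
  have hop := L9 d.C q hq ((hqQ.trans (hQw.trans hwP)).trans (pow_le_pow_right₀ hP1 (by norm_num))) a hg β M N hM1 hN1
    (hB.trans ((hBQ.trans (hQw.trans hwP)).trans (pow_le_pow_right₀ hP1 (by norm_num))))
    (((Icc (2 ^ i') (2 ^ (i' + 6))).filter (fun n => Nat.Coprime n q)).map Nat.castEmbedding)
    (((Icc (2 ^ i) (2 ^ (i + 6))).filter (fun n => Nat.Coprime n q)).map Nat.castEmbedding) (by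
      intro m hm
      simp only [mem_map, mem_filter, mem_Icc, Nat.castEmbedding_apply] at hm
      obtain ⟨n, ⟨⟨h3, h4⟩, h5⟩, rfl⟩ := hm
      have h3' : ((2:ℝ) ^ i') ≤ n := by exact_mod_cast h3
      have h4' : (n:ℝ) ≤ 2 ^ (i' + 6) := by exact_mod_cast h4
      rw [pow_add] at h4'
      refine ⟨?_, ?_, Nat.isCoprime_iff_coprime.mpr h5⟩
      · rw [hM]; push_cast; linarith
      · rw [hM]; push_cast; linarith) (by
      intro m hm
      simp only [mem_map, mem_filter, mem_Icc, Nat.castEmbedding_apply] at hm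
      obtain ⟨n, ⟨⟨h3, h4⟩, h5⟩, rfl⟩ := hm
      have h3' : ((2:ℝ) ^ i) ≤ n := by exact_mod_cast h3
      have h4' : (n:ℝ) ≤ 2 ^ (i + 6) := by exact_mod_cast h4
      rw [pow_add] at h4'
      refine ⟨?_, ?_, Nat.isCoprime_iff_coprime.mpr h5⟩
      · rw [hN]; push_cast; linarith
      · rw [hN]; push_cast; linarith)
  rw [← hQd'] at hop
  refine ((OpB.filt (Real.sqrt_nonneg _) (fun n => Nat.Coprime n q) (fun n => Nat.Coprime n q) hop.nat).mono (Real.sqrt_le_sqrt ?_)).congr fun b _ n _ => ?_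
  · have hV0 : 0 < D ^ 2 * E ^ 68 := by positivity
    have hQ0 : 0 < Q' := by linarith
    have hMw : M ≤ P / w := by
      rw [le_div_iff₀ hw0]
      refine le_trans ?_ hMN
      gcongr; linarith
    have hNw : N ≤ E * (P / w) := by
      rw [← mul_div_assoc, le_div_iff₀ hw0]
      calc N * w ≤ E * w ^ 3 * w := by
            gcongr; rw [hN, mul_comm]; gcongr; linarith
        _ = E * w ^ 4 := by ring
        _ ≤ E * P := by rw [pow_one] at hwP; gcongr
    have hQPw : Q' ≤ P / w := by
      rw [le_div_iff₀ hw0]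
      calc Q' * w ≤ w ^ 4 * w := by gcongr; linarith
        _ = w ^ 5 := by ring
        _ ≤ w ^ 6 := pow_le_pow_right₀ hw1 (by norm_num)
        _ ≤ P := h6
    have hPw : P / w ≤ P / (D ^ 2 * E ^ 100) := by
      refine div_le_div_of_nonneg_left hP0.le (by positivity) ?_
      simpa using hpw 2 100 1 (by norm_num) (by norm_num)
    have hMNQ : M * N / Q' ≤ P / (D ^ 2 * E ^ 87) := by
      rw [div_le_div_iff₀ hQ0 (by positivity)]
      refine mul_le_mul hMN ?_ (by positivity) hP0.le
      refine le_of_mul_le_mul_left ?_ (pow_pos hE0 3)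
      calc E ^ 3 * (D ^ 2 * E ^ 87) = D ^ 2 * E ^ 90 := by ring
        _ ≤ _ := hQ2.le.trans hQQ'
    have hPw0 : 0 ≤ P / (D ^ 2 * E ^ 100) := by positivity
    calc E ^ 12 * (M / Q' + 1) * (N + Q') = E ^ 12 * (M * N / Q' + M + N + Q') := by field_simp; ring
      _ ≤ E ^ 12 * (P / (D ^ 2 * E ^ 87) + P / (D ^ 2 * E ^ 100) + E * (P / (D ^ 2 * E ^ 100)) + P / (D ^ 2 * E ^ 100)) := by
          refine mul_le_mul_of_nonneg_left ?_ (by positivity)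
          have : E * (P / w) ≤ E * (P / (D ^ 2 * E ^ 100)) := by gcongr
          linarith
      _ ≤ E ^ 12 * (P / (D ^ 2 * E ^ 81)) := by
          refine mul_le_mul_of_nonneg_left ?_ (by positivity)
          obtain ⟨G, hG⟩ : ∃ G, G = P / (D ^ 2 * E ^ 100) := ⟨_, rfl⟩
          have hG0 : 0 ≤ G := by rw [hG]; exact hPw0
          have f1 : P / (D ^ 2 * E ^ 87) = E ^ 13 * G := by rw [hG]; field_simp
          have f2 : P / (D ^ 2 * E ^ 81) = E ^ 19 * G := by rw [hG]; field_simp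
          rw [f1, f2, ← hG]
          have g1 : E ^ 13 * G ≤ E ^ 18 * G := by gcongr <;> norm_num
          have g2 : E * G ≤ E ^ 18 * G := by gcongr; exact le_self_pow₀ hE1 (by norm_num)
          have g3 : 1 * G ≤ E ^ 18 * G := by gcongr; exact hEk _
          have g4 : 4 * (E ^ 18 * G) ≤ E * (E ^ 18 * G) := by gcongr; linarith
          have g5 : E ^ 19 * G = E * (E ^ 18 * G) := by ring
          linarith
      _ = P / (D ^ 2 * E ^ 69) := by field_simp
      _ ≤ _ := by gcongr <;> norm_num
  · unfold pc
    by_cases h3 : Nat.Coprime b q ∧ Nat.Coprime n q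
    · rw [if_pos h3, if_pos (Nat.coprime_mul_iff_left.mpr h3.symm)]
      unfold ph; congr 1; push_cast; ring
    · rw [if_neg h3, if_neg (fun h => h3 (Nat.coprime_mul_iff_left.mp h).symm)]

end W3

namespace W3
open MeasureTheory Finset
open scoped Classical
variable {P E D : ℝ} {Y y ω : ℕ}

lemma inner2 (C : Ctx P E) (a : ℤ) (q : ℕ) (hq : 0 < q) (hqP : (q:ℝ) ≤ P ^ 20) (hg : Int.gcd a q = 1) (β N : ℝ) (L : ℕ) (hN : 1 ≤ N)
    (u v : ℕ) (hu : N ≤ u + 1) (hv : (v:ℝ) ≤ 2 * N) :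
    ‖∑ n ∈ Ioc u v, pc (a / q + β) q (L * n)‖ ≤ 18 * E ^ 6 * N / (√q * (1 + |β| * L ^ 3 * N ^ 3)) + 2000 * q * (1 + |β| * L ^ 3 * N ^ 3) := by
  have hE0 := C.E0
  have hq' : (0:ℝ) < q := by exact_mod_cast hq
  have hsq : 0 < √(q:ℝ) := Real.sqrt_pos.mpr hq'
  by_cases hL : Nat.Coprime L q
  swap
  · have : ∑ n ∈ Ioc u v, pc (a / q + β) q (L * n) = 0 := by
      refine sum_eq_zero fun n _ => ?_
      unfold pc
      rw [if_neg]
      exact fun h => hL (Nat.Coprime.coprime_mul_right h)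
    rw [this, norm_zero]
    positivity
  obtain ⟨b, hb⟩ : ∃ b : ℤ, b = a * (L:ℤ) ^ 3 := ⟨_, rfl⟩
  have hbg : Int.gcd b q = 1 := by
    rw [← Int.isCoprime_iff_gcd_eq_one] at hg ⊢
    rw [hb]
    exact hg.mul_left (IsCoprime.pow_left (Nat.isCoprime_iff_coprime.mpr hL))
  obtain ⟨c, hc⟩ : ∃ c : ℤ → ℂ, c = fun n => if IsCoprime n (q:ℤ) then e ((b:ℝ) * (n:ℝ) ^ 3 / q) else 0 := ⟨_, rfl⟩
  have hper : ∀ n, c (n + q) = c n := by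
    intro n
    rw [hc]
    have h1 : IsCoprime (n + (q:ℤ)) (q:ℤ) ↔ IsCoprime n (q:ℤ) := by
      simpa using (IsCoprime.add_mul_left_left_iff (x := n) (y := (q:ℤ)) (z := 1))
    have h2 := e_per b q hq (n + q) n (by simp)
    simp only [h1]
    rw [h2]
  have hc1 : ∀ n, ‖c n‖ ≤ 1 := by
    intro n; rw [hc]; dsimp only; split_ifs
    · rw [e_norm]
    · simp
  have hm : ‖∑ x ∈ Ioc (q:ℤ) (q + q), c x‖ ≤ q * min 1 (3 * E ^ 6 / √q) := by
    rw [mul_min_of_nonneg _ _ hq'.le]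
    refine le_min ?_ ?_
    · refine (norm_sum_le _ _).trans ((sum_le_sum fun n _ => hc1 n).trans ?_)
      simp
    · have := GS C q q hq hqP dvd_rfl b hbg
      rw [sum_filter] at this
      rw [hc, ← two_mul]
      refine this.trans (le_of_eq ?_)
      ring
  have h := RC c q hq hper hc1 _ (min_le_left _ _) hm (β * L ^ 3) N hN u v (by exact_mod_cast hu) (by exact_mod_cast hv)
  rw [sumIoc] at h
  have e1 : ∑ n ∈ Ioc u v, pc (a / q + β) q (L * n) = ∑ n ∈ Ioc u v, c (n:ℤ) * e (β * L ^ 3 * (((n:ℕ):ℤ):ℝ) ^ 3) := by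
    refine sum_congr rfl fun n _ => ?_
    rw [hc]; unfold pc; dsimp only
    have h1 : (Nat.Coprime (L * n) q) ↔ IsCoprime (n:ℤ) (q:ℤ) := by
      rw [Nat.coprime_mul_iff_left, Nat.isCoprime_iff_coprime]; exact ⟨fun h => h.2, fun h => ⟨hL, h⟩⟩
    by_cases h2 : IsCoprime (n:ℤ) (q:ℤ)
    · rw [if_pos h2, if_pos (h1.mpr h2), ← e_add]
      unfold ph; congr 1; rw [hb]; push_cast; ring
    · rw [if_neg h2, if_neg (fun h => h2 (h1.mp h)), zero_mul]
  rw [e1]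
  have e2 : |β * (L:ℝ) ^ 3| = |β| * L ^ 3 := by rw [abs_mul, abs_of_nonneg (by positivity : (0:ℝ) ≤ (L:ℝ) ^ 3)]
  rw [e2] at h
  refine h.trans (add_le_add ?_ le_rfl)
  calc 6 * min 1 (3 * E ^ 6 / √q) * N / (1 + |β| * L ^ 3 * N ^ 3) ≤ 6 * (3 * E ^ 6 / √q) * N / (1 + |β| * L ^ 3 * N ^ 3) := by
        gcongr; exact min_le_right _ _
    _ = _ := by field_simp; ring

lemma p2_typeI (d : Dat P E D Y y ω) (a : ℤ) (q : ℕ) (hq : 0 < q) (hg : Int.gcd a q = 1) (β : ℝ)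
    (hQ : q * (1 + |β| * P ^ 3) ≤ D ^ 8 * E ^ 299) (hQ2 : D ^ 2 * E ^ 90 < q * (1 + |β| * P ^ 3))
    (i k j : ℕ) (hi : i < ω) (hj : 3 * ω < j) (hk : k = 0 ∨ 3 * ω < k ∧ k ≤ j)
    (h1 : 2 ^ (i + k + j) ≤ Y) (h2 : y ≤ 2 ^ (i + k + j + 6)) (u v : ℕ → ℕ → ℕ) (hu : ∀ l k, 2 ^ j ≤ u l k + 1) (hv : ∀ l k, v l k ≤ 2 ^ (j + 1)) :
    ∑ l ∈ Icc (2 ^ i) (2 ^ (i + 6)), ∑ k ∈ Icc (2 ^ k) (2 ^ (k + 1)), ‖∑ n ∈ Ioc (u l k) (v l k), pc (a / q + β) q (l * k * n)‖ ≤ P / (D * E ^ 22) := by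
  have hk0 : k = 0 := by
    rcases hk with h | ⟨h, h'⟩
    · exact h
    · exfalso
      have : 2 ^ (6 * ω) ≤ 2 ^ (i + k + j) := Nat.pow_le_pow_right (by norm_num) (by omega)
      have := d.hY6
      omega
  subst hk0
  rw [add_zero] at h1 h2
  have hE1 := d.C.E1
  have hE := d.C.hE
  have hE0 := d.C.E0
  have hD := d.hD
  have hD0 : 0 < D := by linarith
  have hP1 := d.C.P1
  have hP0 := d.C.P0
  have hq1 : (1:ℝ) ≤ q := by exact_mod_cast hq
  have hq0 : (0:ℝ) < q := by linarith
  have hsq : 0 < √(q:ℝ) := Real.sqrt_pos.mpr hq0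
  obtain ⟨w, hw⟩ : ∃ w : ℝ, w = 2 ^ ω := ⟨_, rfl⟩
  have hw1 : 1 ≤ w := by rw [hw]; exact one_le_pow₀ (by norm_num)
  have h6 : w ^ 6 ≤ P := by rw [hw]; exact d.w6
  have hpw : ∀ a b c : ℕ, a ≤ 2 * c → b ≤ 100 * c → D ^ a * E ^ b ≤ w ^ c := by rw [hw]; exact d.pw
  obtain ⟨I, hI⟩ : ∃ I : ℝ, I = 2 ^ i := ⟨_, rfl⟩
  obtain ⟨N, hN⟩ : ∃ N : ℝ, N = 2 ^ j := ⟨_, rfl⟩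
  have hIw : I ≤ w := by rw [hI, hw]; exact pow_le_pow_right₀ (by norm_num) hi.le
  have hI1 : 1 ≤ I := by rw [hI]; exact one_le_pow₀ (by norm_num)
  have hN1 : 1 ≤ N := by rw [hN]; exact one_le_pow₀ (by norm_num)
  have hY := d.Yt _ h1
  rw [pow_add, ← hI, ← hN] at hY
  have hPt := d.Pt _ h2
  rw [pow_add, pow_add, ← hI, ← hN] at hPt
  obtain ⟨R, hR⟩ : ∃ R : ℝ, R = 1 + |β| * P ^ 3 := ⟨_, rfl⟩
  rw [← hR] at hQ hQ2
  have hb0 : 0 ≤ |β| * P ^ 3 := by positivity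
  have hR1 : 1 ≤ R := by linarith
  have hqP : (q:ℝ) ≤ P ^ 20 := by
    calc (q:ℝ) ≤ q * R := le_mul_of_one_le_right hq0.le hR1
      _ ≤ w ^ 4 := hQ.trans (hpw 8 299 4 (by norm_num) (by norm_num))
      _ ≤ w ^ 6 := pow_le_pow_right₀ hw1 (by norm_num)
      _ ≤ P ^ 1 := by rw [pow_one]; exact h6
      _ ≤ P ^ 20 := pow_le_pow_right₀ hP1 (by norm_num)
  have hsQ : D * E ^ 45 ≤ √q * R := by
    have h3 : D * E ^ 45 ≤ √(q * R) := by
      refine Real.le_sqrt_of_sq_le (le_trans (le_of_eq ?_) hQ2.le)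
      ring
    refine h3.trans ?_
    rw [Real.sqrt_mul hq0.le]
    refine mul_le_mul_of_nonneg_left ?_ hsq.le
    rw [Real.sqrt_le_left (by linarith)]
    exact le_self_pow₀ hR1 (by norm_num)
  -- each inner sum
  have key : ∀ l ∈ Icc (2 ^ i) (2 ^ (i + 6)), ∀ k ∈ Icc (2 ^ 0) (2 ^ (0 + 1)), ‖∑ n ∈ Ioc (u l k) (v l k), pc (a / q + β) q (l * k * n)‖ ≤
      18 * E ^ 12 * N / (D * E ^ 45) + 2000 * (D ^ 8 * E ^ 299) := by
    intro l hl k hk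
    rw [mem_Icc] at hl hk
    have hl1 : I ≤ l := by rw [hI]; exact_mod_cast hl.1
    have hl2 : (l:ℝ) ≤ I * 2 ^ 6 := by rw [hI, ← pow_add]; exact_mod_cast hl.2
    have hk1 : (1:ℝ) ≤ k := by exact_mod_cast hk.1
    have hk2 : (k:ℝ) ≤ 2 := by exact_mod_cast hk.2
    have hL1 : I ≤ (l * k : ℕ) := by push_cast; exact hl1.trans (le_mul_of_one_le_right (by linarith) hk1)
    have hL2 : ((l * k : ℕ):ℝ) ≤ I * 2 ^ 6 * 2 := by push_cast; gcongr
    obtain ⟨L, hL⟩ : ∃ L : ℝ, L = ((l * k : ℕ):ℝ) := ⟨_, rfl⟩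
    have h := inner2 d.C a q hq hqP hg β N (l * k) hN1 (u l k) (v l k) (by rw [hN]; exact_mod_cast hu l k) (by
      have : ((v l k : ℕ):ℝ) ≤ 2 ^ (j + 1) := by exact_mod_cast hv l k
      rw [pow_succ, ← hN] at this; linarith)
    rw [← hL] at h hL1 hL2
    have hL0 : 0 < L := by linarith
    have hB1 : 1 + |β| * L ^ 3 * N ^ 3 ≤ R := by
      rw [hR, mul_assoc, ← mul_pow]
      have : L * N ≤ P := by
        calc L * N ≤ I * 2 ^ 6 * 2 * N := by gcongr
          _ ≤ P := by have : 0 ≤ I * N := by positivity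
                      linarith
      gcongr
    have hB2 : R ≤ E ^ 6 * (1 + |β| * L ^ 3 * N ^ 3) := by
      have h3 : P ≤ E ^ 2 * (L * N) := by
        calc P ≤ E * (I * N * 2 ^ 6) := hPt
          _ ≤ E * (L * N * E) := by gcongr; linarith
          _ = _ := by ring
      calc R = 1 + |β| * P ^ 3 := hR
        _ ≤ E ^ 6 + |β| * (E ^ 2 * (L * N)) ^ 3 := by
            have : 1 ≤ E ^ 6 := one_le_pow₀ hE1
            gcongr
        _ = _ := by ring
    have hB0 : 0 < 1 + |β| * L ^ 3 * N ^ 3 := by positivity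
    refine h.trans (add_le_add ?_ ?_)
    · rw [div_le_div_iff₀ (by positivity) (by positivity)]
      calc 18 * E ^ 6 * N * (D * E ^ 45) ≤ 18 * E ^ 6 * N * (√q * (E ^ 6 * (1 + |β| * L ^ 3 * N ^ 3))) := by
            refine mul_le_mul_of_nonneg_left (hsQ.trans ?_) (by positivity)
            exact mul_le_mul_of_nonneg_left hB2 hsq.le
        _ = _ := by ring
    · rw [mul_assoc]
      refine mul_le_mul_of_nonneg_left (le_trans ?_ hQ) (by norm_num)
      exact mul_le_mul_of_nonneg_left hB1 hq0.le
  have hb : 0 ≤ 18 * E ^ 12 * N / (D * E ^ 45) + 2000 * (D ^ 8 * E ^ 299) := by positivity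
  have hs : ∑ l ∈ Icc (2 ^ i) (2 ^ (i + 6)), ∑ k ∈ Icc (2 ^ 0) (2 ^ (0 + 1)), ‖∑ n ∈ Ioc (u l k) (v l k), pc (a / q + β) q (l * k * n)‖ ≤
      (I * 2 ^ 6) * (2 * (18 * E ^ 12 * N / (D * E ^ 45) + 2000 * (D ^ 8 * E ^ 299))) := by
    refine (sum_le_sum fun l hl => sum_le_sum fun k hk => key l hl k hk).trans ?_
    rw [sum_const, sum_const, nsmul_eq_mul, nsmul_eq_mul, Nat.card_Icc, Nat.card_Icc]
    have c1 : ((2 ^ (i + 6) + 1 - 2 ^ i : ℕ):ℝ) ≤ I * 2 ^ 6 := by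
      have : 1 ≤ 2 ^ i := Nat.one_le_two_pow
      have h3 : ((2 ^ (i + 6) + 1 - 2 ^ i : ℕ):ℝ) ≤ ((2 ^ (i + 6) : ℕ) : ℝ) := by
        exact Nat.cast_le.mpr (Nat.sub_le_of_le_add (Nat.add_le_add_left this _))
      refine h3.trans (le_of_eq ?_)
      rw [hI, ← pow_add]; push_cast; rfl
    refine mul_le_mul c1 (le_of_eq ?_) (by positivity) (by positivity)
    norm_num
  refine hs.trans ?_
  have t1 : (I * 2 ^ 6) * (2 * (18 * E ^ 12 * N / (D * E ^ 45))) ≤ P / (D * E ^ 22) / 2 := by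
    calc (I * 2 ^ 6) * (2 * (18 * E ^ 12 * N / (D * E ^ 45))) = 2304 * (I * N) / (D * E ^ 33) := by field_simp; norm_num
      _ ≤ P / (D * E ^ 33) := by
          refine div_le_div_of_nonneg_right ?_ (by positivity)
          have : 0 ≤ I * N := by positivity
          linarith
      _ ≤ P / (D * (2 * E ^ 22)) := by
          refine div_le_div_of_nonneg_left hP0.le (by positivity) ?_
          gcongr
          calc 2 * E ^ 22 ≤ E * E ^ 22 := by gcongr; linarith
            _ = E ^ 23 := by ring
            _ ≤ _ := pow_le_pow_right₀ hE1 (by norm_num)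
      _ = _ := by field_simp
  have t2 : (I * 2 ^ 6) * (2 * (2000 * (D ^ 8 * E ^ 299))) ≤ P / (D * E ^ 22) / 2 := by
    rw [div_div, le_div_iff₀ (by positivity)]
    calc I * 2 ^ 6 * (2 * (2000 * (D ^ 8 * E ^ 299))) * (D * E ^ 22 * 2) = 512000 * (I * (D ^ 9 * E ^ 321)) := by ring
      _ ≤ E * (w * (D ^ 9 * E ^ 321)) := by gcongr; linarith
      _ = w * (D ^ 9 * E ^ 322) := by ring
      _ ≤ w * w ^ 5 := mul_le_mul_of_nonneg_left (hpw 9 322 5 (by norm_num) (by norm_num)) (by linarith)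
      _ = w ^ 6 := by ring
      _ ≤ P := h6
  have e3 : (I * 2 ^ 6) * (2 * (18 * E ^ 12 * N / (D * E ^ 45) + 2000 * (D ^ 8 * E ^ 299))) =
    (I * 2 ^ 6) * (2 * (18 * E ^ 12 * N / (D * E ^ 45))) + (I * 2 ^ 6) * (2 * (2000 * (D ^ 8 * E ^ 299))) := by ring
  linarith

lemma pass2 (d : Dat P E D Y y ω) (a : ℤ) (q : ℕ) (hq : 0 < q) (hg : Int.gcd a q = 1) (β : ℝ)
    (hQ : q * (1 + |β| * P ^ 3) ≤ D ^ 8 * E ^ 299)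
    (hS : P / (2 * D) < ‖∑ n ∈ Icc y Y, (ArithmeticFunction.vonMangoldt n : ℂ) * pc (a / q + β) q n‖) :
    q * (1 + |β| * P ^ 3) ≤ D ^ 2 * E ^ 90 := by
  by_contra hno
  rw [not_le] at hno
  have hE := d.C.hE
  have hE0 := d.C.E0
  have hE1 := d.C.E1
  have hD := d.hD
  have hD0 : 0 < D := by linarith
  have hP0 := d.C.P0
  have hY0 : (0:ℝ) ≤ Y := by positivity
  have h := HB d.C Y y ω (3 * ω) (by linarith [d.hY]) d.hy d.hyY d.hY6 d.hP6 (by omega) d.yw (pc (a / q + β) q) √(P / (D ^ 2 * E ^ 68)) (P / (D * E ^ 22))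
    (Real.sqrt_nonneg _) (by positivity) (fun i i' hi hi2 h1 h2 => p2_typeII d a q hq hg β hQ hno i i' hi hi2 h1 h2)
    (fun i k j hi hj hk h1 h2 u v hu hv => p2_typeI d a q hq hg β hQ hno i k j hi hj hk h1 h2 u v hu hv)
  have e1 : √P * √(P / (D ^ 2 * E ^ 68)) = P / (D * E ^ 34) := by
    rw [← Real.sqrt_mul hP0.le, show P * (P / (D ^ 2 * E ^ 68)) = (P / (D * E ^ 34)) ^ 2 by field_simp, Real.sqrt_sq (by positivity)]
  rw [e1] at h
  have e2 : E ^ 33 * (P / (D * E ^ 34)) + E ^ 21 * (P / (D * E ^ 22)) = 2 * (P / D) / E := by field_simp; ring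
  rw [e2] at h
  have h3 : 2 * (P / D) / E ≤ P / (2 * D) := by
    rw [div_le_iff₀ hE0, show P / (2 * D) * E = (P / D) * (E / 2) by field_simp, mul_comm 2]
    gcongr; linarith
  linarith

end W3

namespace W3
open MeasureTheory Finset
open scoped Classical
variable {P E D : ℝ} {Y y ω : ℕ}

lemma primes_vs (d : Dat P E D Y y ω) (α : ℝ) (q : ℕ) (hq : 0 < q) (hqy : q < y ∨ q = 1) (hS : P / D < ‖∑ p ∈ (Icc y Y).filter Nat.Prime, (Real.log p : ℂ) * ph α p‖) :
    P / (2 * D) < ‖∑ n ∈ Icc y Y, (ArithmeticFunction.vonMangoldt n : ℂ) * pc α q n‖ := by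
  have hE := d.C.hE
  have hE0 := d.C.E0
  have hE1 := d.C.E1
  have hD := d.hD
  have hD0 : 0 < D := by linarith
  have hP0 := d.C.P0
  have hY1 : 1 ≤ Y := d.hy.trans d.hyY
  have hY1' : (1:ℝ) ≤ Y := by exact_mod_cast hY1
  have e1 : ∑ n ∈ Icc y Y, (ArithmeticFunction.vonMangoldt n : ℂ) * pc α q n = ∑ p ∈ (Icc y Y).filter Nat.Prime, (Real.log p : ℂ) * ph α p +
      ∑ n ∈ (Icc y Y).filter (fun n => ¬ Nat.Prime n), (ArithmeticFunction.vonMangoldt n : ℂ) * pc α q n := by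
    rw [← sum_filter_add_sum_filter_not (Icc y Y) Nat.Prime]
    congr 1
    refine sum_congr rfl fun p hp => ?_
    rw [mem_filter, mem_Icc] at hp
    rw [ArithmeticFunction.vonMangoldt_apply_prime hp.2]
    unfold pc
    rw [if_pos]
    rcases hqy with h | h
    · exact (Nat.coprime_of_lt_prime hq.ne' (by omega) hp.2)
    · rw [h]; exact Nat.coprime_one_right p
  have e2 : ‖∑ n ∈ (Icc y Y).filter (fun n => ¬ Nat.Prime n), (ArithmeticFunction.vonMangoldt n : ℂ) * pc α q n‖ ≤ 2 * √Y * Real.log Y := by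
    refine le_trans ?_ (Chebyshev.psi_sub_theta_le hY1')
    rw [Chebyshev.psi_sub_theta_eq_sum_not_prime, Nat.floor_natCast]
    refine (norm_sum_le _ _).trans ?_
    have h1 : ∀ n ∈ (Icc y Y).filter (fun n => ¬ Nat.Prime n), ‖(ArithmeticFunction.vonMangoldt n : ℂ) * pc α q n‖ ≤ ArithmeticFunction.vonMangoldt n := by
      intro n _
      rw [norm_mul, Complex.norm_real, Real.norm_of_nonneg ArithmeticFunction.vonMangoldt_nonneg]
      refine mul_le_of_le_one_right ArithmeticFunction.vonMangoldt_nonneg ?_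
      unfold pc ph
      split_ifs
      · rw [e_norm]
      · simp
    refine (sum_le_sum h1).trans ?_
    refine sum_le_sum_of_subset_of_nonneg ?_ fun _ _ _ => ArithmeticFunction.vonMangoldt_nonneg
    intro n hn
    rw [mem_filter, mem_Icc] at hn
    rw [mem_filter, mem_Ioc]
    have := d.hy
    exact ⟨⟨by omega, hn.1.2⟩, hn.2⟩
  have hYP : (Y:ℝ) ≤ P := by have := d.hY
                             linarith
  have e3 : 2 * √Y * Real.log Y ≤ P / (2 * D) := by
    have hlog : Real.log Y ≤ E := (Real.log_le_log (by linarith) hYP).trans d.C.hl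
    have hsq : √(Y:ℝ) ≤ √P := Real.sqrt_le_sqrt hYP
    have h3 : ((2:ℝ) ^ ω) ^ 3 ≤ √P := by
      refine Real.le_sqrt_of_sq_le (le_trans (le_of_eq ?_) d.w6)
      ring
    have h4 : 4 * D * E ≤ √P := by
      refine le_trans ?_ h3
      refine le_trans ?_ (d.pw 1 2 3 (by norm_num) (by norm_num))
      rw [pow_one]
      calc 4 * D * E ≤ E * D * E := by gcongr; linarith
        _ = _ := by ring
    rw [le_div_iff₀ (by positivity)]
    have h0 : 0 ≤ Real.log Y := Real.log_nonneg hY1'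
    calc 2 * √Y * Real.log Y * (2 * D) ≤ 2 * √P * E * (2 * D) := by gcongr
      _ = √P * (4 * D * E) := by ring
      _ ≤ √P * √P := by gcongr
      _ = P := Real.mul_self_sqrt hP0.le
  have e4 := norm_sub_le (∑ n ∈ Icc y Y, (ArithmeticFunction.vonMangoldt n : ℂ) * pc α q n)
    (∑ n ∈ (Icc y Y).filter (fun n => ¬ Nat.Prime n), (ArithmeticFunction.vonMangoldt n : ℂ) * pc α q n)
  have e5 : P / D = P / (2 * D) + P / (2 * D) := by field_simp; norm_num
  rw [e1, add_sub_cancel_right, ← e1] at e4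
  linarith

theorem finmain (d : Dat P E D Y y ω) (α : ℝ) (hS : P / D < ‖∑ p ∈ (Icc y Y).filter Nat.Prime, (Real.log p : ℂ) * ph α p‖) :
    ∃ (a : ℤ) (q : ℕ), 0 < q ∧ Int.gcd a q = 1 ∧ q * (1 + |α - a / q| * P ^ 3) ≤ D ^ 2 * E ^ 90 := by
  have h1 := primes_vs d α 1 one_pos (Or.inr rfl) hS
  have e1 : ∀ n, pc α 1 n = ph α n := fun n => by unfold pc; rw [if_pos (Nat.coprime_one_right n)]
  simp only [e1] at h1
  obtain ⟨a, q, hq, hg, hQ⟩ := pass1 d α h1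
  refine ⟨a, q, hq, hg, ?_⟩
  have hP0 := d.C.P0
  have hqy : q < y := by
    have hE1 := d.C.E1
    have hE0 := d.C.E0
    have hq0 : (0:ℝ) < q := by exact_mod_cast hq
    have h2 : (q:ℝ) ≤ D ^ 8 * E ^ 299 := by
      refine le_trans ?_ hQ
      exact le_mul_of_one_le_right hq0.le (by linarith [show 0 ≤ |α - a / q| * P ^ 3 by positivity])
    have h3 : (q:ℝ) < y := by
      have hE := d.C.hE
      have h4 : E * q < E * y := by
        calc E * q < E ^ 2 * q := by rw [sq]; gcongr; exact lt_mul_of_one_lt_right hE0 (by linarith)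
          _ ≤ E ^ 2 * (D ^ 8 * E ^ 299) := by gcongr
          _ = D ^ 8 * E ^ 301 := by ring
          _ ≤ ((2:ℝ) ^ ω) ^ 6 := d.pw 8 301 6 (by norm_num) (by norm_num)
          _ ≤ P := d.w6
          _ ≤ E * y := d.hyP
      exact lt_of_mul_lt_mul_left h4 hE0.le
    exact_mod_cast h3
  have hα : (a / q + (α - a / q) : ℝ) = α := by ring
  refine pass2 d a q hq hg (α - a / q) hQ ?_
  rw [hα]
  exact primes_vs d α q hq (Or.inl hqy) hS

end W3

namespace W3
open MeasureTheory Finset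
open scoped Classical

lemma divbound (δ : ℝ) (hδ : 0 < δ) : ∃ C : ℝ, 0 < C ∧ ∀ n : ℕ, (n.divisors.card : ℝ) ≤ C * (n:ℝ) ^ δ := by
  obtain ⟨A, hA1, hA⟩ : ∃ A : ℝ, 1 ≤ A ∧ 1 ≤ A * (δ * Real.log 2) := by
    have hl : 0 < δ * Real.log 2 := mul_pos hδ (Real.log_pos (by norm_num))
    refine ⟨1 + 1 / (δ * Real.log 2), ?_, ?_⟩
    · linarith [show 0 ≤ 1 / (δ * Real.log 2) by positivity]
    · rw [add_mul, one_div, inv_mul_cancel₀ hl.ne']; linarith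
  obtain ⟨B, hB⟩ : ∃ B : ℕ, (2:ℝ) ^ (1 / δ) ≤ B := exists_nat_ge _
  have hA0 : 0 < A := by linarith
  refine ⟨A ^ B, by positivity, fun n => ?_⟩
  rcases Nat.eq_zero_or_pos n with rfl | hn
  · simp; positivity
  have key : ∀ p ∈ n.primeFactors, ((n.factorization p + 1 : ℕ):ℝ) ≤ (if p < B then A else 1) * ((p:ℝ) ^ (n.factorization p)) ^ δ := by
    intro p hp
    have hp2 : (2:ℝ) ≤ p := by exact_mod_cast (Nat.prime_of_mem_primeFactors hp).two_le
    obtain ⟨a, ha⟩ : ∃ a, a = n.factorization p := ⟨_, rfl⟩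
    rw [← ha]
    have e1 : ((p:ℝ) ^ a) ^ δ = ((p:ℝ) ^ δ) ^ a := by
      rw [← Real.rpow_natCast, ← Real.rpow_natCast, ← Real.rpow_mul (by linarith), ← Real.rpow_mul (by linarith), mul_comm]
    rw [e1]
    push_cast
    split_ifs with h
    · have h1 : 1 + δ * Real.log 2 ≤ (p:ℝ) ^ δ := by
        calc 1 + δ * Real.log 2 ≤ Real.exp (δ * Real.log 2) := by linarith [Real.add_one_le_exp (δ * Real.log 2)]
          _ = 2 ^ δ := by rw [Real.rpow_def_of_pos (by norm_num), mul_comm]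
          _ ≤ _ := by gcongr
      have h2 : 1 + (a:ℝ) * (δ * Real.log 2) ≤ ((p:ℝ) ^ δ) ^ a := by
        refine (one_add_mul_le_pow ?_ a).trans (by gcongr)
        linarith [show 0 ≤ δ * Real.log 2 from (mul_pos hδ (Real.log_pos (by norm_num))).le]
      have h3 : (a:ℝ) * 1 ≤ a * (A * (δ * Real.log 2)) := by gcongr
      calc (a:ℝ) + 1 ≤ A * (1 + (a:ℝ) * (δ * Real.log 2)) := by linarith
        _ ≤ _ := by gcongr
    · have h1 : (2:ℝ) ≤ (p:ℝ) ^ δ := by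
        have h2 : (B:ℝ) ≤ p := by exact_mod_cast not_lt.mp h
        calc (2:ℝ) = ((2:ℝ) ^ (1 / δ)) ^ δ := by rw [← Real.rpow_mul (by norm_num), one_div, inv_mul_cancel₀ hδ.ne', Real.rpow_one]
          _ ≤ _ := by gcongr; exact hB.trans h2
      have h2 : 1 + (a:ℝ) * 1 ≤ ((p:ℝ) ^ δ) ^ a := (one_add_mul_le_pow (by norm_num) a).trans (by gcongr; linarith)
      linarith
  rw [Nat.card_divisors hn.ne']
  push_cast at key ⊢
  refine (prod_le_prod (fun _ _ => by positivity) key).trans ?_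
  rw [prod_mul_distrib]
  have e2 : ∏ p ∈ n.primeFactors, ((p:ℝ) ^ (n.factorization p)) ^ δ = (n:ℝ) ^ δ := by
    rw [Real.finsetProd_rpow _ _ (fun _ _ => by positivity)]
    congr 1
    have := Nat.prod_factorization_pow_eq_self hn.ne'
    rw [Finsupp.prod, Nat.support_factorization] at this
    exact_mod_cast this
  rw [e2]
  refine mul_le_mul_of_nonneg_right ?_ (by positivity)
  rw [← prod_filter, prod_const]
  refine pow_le_pow_right₀ hA1 ?_
  calc _ ≤ (range B).card := card_le_card (fun p hp => by
        rw [mem_filter] at hp; exact mem_range.mpr hp.2)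
    _ = B := card_range B

/-- all sufficiently large -/
lemma bigX (c K : ℝ) (hc : 0 < c) : ∀ᶠ X : ℝ in Filter.atTop, K ≤ X ^ c :=
  (tendsto_rpow_atTop hc).eventually_ge_atTop K

theorem main (ε : ℝ) (hε : 0 < ε) (η : ℝ) (hη : 0 < η) :
    ∃ X₀ : ℝ, ∀ X ≥ X₀, ∀ Z α : ℝ, X ^ ((1:ℝ)/3 - 1/36 + 2*ε) ≤ Z → Z ≤ X ^ ((1:ℝ)/3) → Z < ‖SS η X 3 α‖ →
      1 ≤ X ∧ 0 < Z ∧ ∃ (a : ℤ) (q : ℕ), 0 < q ∧ Int.gcd a q = 1 ∧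
        q * (1 + |α - a / q| * X) ≤ 4096 ^ 2 * (X ^ ((1:ℝ)/3 + ε) / Z) ^ 2 := by
  obtain ⟨δ, hδe⟩ : ∃ δ, δ = ε / 100 := ⟨_, rfl⟩
  have hδ : 0 < δ := by rw [hδe]; positivity
  obtain ⟨Cd, hCd, hdiv⟩ := divbound (δ / 40) (by positivity)
  obtain ⟨X₀, hX₀⟩ := Filter.eventually_atTop.mp ((Filter.eventually_ge_atTop (2:ℝ)).and ((bigX (δ / 2) (10 ^ 6) (by positivity)).and
    ((bigX (δ / 2) (80 / δ) (by positivity)).and ((bigX (δ / 2) Cd (by positivity)).and ((bigX (δ / 2) (4096 / η ^ ((1:ℝ)/3)) (by positivity)).and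
    ((bigX (2 / 3) 4096 (by norm_num)).and (bigX (3 * ε) (4096 ^ 2) (by positivity))))))))
  refine ⟨X₀, fun X hX Z α hZ1 hZ2 hS => ?_⟩
  obtain ⟨x2, x6, x80, xd, xη, x23, x3⟩ := hX₀ X hX
  have hX0 : 0 < X := by linarith
  have hX1 : 1 ≤ X := by linarith
  have hZ0 : 0 < Z := lt_of_lt_of_le (by positivity) hZ1
  refine ⟨hX1, hZ0, ?_⟩
  obtain ⟨F, hF⟩ : ∃ F, F = X ^ (δ / 2) := ⟨_, rfl⟩
  obtain ⟨E, hE⟩ : ∃ E, E = X ^ δ := ⟨_, rfl⟩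
  obtain ⟨p, hp⟩ : ∃ p, p = X ^ ((1:ℝ)/3) := ⟨_, rfl⟩
  rw [← hF] at x6 x80 xd xη
  have hEF : E = F * F := by rw [hE, hF, ← Real.rpow_add hX0]; ring_nf
  have hF0 : 0 < F := by linarith
  have hFE : F ≤ E := by rw [hEF]; exact le_mul_of_one_le_left hF0.le (by linarith)
  have hp0 : 0 < p := by rw [hp]; positivity
  have hp1 : 1 ≤ p := by rw [hp]; exact Real.one_le_rpow hX1 (by norm_num)
  have hp3 : p ^ 3 = X := by rw [hp, ← Real.rpow_natCast, ← Real.rpow_mul hX0.le]; norm_num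
  have hPX : 4096 * p ≤ X := by
    calc 4096 * p ≤ X ^ ((2:ℝ)/3) * p := by gcongr
      _ = X := by rw [hp, ← Real.rpow_add hX0]; norm_num
  have hlogX : 40 * Real.log X ≤ E := by
    have h1 := Real.log_le_rpow_div hX0.le (show 0 < δ / 2 by positivity)
    rw [← hF] at h1
    rw [hEF]
    calc 40 * Real.log X ≤ 40 * (F / (δ / 2)) := by gcongr
      _ = 80 / δ * F := by field_simp; norm_num
      _ ≤ F * F := by gcongr
  have hlog0 : 0 ≤ Real.log X := Real.log_nonneg hX1
  have hlogP : Real.log (4096 * p) ≤ Real.log X := Real.log_le_log (by positivity) hPX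
  have C : Ctx (4096 * p) E := by
    refine ⟨by linarith, by linarith, ?_, by linarith, ?_⟩
    · intro k hk
      have h1 := Real.log_le_log (by positivity) hk
      rw [Real.log_pow, Real.log_pow] at h1
      have h2 : (1:ℝ) / 2 ≤ Real.log 2 := by linarith [Real.log_two_gt_d9]
      have h3 : (k:ℝ) * (1 / 2) ≤ k * Real.log 2 := by gcongr
      push_cast at h1
      linarith
    · intro n hn
      refine (hdiv n).trans ?_
      rw [hEF]
      refine mul_le_mul xd ?_ (by positivity) hF0.le
      have h1 : (n:ℝ) ≤ X ^ 20 := hn.trans (by gcongr)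
      calc (n:ℝ) ^ (δ / 40) ≤ (X ^ 20) ^ (δ / 40) := by gcongr
        _ = F := by
          rw [hF, ← Real.rpow_natCast, ← Real.rpow_mul hX0.le]; congr 1; push_cast; ring
  obtain ⟨Y, hY⟩ : ∃ Y : ℕ, Y = ⌊p⌋₊ := ⟨_, rfl⟩
  obtain ⟨y, hy⟩ : ∃ y : ℕ, y = ⌈(η * X) ^ ((1:ℝ)/3)⌉₊ := ⟨_, rfl⟩
  have hy1 : 1 ≤ y := by rw [hy]; exact Nat.one_le_iff_ne_zero.mpr (Nat.ceil_pos.mpr (by positivity)).ne'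
  have hSS : SS η X 3 α = ∑ p ∈ (Icc y Y).filter Nat.Prime, (Real.log p : ℂ) * ph α p := by
    unfold SS
    have hset : (Icc 1 ⌊X ^ ((1:ℝ)/((3:ℕ):ℝ))⌋₊).filter (fun n : ℕ => n.Prime ∧ (η * X) ^ ((1:ℝ)/((3:ℕ):ℝ)) ≤ (n:ℝ)) = (Icc y Y).filter Nat.Prime := by
      ext n
      simp only [mem_filter, mem_Icc, Nat.cast_ofNat, hy, hY, hp, Nat.ceil_le]
      constructor
      · rintro ⟨⟨h1, h2⟩, h3, h4⟩; exact ⟨⟨h4, h2⟩, h3⟩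
      · rintro ⟨⟨h4, h2⟩, h3⟩; exact ⟨⟨h3.one_lt.le, h2⟩, h3, h4⟩
    rw [hset]
    refine sum_congr rfl fun n _ => ?_
    unfold ph
    rw [mul_comm α]
  rw [hSS] at hS
  have hyY : y ≤ Y := by
    by_contra h
    rw [Icc_eq_empty h] at hS
    simp at hS
    linarith
  have hYp : (Y:ℝ) ≤ p := by rw [hY]; exact Nat.floor_le hp0.le
  have hY1 : Y ≠ 0 := by omega
  obtain ⟨ω, hω⟩ : ∃ ω, ω = Nat.log 2 Y / 6 + 1 := ⟨_, rfl⟩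
  have hω1 : Y < 2 ^ (6 * ω) := lt_of_lt_of_le (Nat.lt_pow_succ_log_self (by norm_num) Y) (Nat.pow_le_pow_right (by norm_num) (by omega))
  have hω2 : (2:ℝ) ^ (6 * ω) ≤ 4096 * p := by
    have h1 : 2 ^ (6 * ω) ≤ 2 ^ (Nat.log 2 Y + 6) := Nat.pow_le_pow_right (by norm_num) (by omega)
    have h2 := Nat.pow_log_le_self 2 hY1
    have h3 : 2 ^ (6 * ω) ≤ Y * 64 := h1.trans (by rw [pow_add]; exact Nat.mul_le_mul_right _ h2)
    have h4 : (2:ℝ) ^ (6 * ω) ≤ Y * 64 := by exact_mod_cast h3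
    linarith
  have hω3 : X ^ ((1:ℝ)/18) ≤ 2 ^ ω := by
    have h1 : p < Y + 1 := by rw [hY]; exact Nat.lt_floor_add_one p
    have h2 : (Y:ℝ) + 1 ≤ 2 ^ (6 * ω) := by exact_mod_cast hω1
    have h3 : (X ^ ((1:ℝ)/18)) ^ 6 ≤ ((2:ℝ) ^ ω) ^ 6 := by
      rw [← pow_mul, mul_comm ω, ← Real.rpow_natCast, ← Real.rpow_mul hX0.le]
      have : (1:ℝ)/18 * ((6:ℕ):ℝ) = 1/3 := by norm_num
      rw [this, ← hp]; linarith
    exact le_of_pow_le_pow_left₀ (by norm_num) (by positivity) h3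
  obtain ⟨D, hD⟩ : ∃ D, D = 4096 * p / Z := ⟨_, rfl⟩
  rw [← hp] at hZ2
  have hd : Dat (4096 * p) E D Y y ω := by
    refine ⟨C, by linarith, hy1, hyY, ?_, hω1, hω2, ?_, ?_⟩
    · have h1 : (η * X) ^ ((1:ℝ)/3) ≤ y := by rw [hy]; exact Nat.le_ceil _
      rw [Real.mul_rpow hη.le hX0.le, ← hp] at h1
      rw [div_le_iff₀ (by positivity)] at xη
      calc 4096 * p ≤ F * η ^ ((1:ℝ)/3) * p := by gcongr
        _ = F * (η ^ ((1:ℝ)/3) * p) := by ring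
        _ ≤ E * y := by
            have : 0 ≤ E := by linarith
            gcongr
    · rw [hD, le_div_iff₀ hZ0]; linarith
    · have h1 : D ≤ 4096 * X ^ ((1:ℝ)/36 - 2 * ε) := by
        rw [hD, div_le_iff₀ hZ0]
        calc 4096 * p = 4096 * X ^ ((1:ℝ)/36 - 2 * ε) * X ^ ((1:ℝ)/3 - 1/36 + 2*ε) := by
              rw [mul_assoc, ← Real.rpow_add hX0, hp]; congr 2; ring
          _ ≤ _ := by gcongr
      have hD0 : 0 ≤ D := by rw [hD]; positivity
      have h2 : E ^ 100 = X ^ ε := by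
        rw [hE, ← Real.rpow_natCast, ← Real.rpow_mul hX0.le, hδe]; congr 1; push_cast; ring
      rw [h2]
      calc D ^ 2 * X ^ ε ≤ (4096 * X ^ ((1:ℝ)/36 - 2 * ε)) ^ 2 * X ^ ε := by gcongr
        _ = 4096 ^ 2 * (X ^ ((1:ℝ)/36 - 2 * ε) * X ^ ((1:ℝ)/36 - 2 * ε) * X ^ ε) := by ring
        _ ≤ X ^ (3 * ε) * (X ^ ((1:ℝ)/36 - 2 * ε) * X ^ ((1:ℝ)/36 - 2 * ε) * X ^ ε) := by gcongr
        _ = X ^ ((1:ℝ)/18) := by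
            rw [← Real.rpow_add hX0, ← Real.rpow_add hX0, ← Real.rpow_add hX0]; congr 1; ring
        _ ≤ _ := hω3
  obtain ⟨a, q, hq, hg, hQ⟩ := finmain hd α (by
    have : 4096 * p / D = Z := by rw [hD]; field_simp
    rw [this]; exact hS)
  refine ⟨a, q, hq, hg, ?_⟩
  have h1 : E ^ 90 ≤ X ^ ε * X ^ ε := by
    rw [hE, ← Real.rpow_natCast, ← Real.rpow_mul hX0.le, ← Real.rpow_add hX0]
    refine Real.rpow_le_rpow_of_exponent_le hX1 ?_
    rw [hδe]; push_cast; linarith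
  have h2 : X ≤ (4096 * p) ^ 3 := by rw [mul_pow, hp3]; linarith
  calc q * (1 + |α - a / q| * X) ≤ q * (1 + |α - a / q| * (4096 * p) ^ 3) := by gcongr
    _ ≤ D ^ 2 * E ^ 90 := hQ
    _ ≤ D ^ 2 * (X ^ ε * X ^ ε) := by gcongr
    _ = _ := by rw [hD, Real.rpow_add hX0, ← hp]; ring

end W3

/-- rational approximation from large values of `S₃(λα)`. -/
theorem S3_large_values_rational_approx (lam : ℝ) (hlam : lam ≠ 0)
    (ε : ℝ) (hε : 0 < ε) (η : ℝ) (hη : 0 < η) (hη1 : η < 1) :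
    ∃ C > (0:ℝ), ∃ X₀ : ℝ, ∀ X ≥ X₀, ∀ Z α : ℝ,
      X ^ ((1:ℝ)/3 - 1/36 + 2*ε) ≤ Z → Z ≤ X ^ ((1:ℝ)/3) →
      Z < ‖SS η X 3 (lam * α)‖ →
      ∃ a q : ℤ, Int.gcd a q = 1 ∧ 1 ≤ q ∧
        (q : ℝ) ≤ C * (X ^ ((1:ℝ)/3 + ε) / Z) ^ 2 ∧
        |(q : ℝ) * lam * α - (a : ℝ)| ≤ C * X⁻¹ * (X ^ ((1:ℝ)/3 + ε) / Z) ^ 2 := by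
  obtain ⟨X₀, h⟩ := W3.main ε hε η hη
  refine ⟨4096 ^ 2, by norm_num, X₀, fun X hX Z α h1 h2 h3 => ?_⟩
  obtain ⟨hX1, hZ0, a, q, hq, hg, hQ⟩ := h X hX Z (lam * α) h1 h2 h3
  have hX0 : 0 < X := by linarith
  have hq0 : (0:ℝ) < q := by exact_mod_cast hq
  have hab := abs_nonneg (lam * α - a / q)
  refine ⟨a, q, hg, by exact_mod_cast hq, ?_, ?_⟩
  · refine le_trans ?_ hQ
    push_cast
    exact le_mul_of_one_le_right hq0.le (by linarith [mul_nonneg hab hX0.le])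
  · have e1 : ((q:ℤ):ℝ) * lam * α - a = q * (lam * α - a / q) := by
      push_cast; field_simp
    rw [e1, abs_mul, abs_of_pos hq0]
    refine le_of_mul_le_mul_right ?_ hX0
    calc (q:ℝ) * |lam * α - a / q| * X ≤ q * (1 + |lam * α - a / q| * X) := by
          rw [mul_assoc]; exact mul_le_mul_of_nonneg_left (by linarith) hq0.le
      _ ≤ _ := hQ
      _ = _ := by field_simp
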